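/- Co-periodic comajors are dense in C_sCL: for every comajor c (of any cubic symmetric lamination) and every ε > 0, there exists a co-periodic comajor c' whose endpoints can be matched with the endpoints of c so that corresponding endpoints are at circle distance less than ε. -/

import Mathlib

noncomputable section

open Set Metric

instance : Fact ((0:ℝ) < 1) := ⟨one_pos⟩

/-- The circle `S = ℝ/ℤ`. -/
abbrev S1 : Type := AddCircle (1 : ℝ)

/-- The tripling map `σ₃ : x ↦ 3x (mod 1)`. -/
def s3 : S1 → S1 := fun x => (3 : ℕ) • x

/-- The antipodal map `x ↦ x + 1/2` (denoted `−x` in the paper). -/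
def antip : S1 → S1 := fun x => x + (((1:ℝ)/2 : ℝ) : S1)

/-- A chord of the circle: an unordered pair of points of `S1`. -/
abbrev Chord : Type := Sym2 S1

/-- The image chord of a chord under a circle map. -/
def cmap (f : S1 → S1) (ℓ : Chord) : Chord := Sym2.map f ℓ

/-- The length of a chord `{a,b}`: the shorter of the two arcs joining `a` and `b`
(the natural norm on `ℝ/ℤ`). -/
def chordLen : Chord → ℝ :=
  Sym2.lift ⟨fun a b => ‖a - b‖, fun a b => norm_sub_rev a b⟩

/-- The standard embedding of the circle `ℝ/ℤ` into `ℂ` (onto the unit circle). -/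
def toC (x : S1) : ℂ :=
  Complex.exp (2 * Real.pi * Complex.I * (((AddCircle.equivIco 1 0 x : Set.Ico (0:ℝ) (0+1)) : ℝ) : ℂ))

/-- The geometric chord in the closed unit disk of `ℂ` determined by an
unordered pair of circle points. -/
def chordSet : Chord → Set ℂ :=
  Sym2.lift ⟨fun a b => segment ℝ (toC a) (toC b), fun a b => segment_symm ℝ _ _⟩

/-- Two chords cross if their endpoints strictly alternate on the circle. -/
def Crosses (ℓ₁ ℓ₂ : Chord) : Prop :=
  (∃ a b c d : ℝ, a < b ∧ b < c ∧ c < d ∧ d < a + 1 ∧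
    ℓ₁ = s(((a : ℝ) : S1), ((c : ℝ) : S1)) ∧ ℓ₂ = s(((b : ℝ) : S1), ((d : ℝ) : S1))) ∨
  (∃ a b c d : ℝ, a < b ∧ b < c ∧ c < d ∧ d < a + 1 ∧
    ℓ₂ = s(((a : ℝ) : S1), ((c : ℝ) : S1)) ∧ ℓ₁ = s(((b : ℝ) : S1), ((d : ℝ) : S1)))

/-- A critical chord: nondegenerate with degenerate `σ₃`-image. -/
def IsCritical (ℓ : Chord) : Prop := ¬ ℓ.IsDiag ∧ (cmap s3 ℓ).IsDiag

/-- The union in `ℂ` of all the chords of a family. -/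
def unionSet (L : Set Chord) : Set ℂ := ⋃ ℓ ∈ L, chordSet ℓ

def openDisk : Set ℂ := Metric.ball (0:ℂ) 1
def closedDisk : Set ℂ := Metric.closedBall (0:ℂ) 1

/-- A lamination: a family of pairwise non-crossing chords whose union is closed. -/
structure IsLamination (L : Set Chord) : Prop where
  nocross : ∀ ℓ₁ ∈ L, ∀ ℓ₂ ∈ L, ¬ Crosses ℓ₁ ℓ₂
  closed : IsClosed (unionSet L)

/-- A sibling collection: three pairwise disjoint chords with the same
nondegenerate `σ₃`-image. -/
def IsSiblingCollection (ℓ₁ ℓ₂ ℓ₃ : Chord) : Prop :=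
  Disjoint (chordSet ℓ₁) (chordSet ℓ₂) ∧ Disjoint (chordSet ℓ₁) (chordSet ℓ₃) ∧
  Disjoint (chordSet ℓ₂) (chordSet ℓ₃) ∧
  ¬ (cmap s3 ℓ₁).IsDiag ∧ cmap s3 ℓ₂ = cmap s3 ℓ₁ ∧ cmap s3 ℓ₃ = cmap s3 ℓ₁

/-- A `σ₃`-invariant lamination. -/
structure IsInvLam (L : Set Chord) extends IsLamination L : Prop where
  forward : ∀ ℓ ∈ L, cmap s3 ℓ ∈ L ∨ (cmap s3 ℓ).IsDiag
  backward : ∀ ℓ ∈ L, ∃ ℓ' ∈ L, cmap s3 ℓ' = ℓ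
  siblings : ∀ ℓ ∈ L, ¬ (cmap s3 ℓ).IsDiag →
    ∃ ℓ₂ ∈ L, ∃ ℓ₃ ∈ L, IsSiblingCollection ℓ ℓ₂ ℓ₃

/-- A cubic symmetric lamination. -/
structure IsCubicSymLam (L : Set Chord) extends IsInvLam L : Prop where
  symm : ∀ ℓ ∈ L, cmap antip ℓ ∈ L

/-- A major: a leaf whose length is closest to `1/3` among all leaves. -/
def IsMajor (L : Set Chord) (M : Chord) : Prop :=
  M ∈ L ∧ ∀ ℓ ∈ L, |1/3 - chordLen M| ≤ |1/3 - chordLen ℓ|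

/-- A minor: the `σ₃`-image of a major. -/
def IsMinor (L : Set Chord) (m : Chord) : Prop := ∃ M, IsMajor L M ∧ m = cmap s3 M

/-- A comajor: a short (or degenerate) sibling of a major, disjoint from all majors. -/
def IsComajor (L : Set Chord) (c : Chord) : Prop :=
  (chordLen c < 1/6 ∨ c.IsDiag) ∧ (¬ c.IsDiag → c ∈ L) ∧
  (∃ M, IsMajor L M ∧ cmap s3 c = cmap s3 M) ∧
  (∀ M, IsMajor L M → Disjoint (chordSet c) (chordSet M))

/-- The cubic symmetric comajor lamination: all comajors of all cubic symmetric
laminations. -/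
def CsCL : Set Chord := {c | ∃ L, IsCubicSymLam L ∧ IsComajor L c}

/-- A chord is periodic if some positive iterate of `σ₃` fixes it. -/
def ChordPeriodic (c : Chord) : Prop := ∃ p, 1 ≤ p ∧ cmap (s3^[p]) c = c

/-- A comajor is co-periodic if its image is periodic but it is not. -/
def CoPeriodic (c : Chord) : Prop := ChordPeriodic (cmap s3 c) ∧ ¬ ChordPeriodic c

/-- The point of the unit circle in `ℂ` with argument `2πt`. -/
def circPt (t : ℝ) : ℂ := toC ((t : ℝ) : S1)

/-- The (closed) arc of the circle in `ℂ` from angle `u` to angle `v` (traversed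
positively), as a subset of `ℂ`. -/
def arcSet (u v : ℝ) : Set ℂ := circPt '' Set.Icc u v

/-- The unordered arc between angles `u` and `v`. -/
def arcSetU (u v : ℝ) : Set ℂ := circPt '' Set.uIcc u v

/-- The closed region `R(n)` bounded by the chord from angle `a` to angle `a+t`
(with `t` the length of the chord) and the corresponding (shorter) arc `H(n)`:
the convex hull of that arc. -/
def regionUnder (a t : ℝ) : Set ℂ := convexHull ℝ (arcSet a (a + t))

/-- `Under m n` (`m ≺ n`): `m` is contained in the region `R(n)`. -/
def Under (m n : Chord) : Prop :=
  ∃ a t : ℝ, 0 ≤ t ∧ t < 1/2 ∧ t = chordLen n ∧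
    n = s(((a : ℝ) : S1), ((a + t : ℝ) : S1)) ∧ chordSet m ⊆ regionUnder a t

/-- The (closed) strip `C(ℓ)` between the medium/long chord `ℓ` from angle `a` to
angle `a+t` (with `1/6 < t ≤ 1/2` its length) and its medium/long sibling
`ℓ' = {a+1/3, a+t-1/3}`. -/
def stripSet (a t : ℝ) : Set ℂ :=
  convexHull ℝ (arcSetU (a + t) (a + 1/3) ∪ arcSetU (a + t - 1/3) a)

/-- The short strips `SH(ℓ) = C(ℓ) ∪ −C(ℓ)`. -/
def SHSet (a t : ℝ) : Set ℂ := stripSet a t ∪ stripSet (a + 1/2) t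

/-- For a short chord `c` from angle `a` to angle `a+t` (`0 ≤ t < 1/6`), the strip
`C(M_c)` between the two medium/long chords `M_c = {a+2/3, a+t+1/3}` and
`M'_c = {a+1/3, a+t+2/3}` having the same `σ₃`-image as `c`. -/
def QStrip (a t : ℝ) : Set ℂ :=
  convexHull ℝ (arcSet (a + 1/3) (a + t + 1/3) ∪ arcSet (a + 2/3) (a + t + 2/3))

/-- A legal (symmetric) pair `{c, −c}`. -/
def IsLegalPair (c : Chord) : Prop :=
  c.IsDiag ∨
  ∃ a t : ℝ, 0 < t ∧ t < 1/6 ∧ t = chordLen c ∧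
    c = s(((a : ℝ) : S1), ((a + t : ℝ) : S1)) ∧
    (∀ i j : ℕ,
      ¬ Crosses (cmap (s3^[i]) c) (cmap (s3^[j]) c) ∧
      ¬ Crosses (cmap (s3^[i]) c) (cmap (s3^[j]) (cmap antip c)) ∧
      ¬ Crosses (cmap (s3^[i]) (cmap antip c)) (cmap (s3^[j]) (cmap antip c))) ∧
    (∀ i : ℕ, 1 ≤ i →
      chordSet (cmap (s3^[i]) c) ∩ interior (QStrip a t ∪ QStrip (a + 1/2) t) = ∅)

/-- A gap of a lamination: the closure of a connected component of the complement,
in the open unit disk, of the union of the leaves. -/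
def IsGapOf (L : Set Chord) (G : Set ℂ) : Prop :=
  ∃ z ∈ openDisk \ unionSet L, G = closure (connectedComponentIn (openDisk \ unionSet L) z)

/-- The vertices of a gap: its points on the circle. -/
def gapVerts (G : Set ℂ) : Set S1 := {x : S1 | toC x ∈ G}

/-- The image of a gap: the convex hull of the `σ₃`-image of its vertex set. -/
def gapImage (G : Set ℂ) : Set ℂ := convexHull ℝ (toC '' (s3 '' gapVerts G))

/-- Iterated gap images. -/
def gapIter (n : ℕ) (G : Set ℂ) : Set ℂ := gapImage^[n] G

/-- An edge of a gap: a nondegenerate chord contained in its boundary. -/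
def IsEdgeOf (G : Set ℂ) (ℓ : Chord) : Prop := ¬ ℓ.IsDiag ∧ chordSet ℓ ⊆ frontier G

/-- The (first return) map `σ₃^p` on the gap `G` has degree greater than one:
some edge of the image gap has (at least) two disjoint preimage edges in `G`. -/
def GapDegreeGE2 (G : Set ℂ) (p : ℕ) : Prop :=
  ∃ m e₁ e₂ : Chord, IsEdgeOf (gapIter p G) m ∧ e₁ ≠ e₂ ∧
    IsEdgeOf G e₁ ∧ IsEdgeOf G e₂ ∧ Disjoint (chordSet e₁) (chordSet e₂) ∧
    cmap (s3^[p]) e₁ = m ∧ cmap (s3^[p]) e₂ = m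

/-- `L` has a periodic infinite gap of degree greater than one (hyperbolicity). -/
def HasHyperbolicGap (L : Set Chord) : Prop :=
  ∃ G p, IsGapOf L G ∧ (gapVerts G).Infinite ∧ 1 ≤ p ∧ gapIter p G = G ∧ GapDegreeGE2 G p

/-- Two circle points are joined by a finite concatenation of leaves of `L`. -/
def ChainJoined (L : Set Chord) : S1 → S1 → Prop :=
  Relation.ReflTransGen (fun x y => ∃ ℓ ∈ L, x ∈ ℓ ∧ y ∈ ℓ)

/-- A q-lamination: points joined by finite concatenations of leaves are vertices of
a single leaf or finite gap. -/
def IsQLam (L : Set Chord) : Prop :=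
  ∀ x y : S1, ChainJoined L x y →
    x = y ∨ (∃ ℓ ∈ L, x ∈ ℓ ∧ y ∈ ℓ) ∨
    (∃ G, IsGapOf L G ∧ (gapVerts G).Finite ∧ toC x ∈ G ∧ toC y ∈ G)

/-- A periodic point of `σ₃`. -/
def PerPt (x : S1) : Prop := ∃ p, 1 ≤ p ∧ s3^[p] x = x

/-- An eventually periodic point of `σ₃`. -/
def EvPerPt (x : S1) : Prop := ∃ k, PerPt (s3^[k] x)

/-- `x` is strictly preperiodic of preperiod `k ≥ 1` and period `p`. -/
def StrictPreper (x : S1) (k p : ℕ) : Prop :=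
  1 ≤ k ∧ 1 ≤ p ∧ s3^[p] (s3^[k] x) = s3^[k] x ∧
  (∀ j < k, ¬ PerPt (s3^[j] x)) ∧
  (∀ q, 1 ≤ q → s3^[q] (s3^[k] x) = s3^[k] x → p ≤ q)

/-- A periodic point of type B: of period `2n` with `σ₃ⁿ(x) = −x`. -/
def TypeB (x : S1) : Prop :=
  ∃ n, 1 ≤ n ∧ Function.minimalPeriod s3 x = 2 * n ∧ s3^[n] x = antip x

/-- `c` is a two-sided limit of chords of the family `A`: within every complementary
component of the disk minus `c` there are chords of `A` converging to `c`. -/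
def TwoSidedLimitOf (A : Set Chord) (c : Chord) : Prop :=
  ∀ z ∈ closedDisk \ chordSet c, ∀ ε : ℝ, 0 < ε →
    ∃ d ∈ A, d ≠ c ∧ chordSet d ⊆ connectedComponentIn (closedDisk \ chordSet c) z ∧
      Metric.hausdorffDist (chordSet d) (chordSet c) < ε

/-- The chord `n` weakly separates the chords `ℓ₁` and `ℓ₂`. -/
def WeaklySep (n ℓ₁ ℓ₂ : Chord) : Prop :=
  ∃ z₁ ∈ chordSet ℓ₁ \ chordSet n, ∃ z₂ ∈ chordSet ℓ₂ \ chordSet n,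
    chordSet ℓ₁ \ chordSet n ⊆ connectedComponentIn (closedDisk \ chordSet n) z₁ ∧
    chordSet ℓ₂ \ chordSet n ⊆ connectedComponentIn (closedDisk \ chordSet n) z₂ ∧
    connectedComponentIn (closedDisk \ chordSet n) z₁ ≠
      connectedComponentIn (closedDisk \ chordSet n) z₂

/-- The (non-diameter, non-fixed) chord `ℓ` moves in under the circle map `h`. -/
def MovesIn (h : S1 → S1) (ℓ : Chord) : Prop := cmap h ℓ ≠ ℓ ∧ Under (cmap h ℓ) ℓ

/-- The chord `ℓ` moves out under the circle map `h`. -/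
def MovesOut (h : S1 → S1) (ℓ : Chord) : Prop := cmap h ℓ ≠ ℓ ∧ ¬ Under (cmap h ℓ) ℓ

namespace Comajor

/-- The cells cut out by the siblings of a symmetric pair of short chords. -/
inductive Cl | p1 | pm | p0 | q1 | q2 | q4 | q5

namespace Cl
/-- Left endpoint of a cell (for the short chord from `a` to `a + t`). -/
def lo (a t : ℝ) : Cl → ℝ
  | p1 => a + t + 1/3 | pm => a + t + 5/6 | p0 => a + t + 1/6
  | q1 => a + 1/6 | q2 => a + 1/3 | q4 => a + 2/3 | q5 => a + 5/6
/-- Width of the arcs of a cell. -/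
def wid (t : ℝ) : Cl → ℝ
  | p1 => 1/3 - t | pm => 1/3 - t | p0 => 1/6 - t
  | q1 => t | q2 => t | q4 => t | q5 => t
/-- Twice the period of a cell. -/
def pp : Cl → ℤ
  | p0 => 1 | _ => 2
/-- The central cells. -/
def isP : Cl → Prop
  | p1 => True | pm => True | p0 => True | _ => False
/-- The antipodal cell. -/
def neg : Cl → Cl
  | p1 => pm | pm => p1 | p0 => p0 | q1 => q4 | q4 => q1 | q2 => q5 | q5 => q2

lemma isP_neg {C : Cl} (h : C.isP) : C.neg.isP := by cases C <;> simp_all [isP, neg]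

lemma pp_cases (C : Cl) : C.pp = 1 ∨ C.pp = 2 := by cases C <;> simp [pp]

lemma pp_cases_real (C : Cl) : (C.pp : ℝ) = 1 ∨ (C.pp : ℝ) = 2 := by
  cases C <;> simp [pp]

lemma three_wid_lt {t : ℝ} (ht : 0 < t) (ht6 : t < 1/6) (C : Cl) : 6 * C.wid t < C.pp := by
  cases C <;> simp [pp, wid] <;> linarith

lemma wid_pos {t : ℝ} (ht : 0 < t) (ht6 : t < 1/6) (C : Cl) : 0 < C.wid t := by
  cases C <;> simp [wid] <;> linarith

lemma isP_wid {t : ℝ} {C : Cl} (h : C.isP) : 3 * C.wid t + 3 * t = C.pp / 2 := by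
  cases C <;> simp_all [pp, wid, isP] <;> ring

lemma isP_lo {a t : ℝ} {C : Cl} (h : C.isP) : ∃ c : ℤ, 3 * C.lo a t = 3 * a + 3 * t + c / 2 := by
  cases C <;> simp_all [lo, isP]
  · exact ⟨2, by push_cast; ring⟩
  · exact ⟨5, by push_cast; ring⟩
  · exact ⟨1, by push_cast; ring⟩
end Cl

/-- Membership of (the class modulo one of) a real number in a cell. -/
def In (a t : ℝ) (C : Cl) (x : ℝ) : Prop :=
  ∃ n : ℤ, C.lo a t ≤ x - C.pp / 2 * n ∧ x - C.pp / 2 * n ≤ C.lo a t + C.wid t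

/-- A lift of the tripling map which is monotone on the cell. -/
def psi (a t : ℝ) (C : Cl) (x : ℝ) : ℝ :=
  3 * x - C.pp * ⌊(x - C.lo a t) / (C.pp / 2)⌋

section
variable {a t : ℝ}

lemma In.add_int {C : Cl} {x : ℝ} (h : In a t C x) (m : ℤ) : In a t C (x + m) := by
  obtain ⟨n, h1, h2⟩ := h
  rcases C.pp_cases_real with hp | hp
  · refine ⟨n + 2 * m, ?_, ?_⟩ <;> simp only [hp] at h1 h2 ⊢ <;> push_cast <;> linarith
  · refine ⟨n + m, ?_, ?_⟩ <;> simp only [hp] at h1 h2 ⊢ <;> push_cast <;> linarith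

lemma In.add_half {C : Cl} {x : ℝ} (h : In a t C x) : In a t C.neg (x + 1/2) := by
  obtain ⟨n, h1, h2⟩ := h
  cases C <;> simp only [Cl.lo, Cl.wid, Cl.pp, Cl.neg, In] at h1 h2 ⊢ <;> push_cast at h1 h2 ⊢
  · exact ⟨n, by linarith, by linarith⟩
  · exact ⟨n+1, by push_cast; linarith, by push_cast; linarith⟩
  · exact ⟨n+1, by push_cast; linarith, by push_cast; linarith⟩
  · exact ⟨n, by linarith, by linarith⟩
  · exact ⟨n, by linarith, by linarith⟩
  · exact ⟨n+1, by push_cast; linarith, by push_cast; linarith⟩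
  · exact ⟨n+1, by push_cast; linarith, by push_cast; linarith⟩

lemma psi_cong (C : Cl) (x : ℝ) : ∃ m : ℤ, psi a t C x = 3 * x + m :=
  ⟨-(C.pp * ⌊(x - C.lo a t) / (C.pp / 2)⌋), by unfold psi; push_cast; ring⟩

lemma psi_add_one (C : Cl) (x : ℝ) : psi a t C (x + 1) = psi a t C x + 1 := by
  unfold psi
  rcases C.pp_cases_real with hp | hp
  · have : (x + 1 - C.lo a t) / ((C.pp:ℝ) / 2) = (x - C.lo a t) / (C.pp / 2) + (2:ℤ) := by
      rw [hp]; push_cast; ring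
    rw [this, Int.floor_add_intCast, hp]; push_cast; ring
  · have : (x + 1 - C.lo a t) / ((C.pp:ℝ) / 2) = (x - C.lo a t) / (C.pp / 2) + (1:ℤ) := by
      rw [hp]; push_cast; ring
    rw [this, Int.floor_add_intCast, hp]; push_cast; ring

lemma psi_add_int (C : Cl) (x : ℝ) (n : ℤ) : psi a t C (x + n) = psi a t C x + n := by
  unfold psi
  rcases C.pp_cases_real with hp | hp
  · have : (x + n - C.lo a t) / ((C.pp:ℝ) / 2) = (x - C.lo a t) / (C.pp / 2) + (2*n:ℤ) := by
      rw [hp]; push_cast; ring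
    rw [this, Int.floor_add_intCast, hp]; push_cast; ring
  · have : (x + n - C.lo a t) / ((C.pp:ℝ) / 2) = (x - C.lo a t) / (C.pp / 2) + (n:ℤ) := by
      rw [hp]; push_cast; ring
    rw [this, Int.floor_add_intCast, hp]; push_cast; ring

variable (ht : 0 < t) (ht6 : t < 1/6)
include ht ht6

lemma psi_of_mem {C : Cl} {x : ℝ} {n : ℤ} (h1 : C.lo a t ≤ x - C.pp / 2 * n)
    (h2 : x - C.pp / 2 * n ≤ C.lo a t + C.wid t) : psi a t C x = 3 * x - C.pp * n := by
  have h3 := Cl.three_wid_lt ht ht6 C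
  have h4 := Cl.wid_pos ht ht6 C
  have : ⌊(x - C.lo a t) / ((C.pp:ℝ) / 2)⌋ = n := by
    rw [Int.floor_eq_iff]
    have hp : (0:ℝ) < (C.pp:ℝ)/2 := by rcases C.pp_cases_real with h | h <;> rw [h] <;> norm_num
    constructor
    · rw [le_div_iff₀ hp]; linarith
    · rw [div_lt_iff₀ hp]; linarith
  unfold psi; rw [this]

lemma psi_lt {C : Cl} {x y : ℝ} (hx : In a t C x) (hy : In a t C y) (h : x < y) :
    psi a t C x < psi a t C y := by
  obtain ⟨n, h1, h2⟩ := hx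
  obtain ⟨m, h3, h4⟩ := hy
  rw [psi_of_mem ht ht6 h1 h2, psi_of_mem ht ht6 h3 h4]
  have hw := Cl.three_wid_lt ht ht6 C
  have hw0 := Cl.wid_pos ht ht6 C
  rcases lt_trichotomy n m with hnm | rfl | hnm
  · have : (n:ℝ) + 1 ≤ m := by exact_mod_cast hnm
    rcases C.pp_cases_real with hp | hp <;> simp only [hp] at h1 h2 h3 h4 hw ⊢ <;> linarith
  · linarith
  · exfalso
    have : (m:ℝ) + 1 ≤ n := by exact_mod_cast hnm
    rcases C.pp_cases_real with hp | hp <;> simp only [hp] at h1 h2 h3 h4 hw ⊢ <;> linarith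

lemma psi_lt_iff {C : Cl} {x y : ℝ} (hx : In a t C x) (hy : In a t C y) :
    psi a t C x < psi a t C y ↔ x < y := by
  refine ⟨fun h => ?_, psi_lt ht ht6 hx hy⟩
  by_contra hc
  rcases (not_lt.1 hc).lt_or_eq with h' | h'
  · exact absurd (psi_lt ht ht6 hy hx h') (not_lt.2 h.le)
  · rw [h'] at h; exact lt_irrefl _ h

lemma psi_le_iff {C : Cl} {x y : ℝ} (hx : In a t C x) (hy : In a t C y) :
    psi a t C x ≤ psi a t C y ↔ x ≤ y := by
  rw [← not_lt, psi_lt_iff ht ht6 hy hx, not_lt]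

lemma psi_surj {C : Cl} (hC : C.isP) (y : ℝ) :
    (∃ x, In a t C x ∧ psi a t C x = y) ∨
    ∃ h : ℤ, 3 * a + h / 2 < y ∧ y < 3 * a + h / 2 + 3 * t ∧
      ∀ x, In a t C x → psi a t C x ≤ 3 * a + h / 2 ∨ 3 * a + h / 2 + 3 * t ≤ psi a t C x := by
  obtain ⟨c, hc⟩ := Cl.isP_lo (a := a) (t := t) hC
  have hw := Cl.isP_wid (t := t) hC
  have hp : (0:ℝ) < (C.pp:ℝ)/2 := by rcases C.pp_cases_real with h | h <;> rw [h] <;> norm_num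
  set n := ⌊(y - 3 * C.lo a t) / ((C.pp:ℝ)/2)⌋ with hn
  have h1 : (n:ℝ) * ((C.pp:ℝ)/2) ≤ y - 3 * C.lo a t := by
    rw [← le_div_iff₀ hp]; exact Int.floor_le _
  have h2 : y - 3 * C.lo a t < ((n:ℝ)+1) * ((C.pp:ℝ)/2) := by
    rw [← div_lt_iff₀ hp]; exact Int.lt_floor_add_one _
  by_cases hy : y - 3 * C.lo a t ≤ n * ((C.pp:ℝ)/2) + 3 * C.wid t
  · left
    have e1 : C.lo a t ≤ (y + C.pp * n) / 3 - C.pp / 2 * n := by nlinarith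
    have e2 : (y + C.pp * n) / 3 - C.pp / 2 * n ≤ C.lo a t + C.wid t := by nlinarith
    exact ⟨(y + C.pp * n) / 3, ⟨n, e1, e2⟩, by rw [psi_of_mem ht ht6 e1 e2]; ring⟩
  · right
    push Not at hy
    refine ⟨c + C.pp * (n + 1), ?_, ?_, ?_⟩
    · push_cast; linarith
    · push_cast; linarith
    · rintro x ⟨m, h3, h4⟩
      rw [psi_of_mem ht ht6 h3 h4]
      rcases le_or_gt m n with hm | hm
      · left
        have : (m:ℝ) ≤ n := by exact_mod_cast hm
        push_cast; nlinarith
      · right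
        have : (n:ℝ) + 1 ≤ m := by exact_mod_cast hm
        push_cast; nlinarith

lemma cell_unique {C C' : Cl} (hC : C.isP) (hC' : C'.isP) {x : ℝ} (h : In a t C x)
    (h' : In a t C' x) : C = C' := by
  obtain ⟨n, h1, h2⟩ := h
  obtain ⟨m, h3, h4⟩ := h'
  cases C <;> cases C' <;> simp only [Cl.lo, Cl.wid, Cl.pp, Cl.isP] at * <;> push_cast at * <;>
    exfalso
  · have e1 : (n:ℝ) < m + 1 := by linarith
    have e2 : (m:ℝ) < n := by linarith
    have : n < m + 1 := by exact_mod_cast e1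
    have : m < n := by exact_mod_cast e2
    omega
  · have e1 : (m:ℝ) < 2 * n + 1 := by linarith
    have e2 : 2 * (n:ℝ) < m := by linarith
    have : m < 2 * n + 1 := by exact_mod_cast e1
    have : 2 * n < m := by exact_mod_cast e2
    omega
  · have e1 : (m:ℝ) < n + 1 := by linarith
    have e2 : (n:ℝ) < m := by linarith
    have : m < n + 1 := by exact_mod_cast e1
    have : n < m := by exact_mod_cast e2
    omega
  · have e1 : (m:ℝ) < 2 * n + 2 := by linarith
    have e2 : 2 * (n:ℝ) + 1 < m := by linarith
    have : m < 2 * n + 2 := by exact_mod_cast e1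
    have : 2 * n + 1 < m := by exact_mod_cast e2
    omega
  · have e1 : (n:ℝ) < 2 * m + 1 := by linarith
    have e2 : 2 * (m:ℝ) < n := by linarith
    have : n < 2 * m + 1 := by exact_mod_cast e1
    have : 2 * m < n := by exact_mod_cast e2
    omega
  · have e1 : (n:ℝ) < 2 * m + 2 := by linarith
    have e2 : 2 * (m:ℝ) + 1 < n := by linarith
    have : n < 2 * m + 2 := by exact_mod_cast e1
    have : 2 * m + 1 < n := by exact_mod_cast e2
    omega

end

/-- The pairs `x, y` and `u, v`, viewed modulo one, strictly alternate on the circle. -/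
def Link (x y u v : ℝ) : Prop :=
  ∃ i j k : ℤ, (x < u + i ∧ u + i < y + j ∧ y + j < v + k ∧ v + k < x + 1) ∨
    (x < v + k ∧ v + k < y + j ∧ y + j < u + i ∧ u + i < x + 1)

lemma Link.swap_right {x y u v : ℝ} (h : Link x y u v) : Link x y v u := by
  obtain ⟨i, j, k, h | h⟩ := h
  · exact ⟨k, j, i, Or.inr h⟩
  · exact ⟨k, j, i, Or.inl h⟩

lemma Link.swap_left {x y u v : ℝ} (h : Link x y u v) : Link y x u v := by
  obtain ⟨i, j, k, ⟨h1, h2, h3, h4⟩ | ⟨h1, h2, h3, h4⟩⟩ := h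
  · refine ⟨i - j + 1, -j + 1, k - j, Or.inr ?_⟩
    push_cast; refine ⟨?_, ?_, ?_, ?_⟩ <;> linarith
  · refine ⟨i - j, -j + 1, k - j + 1, Or.inl ?_⟩
    push_cast; refine ⟨?_, ?_, ?_, ?_⟩ <;> linarith

lemma Link.symm {x y u v : ℝ} (h : Link x y u v) : Link u v x y := by
  obtain ⟨i, j, k, ⟨h1, h2, h3, h4⟩ | ⟨h1, h2, h3, h4⟩⟩ := h
  · refine ⟨-i + 1, k - i, j - i, Or.inr ?_⟩
    push_cast; refine ⟨?_, ?_, ?_, ?_⟩ <;> linarith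
  · refine ⟨-i + 1, k - i + 1, j - i + 1, Or.inl ?_⟩
    push_cast; refine ⟨?_, ?_, ?_, ?_⟩ <;> linarith

lemma Link.congr {x y u v x' y' u' v' : ℝ} (r : ℝ) (h : Link x y u v)
    (hx : ∃ n : ℤ, x' = x + r + n) (hy : ∃ n : ℤ, y' = y + r + n)
    (hu : ∃ n : ℤ, u' = u + r + n) (hv : ∃ n : ℤ, v' = v + r + n) : Link x' y' u' v' := by
  obtain ⟨n1, rfl⟩ := hx
  obtain ⟨n2, rfl⟩ := hy
  obtain ⟨n3, rfl⟩ := hu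
  obtain ⟨n4, rfl⟩ := hv
  obtain ⟨i, j, k, ⟨h1, h2, h3, h4⟩ | ⟨h1, h2, h3, h4⟩⟩ := h
  · refine ⟨i + n1 - n3, j + n1 - n2, k + n1 - n4, Or.inl ?_⟩
    push_cast; refine ⟨?_, ?_, ?_, ?_⟩ <;> linarith
  · refine ⟨i + n1 - n3, j + n1 - n2, k + n1 - n4, Or.inr ?_⟩
    push_cast; refine ⟨?_, ?_, ?_, ?_⟩ <;> linarith

lemma Link.of_lt {x y u v : ℝ} (h1 : x < u) (h2 : u < y) (h3 : y < v) (h4 : v < x + 1) :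
    Link x y u v := ⟨0, 0, 0, Or.inl (by simp [*])⟩

lemma Link.mem_of_lt {x y u v : ℝ} (h : Link x y u v) (h1 : x ≤ y) (h2 : y ≤ x + 1) :
    (∃ i : ℤ, x < u + i ∧ u + i < y) ∨ (∃ i : ℤ, x < v + i ∧ v + i < y) := by
  obtain ⟨i, j, k, ⟨g1, g2, g3, g4⟩ | ⟨g1, g2, g3, g4⟩⟩ := h
  · have e1 : (j:ℝ) < 1 := by linarith
    have e2 : (-1:ℝ) < j := by linarith
    have e1 : j < 1 := by exact_mod_cast e1
    have e2 : -1 < j := by exact_mod_cast e2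
    obtain rfl : j = 0 := by omega
    exact Or.inl ⟨i, g1, by simpa using g2⟩
  · have e1 : (j:ℝ) < 1 := by linarith
    have e2 : (-1:ℝ) < j := by linarith
    have e1 : j < 1 := by exact_mod_cast e1
    have e2 : -1 < j := by exact_mod_cast e2
    obtain rfl : j = 0 := by omega
    exact Or.inr ⟨k, g1, by simpa using g2⟩

section
variable {a t : ℝ}

set_option maxHeartbeats 2000000 in
lemma cell_interior (ht : 0 < t) (ht6 : t < 1/6) {C C' : Cl} (hC : C.pp = 2) {z : ℝ}
    (h1 : C.lo a t < z) (h2 : z < C.lo a t + C.wid t) (h : In a t C' z) : C = C' := by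
  obtain ⟨m, h3, h4⟩ := h
  cases C <;> cases C' <;> first | rfl | (exfalso; revert hC; decide) | exfalso
  all_goals
    simp only [Cl.lo, Cl.wid, Cl.pp, Int.cast_ofNat, Int.cast_one] at h1 h2 h3 h4
    have e1 : (-3:ℝ) < m := by linarith
    have e2 : (m:ℝ) < 3 := by linarith
    have e1 : -3 < m := by exact_mod_cast e1
    have e2 : m < 3 := by exact_mod_cast e2
    obtain rfl | rfl | rfl | rfl | rfl : m = -2 ∨ m = -1 ∨ m = 0 ∨ m = 1 ∨ m = 2 := by omega
    all_goals norm_num at h3 h4; linarith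

lemma push_cell_aux (ht : 0 < t) (ht6 : t < 1/6) {C C' : Cl} (hC : C.pp = 2) {x y u v : ℝ}
    (hx : In a t C x) (hy : In a t C y) (hu : In a t C' u) (hv : In a t C' v)
    (h : Link x y u v) : C = C' := by
  obtain ⟨n, h1, h2⟩ := hx
  obtain ⟨m, h3, h4⟩ := hy
  have hp : (C.pp:ℝ) = 2 := by rw [hC]; norm_num
  rw [hp] at h1 h2 h3 h4
  have hw := Cl.three_wid_lt ht ht6 C
  rw [hp] at hw
  have key : ∀ x' y' : ℝ, C.lo a t ≤ x' → x' ≤ y' → y' ≤ C.lo a t + C.wid t →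
      Link x' y' u v → C = C' := by
    intro x' y' g1 g2 g3 g
    rcases g.mem_of_lt g2 (by linarith) with ⟨i, e1, e2⟩ | ⟨i, e1, e2⟩
    · exact cell_interior ht ht6 hC (by linarith) (by linarith) (hu.add_int i)
    · exact cell_interior ht ht6 hC (by linarith) (by linarith) (hv.add_int i)
  have L : Link (x - 2/2*n) (y - 2/2*m) u v :=
    h.congr 0 ⟨-n, by push_cast; ring⟩ ⟨-m, by push_cast; ring⟩ ⟨0, by simp⟩ ⟨0, by simp⟩
  rcases le_total (x - 2/2*n) (y - 2/2*m) with hle | hle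
  · exact key _ _ h1 hle h4 L
  · exact key _ _ h3 hle h2 L.swap_left

lemma push_cell (ht : 0 < t) (ht6 : t < 1/6) {C C' : Cl} {x y u v : ℝ}
    (hx : In a t C x) (hy : In a t C y) (hu : In a t C' u) (hv : In a t C' v)
    (h : Link x y u v) : C = C' := by
  rcases C.pp_cases with hp | hp
  · rcases C'.pp_cases with hp' | hp'
    · cases C <;> cases C' <;> simp_all [Cl.pp]
    · exact (push_cell_aux ht ht6 hp' hu hv hx hy h.symm).symm
  · exact push_cell_aux ht ht6 hp hx hy hu hv h

lemma push_link (ht : 0 < t) (ht6 : t < 1/6) {C : Cl} {x y u v : ℝ}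
    (hx : In a t C x) (hy : In a t C y) (hu : In a t C u) (hv : In a t C v)
    (h : Link x y u v) : Link (psi a t C x) (psi a t C y) (psi a t C u) (psi a t C v) := by
  have e : psi a t C x + 1 = psi a t C (x + 1) := (psi_add_one C x).symm
  have hx1 : In a t C (x + 1) := by simpa using hx.add_int 1
  obtain ⟨i, j, k, ⟨h1, h2, h3, h4⟩ | ⟨h1, h2, h3, h4⟩⟩ := h
  · refine ⟨i, j, k, Or.inl ⟨?_, ?_, ?_, ?_⟩⟩ <;> (try rw [e]) <;>
      simp only [← psi_add_int]
    · exact psi_lt ht ht6 hx (hu.add_int i) h1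
    · exact psi_lt ht ht6 (hu.add_int i) (hy.add_int j) h2
    · exact psi_lt ht ht6 (hy.add_int j) (hv.add_int k) h3
    · exact psi_lt ht ht6 (hv.add_int k) hx1 h4
  · refine ⟨i, j, k, Or.inr ⟨?_, ?_, ?_, ?_⟩⟩ <;> (try rw [e]) <;>
      simp only [← psi_add_int]
    · exact psi_lt ht ht6 hx (hv.add_int k) h1
    · exact psi_lt ht ht6 (hv.add_int k) (hy.add_int j) h2
    · exact psi_lt ht ht6 (hy.add_int j) (hu.add_int i) h3
    · exact psi_lt ht ht6 (hu.add_int i) hx1 h4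

lemma push (ht : 0 < t) (ht6 : t < 1/6) {C C' : Cl} {x y u v : ℝ}
    (hx : In a t C x) (hy : In a t C y) (hu : In a t C' u) (hv : In a t C' v)
    (h : Link x y u v) : C = C' ∧ Link (3*x) (3*y) (3*u) (3*v) := by
  obtain rfl := push_cell ht ht6 hx hy hu hv h
  refine ⟨rfl, (push_link ht ht6 hx hy hu hv h).congr 0 ?_ ?_ ?_ ?_⟩ <;>
  · obtain ⟨m, hm⟩ := psi_cong (a := a) (t := t) C _
    exact ⟨-m, by rw [hm]; push_cast; ring⟩

variable (a t) in
/-- `x, y` bound a complementary gap of a central cell. -/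
def Edge (x y : ℝ) : Prop :=
  ∃ C : Cl, C.isP ∧ ∃ n m : ℤ, x = C.lo a t + C.wid t + C.pp / 2 * n ∧
    y = C.lo a t + C.pp / 2 * (n + 1) + m

variable (a t) in
/-- `x, y` lie in a common central cell. -/
def CellP (x y : ℝ) : Prop := ∃ C : Cl, C.isP ∧ In a t C x ∧ In a t C y

variable (a t) in
/-- `x, y` lie in a common cell. -/
def Cell (x y : ℝ) : Prop := ∃ C : Cl, In a t C x ∧ In a t C y

lemma CellP.cell {x y : ℝ} (h : CellP a t x y) : Cell a t x y := by
  obtain ⟨C, -, h⟩ := h; exact ⟨C, h⟩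

lemma CellP.symm {x y : ℝ} (h : CellP a t x y) : CellP a t y x := by
  obtain ⟨C, h0, h1, h2⟩ := h; exact ⟨C, h0, h2, h1⟩

lemma Cell.symm {x y : ℝ} (h : Cell a t x y) : Cell a t y x := by
  obtain ⟨C, h1, h2⟩ := h; exact ⟨C, h2, h1⟩

lemma CellP.trans (ht : 0 < t) (ht6 : t < 1/6) {x y z : ℝ} (h : CellP a t x y)
    (h' : CellP a t y z) : CellP a t x z := by
  obtain ⟨C, h0, h1, h2⟩ := h
  obtain ⟨C', h0', h1', h2'⟩ := h'
  obtain rfl := cell_unique ht ht6 h0 h0' h2 h1'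
  exact ⟨C, h0, h1, h2'⟩

lemma In.add_half_int {C : Cl} {x : ℝ} (h : In a t C x) (k : ℤ) :
    In a t (if Even k then C else C.neg) (x + k / 2) := by
  rcases Int.even_or_odd' k with ⟨m, rfl | rfl⟩
  · rw [if_pos (even_two_mul m)]
    have := h.add_int m
    convert this using 2; push_cast; ring
  · rw [if_neg (by simp)]
    have := h.add_half.add_int m
    convert this using 1; push_cast; ring

lemma CellP.add {x y : ℝ} (h : CellP a t x y) (k i j : ℤ) :
    CellP a t (x + k / 2 + i) (y + k / 2 + j) := by
  obtain ⟨C, h0, h1, h2⟩ := h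
  refine ⟨if Even k then C else C.neg, ?_, (h1.add_half_int k).add_int i,
    (h2.add_half_int k).add_int j⟩
  split
  · exact h0
  · exact Cl.isP_neg h0

lemma Cell.add {x y : ℝ} (h : Cell a t x y) (k i j : ℤ) :
    Cell a t (x + k / 2 + i) (y + k / 2 + j) := by
  obtain ⟨C, h1, h2⟩ := h
  exact ⟨if Even k then C else C.neg, (h1.add_half_int k).add_int i, (h2.add_half_int k).add_int j⟩

lemma Edge.mem (ht : 0 < t) (ht6 : t < 1/6) {x y : ℝ} (h : Edge a t x y) : CellP a t x y := by
  obtain ⟨C, hC, n, m, rfl, rfl⟩ := h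
  have hw := Cl.wid_pos ht ht6 C
  refine ⟨C, hC, ⟨n, by linarith, by linarith⟩, ?_⟩
  refine In.add_int ⟨n+1, ?_, ?_⟩ m <;> push_cast <;> linarith

lemma Edge.image {x y : ℝ} (h : Edge a t x y) :
    ∃ k j : ℤ, 3 * x = 3 * a + k / 2 ∧ 3 * y = 3 * a + 3 * t + k / 2 + j := by
  obtain ⟨C, hC, n, m, rfl, rfl⟩ := h
  obtain ⟨c, hc⟩ := Cl.isP_lo (a := a) (t := t) hC
  have hw := Cl.isP_wid (t := t) hC
  refine ⟨c + C.pp + 3 * C.pp * n, C.pp + 3 * m, ?_, ?_⟩ <;> push_cast <;> linarith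

lemma Edge.not_link (ht : 0 < t) (ht6 : t < 1/6) {x y u v : ℝ} (h : Edge a t x y)
    (h' : Cell a t u v) : ¬ Link x y u v := by
  intro hL
  obtain ⟨C, hC, hx, hy⟩ := h.mem ht ht6
  obtain ⟨D, hu, hv⟩ := h'
  obtain rfl := push_cell ht ht6 hx hy hu hv hL
  obtain ⟨C', hC', n, m, rfl, rfl⟩ := h
  have hw := Cl.wid_pos ht ht6 C'
  have hw3 := Cl.three_wid_lt ht ht6 C'
  have hxx : In a t C' (C'.lo a t + C'.wid t + C'.pp / 2 * n) := ⟨n, by linarith, by linarith⟩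
  obtain rfl := cell_unique ht ht6 hC hC' hx hxx
  have L2 : Link (C.lo a t + C.wid t + C.pp / 2 * n) (C.lo a t + C.pp / 2 * (n + 1)) u v :=
    hL.congr 0 ⟨0, by simp⟩ ⟨-m, by push_cast; ring⟩ ⟨0, by simp⟩ ⟨0, by simp⟩
  have key : ∀ z, In a t C z → C.lo a t + C.wid t + C.pp / 2 * n < z →
      z < C.lo a t + C.pp / 2 * (n + 1) → False := by
    rintro z ⟨l, g1, g2⟩ g3 g4
    rcases le_or_gt l n with hl | hl
    · have : (l:ℝ) ≤ n := by exact_mod_cast hl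
      rcases C.pp_cases_real with hp | hp <;> simp only [hp] at * <;> linarith
    · have : (n:ℝ) + 1 ≤ l := by exact_mod_cast hl
      rcases C.pp_cases_real with hp | hp <;> simp only [hp] at * <;> linarith
  rcases L2.mem_of_lt (by rcases C.pp_cases_real with hp | hp <;> simp only [hp] at * <;> linarith)
    (by rcases C.pp_cases_real with hp | hp <;> simp only [hp] at * <;> linarith) with
    ⟨i, g1, g2⟩ | ⟨i, g1, g2⟩
  · exact key _ (hu.add_int i) g1 g2
  · exact key _ (hv.add_int i) g1 g2

lemma push_iter (ht : 0 < t) (ht6 : t < 1/6) {x y u v : ℝ} (k : ℕ)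
    (h1 : ∀ j < k, Cell a t (3^j*x) (3^j*y)) (h2 : ∀ j < k, Cell a t (3^j*u) (3^j*v))
    (h : Link x y u v) : Link (3^k*x) (3^k*y) (3^k*u) (3^k*v) := by
  induction k with
  | zero => simpa using h
  | succ k ih =>
    obtain ⟨C, c1, c2⟩ := h1 k (by omega)
    obtain ⟨D, d1, d2⟩ := h2 k (by omega)
    have := (push ht ht6 c1 c2 d1 d2
      (ih (fun j hj => h1 j (by omega)) (fun j hj => h2 j (by omega)))).2
    simpa [pow_succ, mul_comm, mul_assoc, mul_left_comm] using this

lemma not_link_of_edge (ht : 0 < t) (ht6 : t < 1/6) {x y u v : ℝ} (k : ℕ)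
    (h1 : ∀ j ≤ k, Cell a t (3^j*x) (3^j*y)) (h2 : ∀ j ≤ k, Cell a t (3^j*u) (3^j*v))
    (he : Edge a t (3^k*x) (3^k*y) ∨ Edge a t (3^k*y) (3^k*x)) : ¬ Link x y u v := by
  intro h
  have := push_iter ht ht6 k (fun j hj => h1 j hj.le) (fun j hj => h2 j hj.le) h
  rcases he with he | he
  · exact he.not_link ht ht6 (h2 k le_rfl) this
  · exact he.not_link ht ht6 (h2 k le_rfl) this.swap_left

variable (a t) in
/-- `x, y` have the same itinerary with respect to the central cells. -/
def Same (x y : ℝ) : Prop := ∀ k : ℕ, CellP a t (3^k*x) (3^k*y)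

lemma Same.symm {x y : ℝ} (h : Same a t x y) : Same a t y x := fun k => (h k).symm

lemma Same.trans (ht : 0 < t) (ht6 : t < 1/6) {x y z : ℝ} (h : Same a t x y)
    (h' : Same a t y z) : Same a t x z := fun k => (h k).trans ht ht6 (h' k)

lemma Same.add {x y : ℝ} (h : Same a t x y) (k i j : ℤ) :
    Same a t (x + k / 2 + i) (y + k / 2 + j) := by
  intro n
  have := (h n).add (3^n*k) (3^n*i) (3^n*j)
  convert this using 1 <;> push_cast <;> ring

lemma Same.pow {x y : ℝ} (h : Same a t x y) (n : ℕ) : Same a t (3^n*x) (3^n*y) := by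
  intro k
  have := h (k + n)
  rwa [pow_add, mul_assoc, mul_assoc] at this

lemma Same.of_link (ht : 0 < t) (ht6 : t < 1/6) {x y u v : ℝ} (h : Same a t x y)
    (h' : Same a t u v) (hL : Link x y u v) : Same a t x u := by
  intro k
  have := push_iter ht ht6 k (fun j _ => (h j).cell) (fun j _ => (h' j).cell) hL
  obtain ⟨C, c0, c1, c2⟩ := h k
  obtain ⟨D, d0, d1, d2⟩ := h' k
  obtain rfl := push_cell ht ht6 c1 c2 d1 d2 this
  exact ⟨C, c0, c1, d1⟩

end

/-- Distance of a real number to the nearest integer. -/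
def nd (z : ℝ) : ℝ := |z - round z|

lemma nd_le (z : ℝ) (n : ℤ) : nd z ≤ |z - n| := round_le z n

lemma nd_exists (z : ℝ) : ∃ n : ℤ, nd z = |z - n| := ⟨round z, rfl⟩

lemma nd_nonneg (z : ℝ) : 0 ≤ nd z := abs_nonneg _

lemma nd_le_abs (z : ℝ) : nd z ≤ |z| := by simpa using nd_le z 0

lemma nd_add_int (z : ℝ) (n : ℤ) : nd (z + n) = nd z := by
  unfold nd; rw [round_add_intCast]; push_cast; congr 1; ring

lemma nd_neg (z : ℝ) : nd (-z) = nd z := by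
  have h : ∀ z, nd (-z) ≤ nd z := by
    intro z
    obtain ⟨n, hn⟩ := nd_exists z
    rw [hn]
    refine (nd_le (-z) (-n)).trans (le_of_eq ?_)
    rw [← abs_neg]; congr 1; push_cast; ring
  exact le_antisymm (h z) (by simpa using h (-z))

lemma nd_eq {z : ℝ} {n : ℤ} (h : |z - n| ≤ 1/2) : nd z = |z - n| := by
  refine le_antisymm (nd_le z n) ?_
  obtain ⟨m, hm⟩ := nd_exists z
  rw [hm]
  rcases eq_or_ne m n with rfl | hne
  · exact le_rfl
  have h1 : (1:ℝ) ≤ |(m:ℝ) - n| := by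
    have : (1:ℤ) ≤ |m - n| := Int.one_le_abs (sub_ne_zero.2 hne)
    exact_mod_cast this
  have h2 : |(m:ℝ) - n| ≤ |z - n| + |z - m| := by
    have : (m:ℝ) - n = (z - n) - (z - m) := by ring
    rw [this]; exact abs_sub _ _
  linarith

lemma nd_eq_zero {z : ℝ} (h : nd z = 0) : ∃ n : ℤ, z = n := by
  obtain ⟨n, hn⟩ := nd_exists z
  exact ⟨n, by rw [h] at hn; linarith [abs_eq_zero.1 hn.symm]⟩

lemma nd_three {z : ℝ} (h : nd z ≤ 1/6) : nd (3 * z) = 3 * nd z := by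
  obtain ⟨n, hn⟩ := nd_exists z
  have : 3 * z - (3 * n : ℤ) = 3 * (z - n) := by push_cast; ring
  rw [nd_eq (n := 3 * n), this, abs_mul, hn]
  · norm_num
  · rw [this, abs_mul, ← hn]; norm_num; linarith

lemma nd_add_le (x y : ℝ) : nd (x + y) ≤ nd x + nd y := by
  obtain ⟨n, hn⟩ := nd_exists x
  obtain ⟨m, hm⟩ := nd_exists y
  rw [hn, hm]
  refine (nd_le _ (n + m)).trans ?_
  refine le_trans (le_of_eq ?_) (abs_add_le _ _)
  congr 1; push_cast; ring

section
variable {a t : ℝ}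

lemma CellP.grow (ht : 0 < t) {x y : ℝ} (h : CellP a t x y) :
    min (3 * nd (x - y)) (3 * t) ≤ nd (3 * x - 3 * y) := by
  obtain ⟨C, hC, ⟨n, h1, h2⟩, ⟨m, h3, h4⟩⟩ := h
  have hw := Cl.isP_wid (t := t) hC
  obtain ⟨N, hN⟩ := nd_exists (3 * x - 3 * y)
  rw [hN]
  set D := (x - C.pp / 2 * n) - (y - C.pp / 2 * m) with hD
  have hD1 : |D| ≤ C.wid t := abs_le.2 ⟨by linarith, by linarith⟩
  have hp : (0:ℝ) < C.pp := by rcases C.pp_cases_real with h | h <;> rw [h] <;> norm_num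
  have main : ∀ K : ℤ, 3 * x - 3 * y - N = 3 * D + C.pp / 2 * K →
      (K = 0 → ∃ l : ℤ, x - y = D + l) → min (3 * nd (x - y)) (3 * t) ≤ |3 * x - 3 * y - N| := by
    intro K hK h0
    rcases eq_or_ne K 0 with rfl | hK0
    · obtain ⟨l, hl⟩ := h0 rfl
      have : nd (x - y) ≤ |D| := by rw [hl, nd_add_int]; exact nd_le_abs D
      have e : |3 * x - 3 * y - N| = 3 * |D| := by rw [hK]; simp [abs_mul]
      rw [e]; exact (min_le_left _ _).trans (by linarith)
    · have h1 : (1:ℝ) ≤ |(K:ℝ)| := by exact_mod_cast Int.one_le_abs hK0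
      have h5 : |(C.pp:ℝ) / 2 * K| ≤ |3 * D + C.pp / 2 * K| + |3 * D| := by
        have : (C.pp:ℝ) / 2 * K = (3 * D + C.pp / 2 * K) - 3 * D := by ring
        nth_rewrite 1 [this]; exact abs_sub _ _
      have h6 : |(C.pp:ℝ) / 2 * K| = C.pp / 2 * |(K:ℝ)| := by
        rw [abs_mul, abs_of_pos (by linarith)]
      have h7 : |3 * D| = 3 * |D| := by simp [abs_mul]
      have h8 : (C.pp:ℝ) / 2 ≤ C.pp / 2 * |(K:ℝ)| := by nlinarith
      rw [hK]; exact (min_le_right _ _).trans (by linarith)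
  rcases C.pp_cases_real with hp' | hp'
  · apply main (3 * (n - m) - 2 * N)
    · rw [hD, hp']; push_cast; ring
    · intro h
      obtain ⟨l, hl⟩ : ∃ l, n - m = 2 * l := ⟨(n-m)/2, by omega⟩
      refine ⟨l, ?_⟩
      have : (n:ℝ) - m = 2 * l := by exact_mod_cast hl
      rw [hD, hp']; linarith
  · apply main (3 * (n - m) - N)
    · rw [hD, hp']; push_cast; ring
    · intro h
      refine ⟨n - m, ?_⟩
      rw [hD, hp']; push_cast; ring

lemma CellP.drop (ht : 0 < t) {x y : ℝ} (h : CellP a t x y)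
    (hd : 1/6 < nd (x - y)) : ∃ k i j : ℤ,
      (3 * x + k / 2 + i ≤ 3 * a ∧ 3 * a + 3 * t ≤ 3 * y + k / 2 + j ∧
        (3 * y + k / 2 + j) - (3 * x + k / 2 + i) ≤ 1/2) ∨
      (3 * y + k / 2 + j ≤ 3 * a ∧ 3 * a + 3 * t ≤ 3 * x + k / 2 + i ∧
        (3 * x + k / 2 + i) - (3 * y + k / 2 + j) ≤ 1/2) := by
  obtain ⟨C, hC, ⟨n, h1, h2⟩, ⟨m, h3, h4⟩⟩ := h
  have hw := Cl.isP_wid (t := t) hC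
  obtain ⟨c, hc⟩ := Cl.isP_lo (a := a) (t := t) hC
  rcases C.pp_cases_real with hp | hp
  · rw [hp] at h1 h2 h3 h4 hw
    have hodd : ¬ Even (n - m) := by
      rintro ⟨l, hl⟩
      have hl' : (n:ℝ) - m = 2 * l := by rw [two_mul]; exact_mod_cast hl
      have := nd_le (x - y) l
      have h5 : |x - y - l| ≤ 1/6 := abs_le.2 ⟨by linarith, by linarith⟩
      linarith
    obtain ⟨l, hl⟩ := Int.not_even_iff_odd.1 hodd
    have hl' : (n:ℝ) - m = 2 * l + 1 := by exact_mod_cast hl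
    -- `X = 3 x - 3 n / 2`, `Y = 3 y - 3 m / 2`
    rcases le_total ((3 * y - 3/2 * m) + 1/2 - (3 * x - 3/2 * n)) (1/2) with hle | hle
    · refine ⟨-3 * n - c - 1, 0, 3 * l + 2, Or.inl ?_⟩
      push_cast
      refine ⟨?_, ?_, ?_⟩ <;> linarith
    · refine ⟨-3 * n - c, 0, 3 * l + 1, Or.inr ?_⟩
      push_cast
      refine ⟨?_, ?_, ?_⟩ <;> linarith
  · rw [hp] at h1 h2 h3 h4 hw
    have := nd_le (x - y) (n - m)
    have h5 : 1/6 < |(x - 2/2*n) - (y - 2/2*m)| := by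
      refine lt_of_lt_of_le hd (this.trans (le_of_eq ?_)); congr 1; push_cast; ring
    rcases lt_abs.1 h5 with h5 | h5
    · refine ⟨- c, - 3 * n - 1, -3*m, Or.inl ?_⟩
      push_cast
      refine ⟨?_, ?_, ?_⟩ <;> linarith
    · refine ⟨- c, - 3 * n, -3*m-1, Or.inr ?_⟩
      push_cast
      refine ⟨?_, ?_, ?_⟩ <;> linarith

lemma Same.sep_of_sep (ht : 0 < t) {x y : ℝ} (h : Same a t x y)
    {n : ℕ} (hn : 3 * t ≤ nd (3^n*x - 3^n*y)) : ∀ k, n ≤ k → 3 * t ≤ nd (3^k*x - 3^k*y) := by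
  intro k hk
  induction k, hk using Nat.le_induction with
  | base => exact hn
  | succ k hk ih =>
    have := (h k).grow ht
    rw [pow_succ', mul_assoc, mul_assoc]
    refine le_trans (le_min ?_ le_rfl) this
    linarith

lemma Same.eventually_sep (ht : 0 < t) {x y : ℝ} (h : Same a t x y)
    (hne : nd (x - y) ≠ 0) : ∃ n, ∀ k, n ≤ k → 3 * t ≤ nd (3^k*x - 3^k*y) := by
  have h0 : 0 < nd (x - y) := lt_of_le_of_ne (nd_nonneg _) hne.symm
  by_contra hcon
  push Not at hcon
  have hlt : ∀ n, nd (3^n*x - 3^n*y) < 3 * t := by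
    intro n
    obtain ⟨k, hk, hk2⟩ := hcon n
    by_contra hc
    exact absurd (h.sep_of_sep ht (not_lt.1 hc) k hk) (not_le.2 hk2)
  have hgr : ∀ n, 3^n * nd (x - y) ≤ nd (3^n*x - 3^n*y) := by
    intro n
    induction n with
    | zero => simp
    | succ n ih =>
      have h1 := (h n).grow ht
      have h2 := hlt (n+1)
      simp only [pow_succ', mul_assoc] at h2 ⊢
      rcases min_le_iff.1 h1 with h3 | h3 <;> linarith
  obtain ⟨n, hn⟩ := pow_unbounded_of_one_lt (3 * t / nd (x - y)) (by norm_num : (1:ℝ) < 3)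
  rw [div_lt_iff₀ h0] at hn
  linarith [hgr n, hlt n]

end

section
variable {a t : ℝ}

lemma Edge.add {x y : ℝ} (h : Edge a t x y) (k i j : ℤ) :
    Edge a t (x + k / 2 + i) (y + k / 2 + j) := by
  have hshift_int : ∀ {x y : ℝ}, Edge a t x y → ∀ i j : ℤ, Edge a t (x + i) (y + j) := by
    rintro x y ⟨C, hC, n, m, rfl, rfl⟩ i j
    rcases C.pp_cases_real with hp | hp
    · exact ⟨C, hC, n + 2 * i, m - i + j, by rw [hp]; push_cast; ring,
        by rw [hp]; push_cast; ring⟩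
    · exact ⟨C, hC, n + i, m - i + j, by rw [hp]; push_cast; ring,
        by rw [hp]; push_cast; ring⟩
  have hhalf : ∀ {x y : ℝ}, Edge a t x y → Edge a t (x + 1/2) (y + 1/2) := by
    rintro x y ⟨C, hC, n, m, rfl, rfl⟩
    cases C <;> simp only [Cl.isP] at hC
    · refine ⟨Cl.pm, trivial, n, m, ?_, ?_⟩ <;> simp only [Cl.lo, Cl.wid, Cl.pp] <;>
        push_cast <;> ring
    · refine ⟨Cl.p1, trivial, n + 1, m, ?_, ?_⟩ <;> simp only [Cl.lo, Cl.wid, Cl.pp] <;>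
        push_cast <;> ring
    · refine ⟨Cl.p0, trivial, n + 1, m, ?_, ?_⟩ <;> simp only [Cl.lo, Cl.wid, Cl.pp] <;>
        push_cast <;> ring
  rcases Int.even_or_odd' k with ⟨m, rfl | rfl⟩
  · have := hshift_int h (m + i) (m + j)
    convert this using 1 <;> push_cast <;> ring
  · have := hshift_int (hhalf h) (m + i) (m + j)
    convert this using 1 <;> push_cast <;> ring

lemma exists_edge_of_notMem (ht : 0 < t) (ht6 : t < 1/6) {C : Cl} (hC : C.isP) {x : ℝ}
    (hx : ¬ In a t C x) : ∃ z1 z2 : ℝ, z1 < x ∧ x < z2 ∧ In a t C z1 ∧ In a t C z2 ∧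
      Edge a t z1 z2 ∧ ∀ y, In a t C y → y ≤ z1 ∨ z2 ≤ y := by
  have hp : (0:ℝ) < (C.pp:ℝ)/2 := by rcases C.pp_cases_real with h | h <;> rw [h] <;> norm_num
  have hw := Cl.wid_pos ht ht6 C
  set n := ⌊(x - C.lo a t) / ((C.pp:ℝ)/2)⌋ with hn
  have h1 : (n:ℝ) * ((C.pp:ℝ)/2) ≤ x - C.lo a t := by
    rw [← le_div_iff₀ hp]; exact Int.floor_le _
  have h2 : x - C.lo a t < ((n:ℝ)+1) * ((C.pp:ℝ)/2) := by
    rw [← div_lt_iff₀ hp]; exact Int.lt_floor_add_one _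
  have h3 : C.lo a t + C.wid t < x - C.pp / 2 * n := by
    by_contra hc
    exact hx ⟨n, by linarith, by linarith⟩
  refine ⟨C.lo a t + C.wid t + C.pp / 2 * n, C.lo a t + C.pp / 2 * (n + 1), by linarith,
    by linarith, ⟨n, by linarith, by linarith⟩, ⟨n + 1, by push_cast; linarith,
    by push_cast; linarith⟩, ⟨C, hC, n, 0, rfl, by simp⟩, ?_⟩
  rintro y ⟨m, g1, g2⟩
  rcases le_or_gt m n with hl | hl
  · have : (m:ℝ) ≤ n := by exact_mod_cast hl
    left; nlinarith
  · have : (n:ℝ) + 1 ≤ m := by exact_mod_cast hl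
    right; nlinarith

lemma pow_mul_psi (C : Cl) (x : ℝ) (j : ℕ) :
    ∃ m : ℤ, 3^j * psi a t C x = 3^(j+1) * x + m := by
  obtain ⟨m, hm⟩ := psi_cong (a := a) (t := t) C x
  exact ⟨3^j * m, by rw [hm]; push_cast; ring⟩

lemma CellP.psi_iff {C D : Cl} {x y : ℝ} {j : ℕ} :
    CellP a t (3^j * psi a t C x) (3^j * psi a t D y) ↔
      CellP a t (3^(j+1) * x) (3^(j+1) * y) := by
  obtain ⟨m, hm⟩ := pow_mul_psi (a := a) (t := t) C x j
  obtain ⟨n, hn⟩ := pow_mul_psi (a := a) (t := t) D y j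
  rw [hm, hn]
  constructor <;> intro h
  · simpa using h.add 0 (-m) (-n)
  · simpa using h.add 0 m n

lemma Edge.psi_iff {C D : Cl} {x y : ℝ} {j : ℕ} :
    Edge a t (3^j * psi a t C x) (3^j * psi a t D y) ↔
      Edge a t (3^(j+1) * x) (3^(j+1) * y) := by
  obtain ⟨m, hm⟩ := pow_mul_psi (a := a) (t := t) C x j
  obtain ⟨n, hn⟩ := pow_mul_psi (a := a) (t := t) D y j
  rw [hm, hn]
  constructor <;> intro h
  · simpa using h.add 0 (-m) (-n)
  · simpa using h.add 0 m n

lemma exists_leaf_around (ht : 0 < t) (ht6 : t < 1/6) (H1 : Same a t (3*a) (3*a+3*t)) (k : ℕ) :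
    ∀ {u x w : ℝ}, u < x → x < w → w < u + 1 → (∀ j ≤ k, CellP a t (3^j*u) (3^j*w)) →
      (∀ j < k, CellP a t (3^j*u) (3^j*x)) → ¬ CellP a t (3^k*u) (3^k*x) →
      ∃ z1 z2, u ≤ z1 ∧ z1 < x ∧ x < z2 ∧ z2 ≤ w ∧
        (∀ j ≤ k, CellP a t (3^j*u) (3^j*z1) ∧ CellP a t (3^j*u) (3^j*z2)) ∧
        Edge a t (3^k*z1) (3^k*z2) := by
  induction k with
  | zero =>
    intro u x w hux hxw hwu huw _ hx
    obtain ⟨C, hC, hu, hw⟩ := huw 0 le_rfl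
    simp only [pow_zero, one_mul] at *
    have hx' : ¬ In a t C x := fun h => hx ⟨C, hC, hu, h⟩
    obtain ⟨z1, z2, h1, h2, h3, h4, h5, h6⟩ := exists_edge_of_notMem ht ht6 hC hx'
    refine ⟨z1, z2, ?_, h1, h2, ?_, ?_, h5⟩
    · rcases h6 u hu with h | h
      · exact h
      · linarith
    · rcases h6 w hw with h | h
      · linarith
      · exact h
    · intro j hj
      obtain rfl : j = 0 := by omega
      simp only [pow_zero, one_mul]
      exact ⟨⟨C, hC, hu, h3⟩, ⟨C, hC, hu, h4⟩⟩
  | succ k ih =>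
    intro u x w hux hxw hwu huw hjx hx
    obtain ⟨C, hC, hu, hw⟩ := huw 0 (by omega)
    obtain ⟨D, hD, hu', hxx⟩ := hjx 0 (by omega)
    simp only [pow_zero, one_mul] at hu hw hu' hxx
    obtain rfl := cell_unique ht ht6 hC hD hu hu'
    have hu1 : In a t C (u + 1) := by simpa using hu.add_int 1
    have l1 := psi_lt ht ht6 hu hxx hux
    have l2 := psi_lt ht ht6 hxx hw hxw
    have l3 := psi_lt ht ht6 hw hu1 hwu
    rw [psi_add_one] at l3
    obtain ⟨z1, z2, g1, g2, g3, g4, g5, g6⟩ := ih l1 l2 l3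
      (fun j hj => CellP.psi_iff.2 (huw (j+1) (by omega)))
      (fun j hj => CellP.psi_iff.2 (hjx (j+1) (by omega)))
      (fun h => hx (CellP.psi_iff.1 h))
    have hzc : ∀ j ≤ k, Cell a t (3^j*z1) (3^j*z2) := fun j hj =>
      ((g5 j hj).1.symm.trans ht ht6 (g5 j hj).2).cell
    have nolink : ∀ h : ℤ, ¬ Link z1 z2 (3*a+h/2) (3*a+h/2+3*t) := by
      intro h
      refine not_link_of_edge ht ht6 k hzc (fun j _ => ?_) (Or.inl g6)
      have := (H1.add h 0 0) j
      convert this.cell using 1 <;> push_cast <;> ring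
    have e1 : ∃ y1, In a t C y1 ∧ psi a t C y1 = z1 := by
      rcases psi_surj ht ht6 hC (a := a) z1 with h | ⟨h, h1, h2, h3⟩
      · exact h
      · exfalso
        refine nolink h (Link.symm (Link.of_lt h1 h2 ?_ ?_))
        · rcases h3 x hxx with h | h <;> linarith
        · rcases h3 u hu with h | h <;> linarith
    have e2 : ∃ y2, In a t C y2 ∧ psi a t C y2 = z2 := by
      rcases psi_surj ht ht6 hC (a := a) z2 with h | ⟨h, h1, h2, h3⟩
      · exact h
      · exfalso
        refine nolink h (Link.of_lt ?_ h1 h2 ?_)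
        · rcases h3 x hxx with h | h <;> linarith
        · rcases h3 w hw with h | h <;> linarith
    obtain ⟨y1, hy1, rfl⟩ := e1
    obtain ⟨y2, hy2, rfl⟩ := e2
    rw [psi_le_iff ht ht6 hu hy1] at g1
    rw [psi_lt_iff ht ht6 hy1 hxx] at g2
    rw [psi_lt_iff ht ht6 hxx hy2] at g3
    rw [psi_le_iff ht ht6 hy2 hw] at g4
    refine ⟨y1, y2, g1, g2, g3, g4, ?_, Edge.psi_iff.1 g6⟩
    intro j hj
    rcases j with _ | j
    · simp only [pow_zero, one_mul]
      exact ⟨⟨C, hC, hu, hy1⟩, ⟨C, hC, hu, hy2⟩⟩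
    · have := g5 j (by omega)
      rwa [CellP.psi_iff, CellP.psi_iff] at this

end

section
variable {a t : ℝ}

variable (a t) in
/-- The monotone lift of an iterate of tripling along an itinerary. -/
def Psi (C : ℕ → Cl) : ℕ → ℝ → ℝ
  | 0, x => x
  | n + 1, x => psi a t (C n) (Psi C n x)

lemma Psi_cong (C : ℕ → Cl) (n : ℕ) (x : ℝ) : ∃ m : ℤ, Psi a t C n x = 3^n * x + m := by
  induction n with
  | zero => exact ⟨0, by simp [Psi]⟩
  | succ n ih =>
    obtain ⟨m, hm⟩ := ih
    obtain ⟨l, hl⟩ := psi_cong (a := a) (t := t) (C n) (Psi a t C n x)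
    exact ⟨3 * m + l, by rw [Psi, hl, hm]; push_cast; ring⟩

lemma Psi_add_int (C : ℕ → Cl) (n : ℕ) (x : ℝ) (m : ℤ) :
    Psi a t C n (x + m) = Psi a t C n x + m := by
  induction n with
  | zero => rfl
  | succ n ih => rw [Psi, ih, psi_add_int, Psi]

lemma Psi_mem {C : ℕ → Cl} {n : ℕ} {x : ℝ} {D : Cl} (h : In a t D (3^n * x)) :
    In a t D (Psi a t C n x) := by
  obtain ⟨m, hm⟩ := Psi_cong (a := a) (t := t) C n x
  rw [hm]; exact h.add_int m

lemma Psi_lt (ht : 0 < t) (ht6 : t < 1/6) {C : ℕ → Cl} {n : ℕ} {x y : ℝ}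
    (hx : ∀ j < n, In a t (C j) (3^j * x)) (hy : ∀ j < n, In a t (C j) (3^j * y)) (h : x < y) :
    Psi a t C n x < Psi a t C n y := by
  induction n with
  | zero => exact h
  | succ n ih =>
    exact psi_lt ht ht6 (Psi_mem (hx n (by omega))) (Psi_mem (hy n (by omega)))
      (ih (fun j hj => hx j (by omega)) (fun j hj => hy j (by omega)))

lemma Psi_lt_iff (ht : 0 < t) (ht6 : t < 1/6) {C : ℕ → Cl} {n : ℕ} {x y : ℝ}
    (hx : ∀ j < n, In a t (C j) (3^j * x)) (hy : ∀ j < n, In a t (C j) (3^j * y)) :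
    Psi a t C n x < Psi a t C n y ↔ x < y := by
  refine ⟨fun h => ?_, Psi_lt ht ht6 hx hy⟩
  by_contra hc
  rcases (not_lt.1 hc).lt_or_eq with h' | h'
  · exact absurd (Psi_lt ht ht6 hy hx h') (not_lt.2 h.le)
  · rw [h'] at h; exact lt_irrefl _ h

lemma Psi_le_iff (ht : 0 < t) (ht6 : t < 1/6) {C : ℕ → Cl} {n : ℕ} {x y : ℝ}
    (hx : ∀ j < n, In a t (C j) (3^j * x)) (hy : ∀ j < n, In a t (C j) (3^j * y)) :
    Psi a t C n x ≤ Psi a t C n y ↔ x ≤ y := by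
  rw [← not_lt, Psi_lt_iff ht ht6 hy hx, not_lt]

lemma psi_sub_le {C : Cl} {x y : ℝ} (h : x ≤ y) : psi a t C y - psi a t C x ≤ 3 * (y - x) := by
  have hp : (0:ℝ) < (C.pp:ℝ)/2 := by rcases C.pp_cases_real with h | h <;> rw [h] <;> norm_num
  have : (⌊(x - C.lo a t) / ((C.pp:ℝ) / 2)⌋ : ℝ) ≤ ⌊(y - C.lo a t) / ((C.pp:ℝ) / 2)⌋ := by
    have : ⌊(x - C.lo a t) / ((C.pp:ℝ) / 2)⌋ ≤ ⌊(y - C.lo a t) / ((C.pp:ℝ) / 2)⌋ :=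
      Int.floor_le_floor (div_le_div_of_nonneg_right (by linarith) hp.le)
    exact_mod_cast this
  unfold psi
  nlinarith

lemma Psi_sub_le (ht : 0 < t) (ht6 : t < 1/6) {C : ℕ → Cl} {n : ℕ} {x y : ℝ}
    (hx : ∀ j < n, In a t (C j) (3^j * x)) (hy : ∀ j < n, In a t (C j) (3^j * y)) (h : x ≤ y) :
    Psi a t C n y - Psi a t C n x ≤ 3^n * (y - x) := by
  induction n with
  | zero => simp [Psi]
  | succ n ih =>
    have hx' : ∀ j < n, In a t (C j) (3^j * x) := fun j hj => hx j (by omega)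
    have hy' : ∀ j < n, In a t (C j) (3^j * y) := fun j hj => hy j (by omega)
    have h1 := ih hx' hy'
    have h2 := psi_sub_le (a := a) (t := t) (C := C n) ((Psi_le_iff ht ht6 hx' hy').2 h)
    rw [pow_succ]
    simp only [Psi]
    linarith

variable (a t) in
/-- A pair of points sharing central cells up to time `k`, when they bound a gap. -/
def LF (k : ℕ) (x y : ℝ) : Prop :=
  (∀ j ≤ k, CellP a t (3^j*x) (3^j*y)) ∧ (Edge a t (3^k*x) (3^k*y) ∨ Edge a t (3^k*y) (3^k*x))

lemma LF.symm {k : ℕ} {x y : ℝ} (h : LF a t k x y) : LF a t k y x :=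
  ⟨fun j hj => (h.1 j hj).symm, h.2.symm⟩

lemma LF.add {n : ℕ} {x y : ℝ} (h : LF a t n x y) (k i j : ℤ) :
    LF a t n (x + k / 2 + i) (y + k / 2 + j) := by
  have e : ∀ (l : ℕ) (z : ℝ) (i : ℤ), 3^l * (z + k/2 + i) =
      3^l * z + ((3^l*k : ℤ) : ℝ)/2 + ((3^l*i : ℤ):ℝ) := by
    intros; push_cast; ring
  refine ⟨fun l hl => ?_, ?_⟩
  · rw [e, e]; exact (h.1 l hl).add _ _ _
  · rw [e, e]; exact h.2.imp (fun h => h.add _ _ _) (fun h => h.add _ _ _)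

lemma LF.pow {n j : ℕ} {x y : ℝ} (h : LF a t n x y) (hj : j ≤ n) :
    LF a t (n - j) (3^j*x) (3^j*y) := by
  have e : ∀ (l : ℕ) (z : ℝ), 3^l * (3^j * z) = 3^(l+j) * z := by
    intros; rw [pow_add, mul_assoc]
  refine ⟨fun l hl => ?_, ?_⟩
  · rw [e, e]; exact h.1 _ (by omega)
  · rw [e, e, Nat.sub_add_cancel hj]; exact h.2

lemma LF.not_link (ht : 0 < t) (ht6 : t < 1/6) {n m : ℕ} {x y u v : ℝ} (h : LF a t n x y)
    (h' : LF a t m u v) : ¬ Link x y u v := by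
  rcases le_total n m with hnm | hnm
  · exact not_link_of_edge ht ht6 n (fun j hj => (h.1 j hj).cell)
      (fun j hj => (h'.1 j (hj.trans hnm)).cell) h.2
  · intro hL
    exact not_link_of_edge ht ht6 m (fun j hj => (h'.1 j hj).cell)
      (fun j hj => (h.1 j (hj.trans hnm)).cell) h'.2 hL.symm

lemma LF.not_link_same (ht : 0 < t) (ht6 : t < 1/6) {n : ℕ} {x y u v : ℝ} (h : LF a t n x y)
    (h' : Same a t u v) : ¬ Link x y u v :=
  not_link_of_edge ht ht6 n (fun j hj => (h.1 j hj).cell) (fun j _ => (h' j).cell) h.2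

variable (a t) in
/-- A leaf following the itinerary of `u` until it bounds a gap. -/
def Good (u : ℝ) (k : ℕ) (z1 z2 : ℝ) : Prop :=
  (∀ j ≤ k, CellP a t (3^j*u) (3^j*z1) ∧ CellP a t (3^j*u) (3^j*z2)) ∧ Edge a t (3^k*z1) (3^k*z2)

lemma Good.lf (ht : 0 < t) (ht6 : t < 1/6) {u z1 z2 : ℝ} {k : ℕ} (h : Good a t u k z1 z2) :
    LF a t k z1 z2 :=
  ⟨fun j hj => (h.1 j hj).1.symm.trans ht ht6 (h.1 j hj).2, Or.inl h.2⟩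

lemma exists_good_around (ht : 0 < t) (ht6 : t < 1/6) (H1 : Same a t (3*a) (3*a+3*t))
    {u x w : ℝ} (hux : u < x) (hxw : x < w) (hwu : w < u + 1) (huw : Same a t u w)
    {k : ℕ} (hx : ¬ CellP a t (3^k*u) (3^k*x)) :
      ∃ k' ≤ k, ∃ z1 z2, u ≤ z1 ∧ z1 < x ∧ x < z2 ∧ z2 ≤ w ∧ Good a t u k' z1 z2 := by
  classical
  have hex : ∃ k, ¬ CellP a t (3^k*u) (3^k*x) := ⟨k, hx⟩
  obtain ⟨z1, z2, h1, h2, h3, h4, h5, h6⟩ := exists_leaf_around ht ht6 H1 (Nat.find hex) hux hxw hwu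
    (fun j _ => huw j) (fun j hj => not_not.1 (Nat.find_min hex hj)) (Nat.find_spec hex)
  exact ⟨Nat.find hex, Nat.find_min' hex hx, z1, z2, h1, h2, h3, h4, h5, h6⟩

lemma exists_good_close (ht : 0 < t) (ht6 : t < 1/6) (H1 : Same a t (3*a) (3*a+3*t))
    {u w : ℝ} (huw : u < w) (hwu : w < u + 1) (hs : Same a t u w)
    (hno : ∀ x, u < x → x < w → ¬ Same a t u x) {ε : ℝ} (hε : 0 < ε) :
    ∃ k z1 z2, u ≤ z1 ∧ z1 < u + ε ∧ z1 < z2 ∧ w - ε < z2 ∧ z2 ≤ w ∧ Good a t u k z1 z2 := by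
  have key : ∀ x, u < x → x < w →
      ∃ k z1 z2, u ≤ z1 ∧ z1 < x ∧ x < z2 ∧ z2 ≤ w ∧ Good a t u k z1 z2 := by
    intro x h1 h2
    obtain ⟨k, hk⟩ : ∃ k, ¬ CellP a t (3^k*u) (3^k*x) := by
      by_contra hc
      push Not at hc
      exact hno x h1 h2 hc
    obtain ⟨k', -, h⟩ := exists_good_around ht ht6 H1 h1 h2 hwu hs hk
    exact ⟨k', h⟩
  set Z : Set ℝ := {z | ∃ k z1, u ≤ z1 ∧ z1 < u + ε ∧ z1 < z ∧ z ≤ w ∧ Good a t u k z1 z} with hZ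
  have hbdd : BddAbove Z := ⟨w, fun z hz => by obtain ⟨_, _, _, _, _, h, _⟩ := hz; exact h⟩
  have hne : ∃ z ∈ Z, u < z := by
    obtain ⟨k, z1, z2, h1, h2, h3, h4, h5⟩ := key (u + min (ε/2) ((w-u)/2))
      (by have : 0 < min (ε/2) ((w-u)/2) := lt_min (by linarith) (by linarith)
          linarith)
      (by have := min_le_right (ε/2) ((w-u)/2); linarith)
    have := min_le_left (ε/2) ((w-u)/2)
    exact ⟨z2, ⟨k, z1, h1, by linarith, by linarith, h4, h5⟩, by linarith⟩
  by_cases hsup : ∃ z ∈ Z, w - ε < z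
  · obtain ⟨z, ⟨k, z1, h1, h2, h3, h4, h5⟩, h6⟩ := hsup
    exact ⟨k, z1, z, h1, h2, h3, h6, h4, h5⟩
  push Not at hsup
  exfalso
  obtain ⟨z0, hz0, hz0u⟩ := hne
  have hs1 : sSup Z ≤ w - ε := csSup_le ⟨z0, hz0⟩ hsup
  have hs2 : u < sSup Z := hz0u.trans_le (le_csSup hbdd hz0)
  obtain ⟨k, y1, y2, h1, h2, h3, h4, h5⟩ := key (sSup Z) hs2 (by linarith)
  by_cases hy : y1 < u + ε
  · have : y2 ≤ sSup Z := le_csSup hbdd ⟨k, y1, h1, hy, by linarith, h4, h5⟩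
    linarith
  · obtain ⟨z, hz, hyz⟩ := exists_lt_of_lt_csSup ⟨z0, hz0⟩ h2
    have hzs := le_csSup hbdd hz
    obtain ⟨l, z1, g1, g2, g3, g4, g5⟩ := hz
    refine (g5.lf ht ht6).not_link ht ht6 (h5.lf ht ht6) (Link.of_lt ?_ hyz ?_ ?_) <;> linarith

/-- Enlarging (or shrinking) the central cells. -/
lemma In.widen {C : Cl} (hC : C.isP) {d1 d2 s x : ℝ} {n : ℤ}
    (h1 : C.lo a t - d2 ≤ x + s - C.pp / 2 * n)
    (h2 : x + s - C.pp / 2 * n ≤ C.lo a t + C.wid t + d1) :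
    In (a + d1) (t - d1 - d2) C (x + s) := by
  refine ⟨n, ?_, ?_⟩ <;> cases C <;> simp only [Cl.isP] at hC <;>
    simp only [Cl.lo, Cl.wid] at * <;> linarith

lemma Edge.widen {d1 d2 x y : ℝ} (h : Edge a t x y) :
    Edge (a + d1) (t - d1 - d2) (x + d1) (y - d2) := by
  obtain ⟨C, hC, n, m, rfl, rfl⟩ := h
  refine ⟨C, hC, n, m, ?_, ?_⟩ <;> cases C <;> simp only [Cl.isP] at hC <;>
    simp only [Cl.lo, Cl.wid] at * <;> ring

lemma same_of_edge {k : ℕ}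
    (h : LF a t k (3*a) (3*a+3*t)) : Same a t (3*a) (3*a+3*t) := by
  intro i
  induction i using Nat.strong_induction_on with
  | _ i ih =>
    rcases le_or_gt i k with hi | hi
    · exact h.1 i hi
    · obtain ⟨l, rfl⟩ : ∃ l, i = l + (k + 1) := ⟨i - (k+1), by omega⟩
      have hl := ih l (by omega)
      have e : ∀ z : ℝ, (3:ℝ)^(l+(k+1)) * z = 3^l * (3 * (3^k * z)) := by intro z; ring
      rw [e, e]
      rcases h.2 with h | h
      · obtain ⟨p, j, e1, e2⟩ := h.image
        rw [e1, e2]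
        have := hl.add (3^l*p) 0 (3^l*j)
        convert this using 1 <;> push_cast <;> ring
      · obtain ⟨p, j, e1, e2⟩ := h.image
        rw [e1, e2]
        have := (hl.add (3^l*p) 0 (3^l*j)).symm
        convert this using 1 <;> push_cast <;> ring

lemma scaled_le {I K X d : ℝ} (hI : 0 < I) (hIK : I ≤ K) (h : K * X = d) (hd : 0 ≤ d) :
    0 ≤ I * X ∧ I * X ≤ d := by
  have hX : 0 ≤ X := by
    by_contra hc
    push Not at hc
    have := mul_neg_of_pos_of_neg (hI.trans_le hIK) hc
    linarith
  exact ⟨mul_nonneg hI.le hX, h ▸ mul_le_mul_of_nonneg_right hIK hX⟩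

/-- Perturbation to a co-periodic pair, when the minor is approximated from the short side. -/
lemma approx_short (ht : 0 < t) (ht6 : t < 1/6) (H1 : Same a t (3*a) (3*a+3*t))
    (hno : ∀ x, 3*a < x → x < 3*a+3*t → ¬ Same a t (3*a) x) {ε : ℝ} (hε : 0 < ε) :
    ∃ a' t', |a' - a| < ε ∧ |a' + t' - (a + t)| < ε ∧ 0 < t' ∧ t' < 1/6 ∧
      ∃ k, LF a' t' k (3*a') (3*a'+3*t') := by
  obtain ⟨k, z1, z2, h1, h2, h3, h4, h5, h6, h7⟩ :=
    exists_good_close ht ht6 H1 (by linarith) (by linarith) H1 hno (lt_min hε ht)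
  have hε1 := min_le_left ε t
  have hε2 := min_le_right ε t
  obtain ⟨p, j, e1, e2⟩ := h7.image
  have hN : (3:ℝ) ≤ 3^(k+1) := by
    have : (1:ℝ) ≤ 3^k := one_le_pow₀ (by norm_num)
    rw [pow_succ]; linarith
  set K : ℝ := 3^k with hK
  have hK1 : 1 ≤ K := one_le_pow₀ (by norm_num)
  have hM : (0:ℝ) < 3 * K - 1 := by linarith
  set d1 : ℝ := K * (z1 - 3*a) / (3*K - 1) with hd1
  set d2 : ℝ := K * (3*a + 3*t - z2) / (3*K - 1) with hd2
  have f1 : d1 * (3 * K - 1) = K * (z1 - 3 * a) := div_mul_cancel₀ _ hM.ne'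
  have f2 : d2 * (3 * K - 1) = K * (3*a+3*t - z2) := div_mul_cancel₀ _ hM.ne'
  have d1n : 0 ≤ d1 := div_nonneg (mul_nonneg (by linarith) (by linarith)) hM.le
  have d2n : 0 ≤ d2 := div_nonneg (mul_nonneg (by linarith) (by linarith)) hM.le
  have b1 : 2 * d1 ≤ z1 - 3 * a := by nlinarith
  have b2 : 2 * d2 ≤ 3*a+3*t - z2 := by nlinarith
  have g1 : K * (3 * (a + d1)) = K * z1 + d1 := by linarith
  have g2 : K * (3 * (a + d1) + 3 * (t - d1 - d2)) = K * z2 - d2 := by linarith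
  refine ⟨a + d1, t - d1 - d2, ?_, ?_, ?_, ?_, k, ?_, Or.inl ?_⟩
  · rw [abs_lt]; constructor <;> linarith
  · rw [abs_lt]; constructor <;> linarith
  · linarith
  · linarith
  · intro i hi
    obtain ⟨⟨C, hC, c1, c2⟩, ⟨D, hD, c3, c4⟩⟩ := h6 i hi
    obtain rfl := cell_unique ht ht6 hC hD c1 c3
    obtain ⟨n, n1, n2⟩ := c2
    obtain ⟨m, m1, m2⟩ := c4
    have hI1 : (1:ℝ) ≤ 3^i := one_le_pow₀ (by norm_num)
    have hI2 : (3:ℝ)^i ≤ K := pow_le_pow_right₀ (by norm_num) hi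
    set I : ℝ := 3^i with hI
    -- the shift of the first endpoint is `I / K * d1`
    have s1 : I * (3 * (a + d1)) = I * z1 + I * (3 * (a + d1) - z1) := by ring
    have s2 : I * (3 * (a + d1) + 3 * (t - d1 - d2)) =
        I * z2 + I * (3 * (a + d1) + 3 * (t - d1 - d2) - z2) := by ring
    have r1 : K * (3 * (a + d1) - z1) = d1 := by linarith
    have r2 : K * (3 * (a + d1) + 3 * (t - d1 - d2) - z2) = - d2 := by linarith
    obtain ⟨q1', q1⟩ := scaled_le (by linarith) hI2 r1 d1n
    obtain ⟨q2', q2⟩ := scaled_le (X := - (3 * (a + d1) + 3 * (t - d1 - d2) - z2))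
      (by linarith) hI2 (by linarith) d2n
    rw [mul_neg] at q2 q2'
    refine ⟨C, hC, ?_, ?_⟩
    · rw [s1]
      exact In.widen (n := n) hC (by linarith) (by linarith)
    · rw [s2]
      exact In.widen (n := m) hC (by linarith) (by linarith)
  · rw [g1, g2]; exact h7.widen

end

section
variable {a t : ℝ}

lemma Edge.not_between (ht : 0 < t) (ht6 : t < 1/6) {x y z : ℝ} {C : Cl} (h : Edge a t x y)
    (hC : C.isP) (hx : In a t C x) (hz : In a t C z) (hyx : y ≤ x + 1) (h1 : x < z)
    (h2 : z < y) : False := by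
  obtain ⟨D, hD, hx', hy'⟩ := h.mem ht ht6
  obtain ⟨C', hC', n, m, rfl, rfl⟩ := h
  have hw := Cl.wid_pos ht ht6 C'
  have hw3 := Cl.three_wid_lt ht ht6 C'
  have hxx : In a t C' (C'.lo a t + C'.wid t + C'.pp / 2 * n) := ⟨n, by linarith, by linarith⟩
  obtain rfl := cell_unique ht ht6 hC hC' hx hxx
  have hm1 : (m:ℝ) < 1 := by
    rcases C.pp_cases_real with hp | hp <;> simp only [hp] at * <;> linarith
  have hm2 : (-1:ℝ) < m := by
    rcases C.pp_cases_real with hp | hp <;> simp only [hp] at * <;> linarith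
  have hm1 : m < 1 := by exact_mod_cast hm1
  have hm2 : -1 < m := by exact_mod_cast hm2
  obtain rfl : m = 0 := by omega
  obtain ⟨l, g1, g2⟩ := hz
  rcases le_or_gt l n with hl | hl
  · have : (l:ℝ) ≤ n := by exact_mod_cast hl
    rcases C.pp_cases_real with hp | hp <;> simp only [hp, Int.cast_zero] at * <;> linarith
  · have : (n:ℝ) + 1 ≤ l := by exact_mod_cast hl
    rcases C.pp_cases_real with hp | hp <;> simp only [hp, Int.cast_zero] at * <;> linarith

lemma Same.exists_itinerary {x y : ℝ} (h : Same a t x y) :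
    ∃ C : ℕ → Cl, ∀ j, (C j).isP ∧ In a t (C j) (3^j*x) ∧ In a t (C j) (3^j*y) := by
  choose C h1 h2 h3 using h
  exact ⟨C, fun j => ⟨h1 j, h2 j, h3 j⟩⟩

lemma CellP.in_of_in (ht : 0 < t) (ht6 : t < 1/6) {C : Cl} (hC : C.isP) {x y : ℝ}
    (hx : In a t C x) (h : CellP a t x y) : In a t C y := by
  obtain ⟨D, hD, h1, h2⟩ := h
  obtain rfl := cell_unique ht ht6 hC hD hx h1
  exact h2

lemma In.pow_add_one {C : Cl} {j : ℕ} {x : ℝ} (h : In a t C (3^j*x)) :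
    In a t C (3^j*(x+1)) := by
  have := h.add_int (3^j)
  convert this using 1; push_cast; ring

lemma exists_good_above (ht : 0 < t) (ht6 : t < 1/6) (H1 : Same a t (3*a) (3*a+3*t))
    (NE : ∀ k, ¬ LF a t k (3*a) (3*a+3*t)) {k : ℕ} {z1 z2 : ℝ} (h1 : 3*a+3*t ≤ z1) (h12 : z1 < z2)
    (h2 : z2 ≤ 3*a+1) (h : LF a t k z1 z2) : ∃ k' ≤ k, ∃ y1 y2, 3*a+3*t ≤ y1 ∧ y1 ≤ z1 ∧
      z2 ≤ y2 ∧ y2 ≤ 3*a+1 ∧ Good a t (3*a+3*t) k' y1 y2 := by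
  by_cases hall : ∀ j ≤ k, CellP a t (3^j*(3*a+3*t)) (3^j*z1)
  · have hall2 : ∀ j ≤ k, CellP a t (3^j*(3*a+3*t)) (3^j*z2) := fun j hj =>
      (hall j hj).trans ht ht6 (h.1 j hj)
    rcases h.2 with he | he
    · exact ⟨k, le_rfl, z1, z2, h1, le_rfl, le_rfl, h2,
        fun j hj => ⟨hall j hj, hall2 j hj⟩, he⟩
    · exfalso
      obtain ⟨C, hC⟩ := H1.exists_itinerary
      have iA : ∀ j ≤ k, In a t (C j) (3^j*(3*a)) := fun j _ => (hC j).2.1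
      have iB : ∀ j ≤ k, In a t (C j) (3^j*(3*a+3*t)) := fun j _ => (hC j).2.2
      have i1 : ∀ j ≤ k, In a t (C j) (3^j*z1) := fun j hj =>
        (hall j hj).in_of_in ht ht6 (hC j).1 (iB j hj)
      have i2 : ∀ j ≤ k, In a t (C j) (3^j*z2) := fun j hj =>
        (hall2 j hj).in_of_in ht ht6 (hC j).1 (iB j hj)
      have l1 := (Psi_le_iff ht ht6 (C := C) (n := k) (fun j hj => i2 j hj.le)
        (fun j hj => (iA j hj.le).pow_add_one)).2 h2
      have l2 := (Psi_le_iff ht ht6 (C := C) (n := k) (fun j hj => (iB j hj.le).pow_add_one)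
        (fun j hj => (i1 j hj.le).pow_add_one)).2 (by linarith : 3*a+3*t+1 ≤ z1+1)
      have l3 := (Psi_lt_iff ht ht6 (C := C) (n := k) (fun j hj => (iA j hj.le).pow_add_one)
        (fun j hj => (iB j hj.le).pow_add_one)).2 (by linarith : 3*a+1 < 3*a+3*t+1)
      have l4 := (Psi_lt_iff ht ht6 (C := C) (n := k) (fun j hj => i1 j hj.le)
        (fun j hj => i2 j hj.le)).2 h12
      have a1 : ∀ x, Psi a t C k (x + 1) = Psi a t C k x + 1 := fun x => by
        simpa using Psi_add_int (a := a) (t := t) C k x 1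
      rw [a1] at l1
      rw [a1, a1] at l2 l3
      have edge : Edge a t (Psi a t C k z2) (Psi a t C k z1 + 1) := by
        obtain ⟨m, hm⟩ := Psi_cong (a := a) (t := t) C k z1
        obtain ⟨m', hm'⟩ := Psi_cong (a := a) (t := t) C k z2
        have := he.add 0 m' (m + 1)
        rw [hm, hm']
        convert this using 1 <;> push_cast <;> ring
      have hmA : In a t (C k) (Psi a t C k (3*a) + 1) := by
        simpa using (Psi_mem (C := C) (n := k) (iA k le_rfl)).add_int 1
      have hmB : In a t (C k) (Psi a t C k (3*a+3*t) + 1) := by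
        simpa using (Psi_mem (C := C) (n := k) (iB k le_rfl)).add_int 1
      have hm2 := Psi_mem (C := C) (n := k) (i2 k le_rfl)
      have eA : Psi a t C k (3*a) + 1 = Psi a t C k z2 := by
        rcases l1.lt_or_eq with hlt | heq
        · exact (edge.not_between ht ht6 (hC k).1 hm2 hmA (by linarith) hlt (by linarith)).elim
        · exact heq.symm
      have eB : Psi a t C k (3*a+3*t) + 1 = Psi a t C k z1 + 1 := by
        rcases l2.lt_or_eq with hlt | heq
        · exact (edge.not_between ht ht6 (hC k).1 hm2 hmB (by linarith) (by linarith) hlt).elim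
        · exact heq
      refine NE k ⟨fun j _ => H1 j, Or.inl ?_⟩
      obtain ⟨m, hm⟩ := Psi_cong (a := a) (t := t) C k (3*a)
      obtain ⟨m', hm'⟩ := Psi_cong (a := a) (t := t) C k (3*a+3*t)
      rw [← eA, ← eB, hm, hm'] at edge
      have := edge.add 0 (-m-1) (-m'-1)
      convert this using 1 <;> push_cast <;> ring
  · push Not at hall
    obtain ⟨j, hj, hjc⟩ := hall
    have hne : 3*a+3*t < z1 := by
      rcases h1.lt_or_eq with h | h
      · exact h
      · exfalso; apply hjc; rw [← h]; exact (H1 j).symm.trans ht ht6 (H1 j)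
    have hBA : Same a t (3*a+3*t) (3*a+1) := by
      simpa using H1.symm.add 0 0 1
    obtain ⟨k', hk', y1, y2, g1, g2, g3, g4, g5⟩ := exists_good_around ht ht6 H1 hne
      (by linarith : z1 < 3*a+1) (by linarith) hBA hjc
    refine ⟨k', by omega, y1, y2, g1, g2.le, ?_, g4, g5⟩
    by_contra hc
    push Not at hc
    refine (g5.lf ht ht6).not_link ht ht6 h (Link.of_lt g2 g3 hc ?_)
    linarith

lemma window_avoid (ht : 0 < t) (ht6 : t < 1/6) (H1 : Same a t (3*a) (3*a+3*t)) {ε : ℝ}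
    (hεt : ε ≤ 3*t) (hε2 : 3*t+2*ε ≤ 1) {k : ℕ}
    (hmin : ∀ k' z1 z2, 3*a+3*t ≤ z1 → z1 < 3*a+3*t+ε → 3*a+1-ε < z2 → z2 ≤ 3*a+1 →
      LF a t k' z1 z2 → k ≤ k')
    {y1 y2 : ℝ} (hy1 : 3*a-ε < y1) (hy1' : y1 ≤ 3*a) (hy2 : 3*a+3*t ≤ y2) (hy2' : y2 < 3*a+3*t+ε)
    (he : LF a t k y1 y2) {n : ℕ} {P Q : ℝ} (hn : n < k) (h : LF a t n P Q)
    (hs : 3*t ≤ nd (P - Q)) : ¬ (3*a+3*t ≤ P ∧ P < y2) ∧ ¬ (y1 < P ∧ P ≤ 3*a) := by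
  obtain ⟨l, hl1, hl2⟩ : ∃ l : ℤ, y1 ≤ Q + l ∧ Q + l < y1 + 1 := by
    refine ⟨-⌊Q - y1⌋, ?_, ?_⟩
    · have := Int.floor_le (Q - y1); push_cast; linarith
    · have := Int.lt_floor_add_one (Q - y1); push_cast; linarith
  have h' : LF a t n P (Q + l) := by simpa using h.add 0 0 l
  have hs' : 3*t ≤ |P - (Q + l)| := by
    refine hs.trans ((nd_le _ l).trans (le_of_eq ?_)); congr 1; ring
  clear h hs
  set R := Q + l with hR
  have hQ2 : y1 < P → P < y2 → R ≤ y2 := by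
    intro h1 h2
    by_contra hc
    push Not at hc
    exact he.not_link ht ht6 h' (Link.of_lt h1 h2 hc hl2)
  constructor
  · rintro ⟨h1, h2⟩
    have h3 := hQ2 (by linarith) h2
    rcases le_or_gt (3*a+3*t) R with hc | hc
    · have : |P - R| < 3*t := abs_lt.2 ⟨by linarith, by linarith⟩
      linarith
    · rcases le_or_gt R (3*a) with hc2 | hc2
      · have := hmin n P (R+1) h1 (by linarith) (by linarith) (by linarith)
          (by simpa using h'.add 0 0 1)
        omega
      · rcases h1.lt_or_eq with hlt | heq
        · exact h'.symm.not_link_same ht ht6 (H1.symm.add 0 0 1) (by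
            simp only [Int.cast_zero, zero_div, add_zero, Int.cast_one]
            exact Link.of_lt hc hlt (by linarith) (by linarith))
        · have : |P - R| < 3*t := abs_lt.2 ⟨by linarith, by linarith⟩
          linarith
  · rintro ⟨h1, h2⟩
    have h3 := hQ2 h1 (by linarith)
    rcases le_or_gt R (3*a) with hc | hc
    · have : |P - R| < 3*t := abs_lt.2 ⟨by linarith, by linarith⟩
      linarith
    · rcases le_or_gt (3*a+3*t) R with hc2 | hc2
      · have := hmin n R (P+1) hc2 (by linarith) (by linarith) (by linarith)
          (by simpa using h'.symm.add 0 0 1)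
        omega
      · rcases h2.lt_or_eq with hlt | heq
        · exact h'.not_link_same ht ht6 H1 (Link.of_lt hlt hc hc2 (by linarith))
        · have : |P - R| < 3*t := abs_lt.2 ⟨by linarith, by linarith⟩
          linarith

end

section
variable {a t : ℝ}

lemma Edge.psi_sub (ht : 0 < t) (ht6 : t < 1/6) {x y : ℝ} {C : Cl} (h : Edge a t x y)
    (hC : C.isP) (hx : In a t C x) (hxy : x < y) (hyx : y < x + 1) :
    psi a t C y - psi a t C x = 3 * t := by
  obtain ⟨C', hC', n, m, rfl, rfl⟩ := h
  have hw := Cl.wid_pos ht ht6 C'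
  have hw3 := Cl.three_wid_lt ht ht6 C'
  have hiw := Cl.isP_wid (t := t) hC'
  have hxx : In a t C' (C'.lo a t + C'.wid t + C'.pp / 2 * n) := ⟨n, by linarith, by linarith⟩
  obtain rfl := cell_unique ht ht6 hC hC' hx hxx
  have hm1 : (m:ℝ) < 1 := by
    rcases C.pp_cases_real with hp | hp <;> simp only [hp] at * <;> linarith
  have hm2 : (-1:ℝ) < m := by
    rcases C.pp_cases_real with hp | hp <;> simp only [hp] at * <;> linarith
  have hm1 : m < 1 := by exact_mod_cast hm1
  have hm2 : -1 < m := by exact_mod_cast hm2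
  obtain rfl : m = 0 := by omega
  have hpp : (0:ℝ) < C.pp := by rcases C.pp_cases_real with hp | hp <;> rw [hp] <;> norm_num
  have f1 : ⌊(C.lo a t + C.pp / 2 * (n + 1) + (0:ℤ) - C.lo a t) / ((C.pp:ℝ) / 2)⌋ = n + 1 := by
    rw [Int.floor_eq_iff]
    have : (C.lo a t + C.pp / 2 * (n + 1) + (0:ℤ) - C.lo a t) / ((C.pp:ℝ) / 2) = n + 1 := by
      field_simp; push_cast; ring
    rw [this]; push_cast; constructor <;> linarith
  have f2 : ⌊(C.lo a t + C.wid t + C.pp / 2 * n - C.lo a t) / ((C.pp:ℝ) / 2)⌋ = n := by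
    rw [Int.floor_eq_iff]
    have : (C.lo a t + C.wid t + C.pp / 2 * n - C.lo a t) / ((C.pp:ℝ) / 2) =
        n + C.wid t / (C.pp / 2) := by
      field_simp; ring
    rw [this]
    have h1 : 0 < C.wid t / (C.pp / 2) := by positivity
    have h2 : C.wid t / (C.pp / 2) < 1 := by rw [div_lt_one (by positivity)]; linarith
    constructor <;> linarith
  unfold psi
  rw [f1, f2]
  push_cast
  linarith

lemma LF.sep (ht : 0 < t) {k : ℕ} {x y : ℝ} (h : LF a t k x y) (hs : 3*t ≤ nd (x - y)) :
    ∀ j ≤ k, 3*t ≤ nd (3^j*x - 3^j*y) := by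
  intro j
  induction j with
  | zero => intro _; simpa using hs
  | succ j ih =>
    intro hj
    have h1 := ih (by omega)
    have h2 := (h.1 j (by omega)).grow ht
    have e : ∀ z : ℝ, (3:ℝ)^(j+1) * z = 3 * (3^j*z) := by intro z; ring
    rw [e, e]
    refine le_trans (le_min ?_ le_rfl) h2
    linarith

lemma ratio_bounds (ht : 0 < t) (ht6 : t < 1/6) (H1 : Same a t (3*a) (3*a+3*t))
    (NE : ∀ k, ¬ LF a t k (3*a) (3*a+3*t))
    (hno : ∀ x, 3*a+3*t < x → x < 3*a+1 → ¬ Same a t (3*a+3*t) x) {ε : ℝ}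
    (hεt : ε ≤ 3*t) (hε2 : 3*t+2*ε ≤ 1) {k : ℕ}
    (hmin : ∀ k' z1 z2, 3*a+3*t ≤ z1 → z1 < 3*a+3*t+ε → 3*a+1-ε < z2 → z2 ≤ 3*a+1 →
      LF a t k' z1 z2 → k ≤ k')
    {z1 z2 : ℝ} (h1 : 3*a+3*t ≤ z1) (h1' : z1 < 3*a+3*t+ε) (h2 : 3*a+1-ε < z2) (h2' : z2 ≤ 3*a+1)
    (he : Good a t (3*a+3*t) k z1 z2) :
    3*a+1-z2 ≤ 3^(k+1) * (z1 - (3*a+3*t)) ∧ z1 - (3*a+3*t) ≤ 3^(k+1) * (3*a+1-z2) := by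
  classical
  have h12 : z1 < z2 := by linarith
  have heL := he.lf ht ht6
  have hBA : Same a t (3*a+3*t) (3*a+1) := by simpa using H1.symm.add 0 0 1
  obtain ⟨C, hC⟩ := H1.exists_itinerary
  have iB : ∀ j, In a t (C j) (3^j*(3*a+3*t)) := fun j => (hC j).2.2
  have iA1 : ∀ j, In a t (C j) (3^j*(3*a+1)) := fun j => (hC j).2.1.pow_add_one
  have good_mem : ∀ {n v1 v2}, Good a t (3*a+3*t) n v1 v2 → ∀ j ≤ n,
      In a t (C j) (3^j*v1) ∧ In a t (C j) (3^j*v2) := fun hv j hj =>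
    ⟨(hv.1 j hj).1.in_of_in ht ht6 (hC j).1 (iB j), (hv.1 j hj).2.in_of_in ht ht6 (hC j).1 (iB j)⟩
  have iz := good_mem he
  have iz1 : ∀ j < k+1, In a t (C j) (3^j*z1) := fun j hj => (iz j (by omega)).1
  have iz2 : ∀ j < k+1, In a t (C j) (3^j*z2) := fun j hj => (iz j (by omega)).2
  set F : ℝ → ℝ := Psi a t C (k+1) with hF
  have hFc : ∀ x, ∃ m : ℤ, F x = 3^(k+1)*x + m := fun x => Psi_cong C (k+1) x
  obtain ⟨h, j, e1, e2⟩ := he.2.image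
  obtain ⟨m1, hm1⟩ := hFc z1
  set θ : ℝ := ((h + 2*m1 : ℤ) : ℝ) / 2 with hθ
  have Fz1 : F z1 = 3*a + θ := by
    rw [hm1, hθ, pow_succ, mul_comm ((3:ℝ)^k) 3, mul_assoc, e1]; push_cast; ring
  have Fz2 : F z2 = 3*a+3*t + θ := by
    have hk1 := Psi_lt ht ht6 (C := C) (n := k) (fun j hj => (iz j hj.le).1)
      (fun j hj => (iz j hj.le).2) h12
    have hk2 := Psi_lt ht ht6 (C := C) (n := k) (x := z2) (y := z1 + 1)
      (fun j hj => (iz j hj.le).2) (fun j hj => (iz j hj.le).1.pow_add_one) (by linarith)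
    have a1 : Psi a t C k (z1 + 1) = Psi a t C k z1 + 1 := by
      simpa using Psi_add_int (a := a) (t := t) C k z1 1
    rw [a1] at hk2
    obtain ⟨n1, hn1⟩ := Psi_cong (a := a) (t := t) C k z1
    obtain ⟨n2, hn2⟩ := Psi_cong (a := a) (t := t) C k z2
    have hE : Edge a t (Psi a t C k z1) (Psi a t C k z2) := by
      have := he.2.add 0 n1 n2
      rw [hn1, hn2]; simpa using this
    have := hE.psi_sub ht ht6 (hC k).1 (Psi_mem (iz k le_rfl).1) hk1 hk2
    have e1 : F z2 = psi a t (C k) (Psi a t C k z2) := rfl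
    have e2 : F z1 = psi a t (C k) (Psi a t C k z1) := rfl
    rw [← e1, ← e2] at this
    linarith
  have FB : F (3*a+3*t) ≤ F z1 := (Psi_le_iff ht ht6 (fun j _ => iB j) iz1).2 h1
  have FA : F z2 ≤ F (3*a+1) := (Psi_le_iff ht ht6 iz2 (fun j _ => iA1 j)).2 h2'
  have FBA : F (3*a+1) < F (3*a+3*t) + 1 := by
    have := Psi_lt ht ht6 (C := C) (n := k+1) (x := 3*a+1) (y := 3*a+3*t+1) (fun j _ => iA1 j)
      (fun j _ => (iB j).pow_add_one) (by linarith)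
    have a1 : F (3*a+3*t+1) = F (3*a+3*t) + 1 := by
      simpa using Psi_add_int (a := a) (t := t) C (k+1) (3*a+3*t) 1
    rw [← a1]; exact this
  have bB := Psi_sub_le ht ht6 (n := k+1) (fun j _ => iB j) iz1 h1
  have bA := Psi_sub_le ht ht6 (n := k+1) iz2 (fun j _ => iA1 j) h2'
  rw [← hF] at bB bA
  -- the claim
  suffices hcl : F (3*a+3*t) - θ ≤ z2 - 1 ∧ z1 ≤ F (3*a+1) - θ by
    constructor <;> linarith
  by_contra hcl
  set L : ℝ := F (3*a+3*t) - θ with hL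
  set R : ℝ := F (3*a+1) - θ with hR
  obtain ⟨mB, hmB⟩ := hFc (3*a+3*t)
  obtain ⟨mA, hmA⟩ := hFc (3*a+1)
  have hLR : Same a t L R := by
    have := (hBA.pow (k+1)).add (-(h+2*m1)) mB mA
    rw [hL, hR, hmB, hmA, hθ]
    convert this using 1 <;> push_cast <;> ring
  have hsep : 3*t ≤ nd (L - R) := by
    have hnd : 3*t ≤ nd (3^0*(3*a+3*t) - 3^0*(3*a+1)) := by
      have : (3:ℝ)^0*(3*a+3*t) - 3^0*(3*a+1) = 3*t + ((-1:ℤ):ℝ) := by push_cast; ring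
      rw [this, nd_add_int, nd_eq (n := 0)]
      · simp [le_abs_self]
      · rw [abs_le]; push_cast; constructor <;> linarith
    have h3 := hBA.sep_of_sep ht hnd (k+1) (by omega)
    have : L - R = 3^(k+1)*(3*a+3*t) - 3^(k+1)*(3*a+1) + ((mB - mA : ℤ):ℝ) := by
      rw [hL, hR, hmB, hmA]; push_cast; ring
    rw [this, nd_add_int]; exact h3
  have hLA : L ≤ 3*a := by linarith
  have hRB : 3*a+3*t ≤ R := by linarith
  have hRL : R < L + 1 := by linarith
  have heL' : LF a t k (z2 - 1) z1 := by simpa [sub_eq_add_neg] using heL.symm.add 0 (-1) 0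
  have hLy : z2 - 1 ≤ L := by
    by_contra hc
    push Not at hc
    have hRy : R < z1 := by
      by_contra hc2; push Not at hc2; exact hcl ⟨hc.le, hc2⟩
    rcases lt_or_ge z1 (L+1) with h3 | h3
    · exact heL'.not_link_same ht ht6 hLR (Link.symm (Link.of_lt hc (by linarith) hRy h3))
    · have h4 := hsep.trans (nd_le (L - R) (-1))
      have : |L - R - ((-1:ℤ):ℝ)| < 3*t := by
        push_cast; rw [abs_lt]; constructor <;> linarith
      linarith
  have hRy : R ≤ z1 := by
    by_contra hc
    push Not at hc
    have hLy' : z2 - 1 < L := by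
      by_contra hc2; push Not at hc2; exact hcl ⟨hc2, hc.le⟩
    rcases lt_or_ge R (z2-1+1) with h3 | h3
    · exact heL'.not_link_same ht ht6 hLR (Link.of_lt hLy' (by linarith) hc h3)
    · have h4 := hsep.trans (nd_le (L - R) (-1))
      have : |L - R - ((-1:ℤ):ℝ)| < 3*t := by
        push_cast; rw [abs_lt]; constructor <;> linarith
      linarith
  have hex : ∃ n v1 v2, 3*a+3*t ≤ v1 ∧ v1 ≤ z1 ∧ z2 ≤ v2 ∧ v2 ≤ 3*a+1 ∧ (v1 ≠ z1 ∨ v2 ≠ z2) ∧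
      Good a t (3*a+3*t) n v1 v2 := by
    have hpq : 0 < z1 - (3*a+3*t) ∨ 0 < 3*a+1-z2 := by
      by_contra hc
      push Not at hc
      exact hcl ⟨by linarith, by linarith⟩
    rcases hpq with hpq | hpq
    · obtain ⟨n, v1, v2, g1, g2, g3, g4, g5, g6⟩ :=
        exists_good_close ht ht6 H1 (by linarith) (by linarith) hBA hno hpq
      refine ⟨n, v1, v2, g1, by linarith, ?_, g5, Or.inl (by linarith), g6⟩
      by_contra hc
      push Not at hc
      exact (g6.lf ht ht6).not_link ht ht6 heL
        (Link.of_lt (by linarith) (by linarith) hc (by linarith))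
    · obtain ⟨n, v1, v2, g1, g2, g3, g4, g5, g6⟩ :=
        exists_good_close ht ht6 H1 (by linarith) (by linarith) hBA hno hpq
      refine ⟨n, v1, v2, g1, ?_, by linarith, g5, Or.inr (by linarith), g6⟩
      by_contra hc
      push Not at hc
      exact heL.not_link ht ht6 (g6.lf ht ht6)
        (Link.of_lt hc (by linarith) (by linarith) (by linarith))
  obtain ⟨v1, v2, g1, g2, g3, g4, g5, g6⟩ := Nat.find_spec hex
  have hfm := fun n (hn : n < Nat.find hex) => Nat.find_min hex hn
  set n := Nat.find hex with hn
  have hkn : k ≤ n := hmin n v1 v2 g1 (by linarith) (by linarith) g4 (g6.lf ht ht6)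
  have iv := good_mem g6
  rcases hkn.eq_or_lt with hkn | hkn
  · have hnn : n = k := hkn.symm
    clear_value n
    subst hnn
    have l1 := (Psi_le_iff ht ht6 (C := C) (n := n) (fun j hj => (iv j hj.le).1)
      (fun j hj => (iz j hj.le).1)).2 g2
    have l2 := (Psi_le_iff ht ht6 (C := C) (n := n) (fun j hj => (iz j hj.le).2)
      (fun j hj => (iv j hj.le).2)).2 g3
    have l3 := Psi_lt ht ht6 (C := C) (n := n) (fun j hj => (iz j hj.le).1)
      (fun j hj => (iz j hj.le).2) h12
    have l4 := Psi_lt ht ht6 (C := C) (n := n) (fun j hj => (iv j hj.le).2)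
      (fun j hj => (iv j hj.le).1.pow_add_one) (by linarith : v2 < v1 + 1)
    have a1 : Psi a t C n (v1 + 1) = Psi a t C n v1 + 1 := by
      simpa using Psi_add_int (a := a) (t := t) C n v1 1
    rw [a1] at l4
    obtain ⟨n1, hn1⟩ := Psi_cong (a := a) (t := t) C n v1
    obtain ⟨n2, hn2⟩ := Psi_cong (a := a) (t := t) C n v2
    have hE : Edge a t (Psi a t C n v1) (Psi a t C n v2) := by
      have := g6.2.add 0 n1 n2
      rw [hn1, hn2]; simpa using this
    have q1 : v1 = z1 := by
      refine le_antisymm g2 ?_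
      by_contra hc
      push Not at hc
      exact hE.not_between ht ht6 (hC n).1 (Psi_mem (iv n le_rfl).1) (Psi_mem (iz n le_rfl).1)
        l4.le (Psi_lt ht ht6 (fun j hj => (iv j hj.le).1) (fun j hj => (iz j hj.le).1) hc)
        (by linarith)
    have q2 : v2 = z2 := by
      refine le_antisymm ?_ g3
      by_contra hc
      push Not at hc
      exact hE.not_between ht ht6 (hC n).1 (Psi_mem (iv n le_rfl).1) (Psi_mem (iz n le_rfl).2)
        l4.le (by linarith) (Psi_lt ht ht6 (fun j hj => (iz j hj.le).2)
          (fun j hj => (iv j hj.le).2) hc)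
    rcases g5 with g5 | g5
    · exact g5 q1
    · exact g5 q2
  · have c1 : ∀ j < k+1, In a t (C j) (3^j*v1) := fun j hj => (iv j (by omega)).1
    have c2 : ∀ j < k+1, In a t (C j) (3^j*v2) := fun j hj => (iv j (by omega)).2
    have b1 : L ≤ F v1 - θ := by
      have := (Psi_le_iff ht ht6 (fun j _ => iB j) c1).2 g1
      rw [← hF] at this; linarith
    have b2 : F v1 - θ ≤ 3*a := by
      have := (Psi_le_iff ht ht6 c1 iz1).2 g2
      rw [← hF] at this; linarith
    have b3 : 3*a+3*t ≤ F v2 - θ := by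
      have := (Psi_le_iff ht ht6 iz2 c2).2 g3
      rw [← hF] at this; linarith
    have b4 : F v2 - θ ≤ R := by
      have := (Psi_le_iff ht ht6 c2 (fun j _ => iA1 j)).2 g4
      rw [← hF] at this; linarith
    have hLF : LF a t (n - (k+1)) (F v2 - θ) (F v1 - θ + 1) := by
      obtain ⟨n1, hn1⟩ := hFc v1
      obtain ⟨n2, hn2⟩ := hFc v2
      have := ((g6.lf ht ht6).pow (j := k+1) (by omega)).symm.add (-(h+2*m1)) n2 (n1+1)
      rw [hn1, hn2, hθ]
      convert this using 1 <;> push_cast <;> ring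
    obtain ⟨k', hk', w1, w2, f1, f2, f3, f4, f5⟩ := exists_good_above ht ht6 H1 NE b3
      (by linarith) (by linarith) hLF
    refine hfm k' (by omega) ⟨w1, w2, f1, by linarith, by linarith, f4, ?_, f5⟩
    by_contra hc
    push Not at hc
    exact hcl ⟨by linarith, by linarith⟩

end

section
variable {a t : ℝ}

/-- Perturbation to a co-periodic pair, when the minor is approximated from the long side. -/
lemma approx_long (ht : 0 < t) (ht6 : t < 1/6) (H1 : Same a t (3*a) (3*a+3*t))
    (NE : ∀ k, ¬ LF a t k (3*a) (3*a+3*t))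
    (hno : ∀ x, 3*a+3*t < x → x < 3*a+1 → ¬ Same a t (3*a+3*t) x) {ε : ℝ} (hε : 0 < ε) :
    ∃ a' t', |a' - a| < ε ∧ |a' + t' - (a + t)| < ε ∧ 0 < t' ∧ t' < 1/6 ∧
      ∃ k, LF a' t' k (3*a') (3*a'+3*t') := by
  classical
  obtain ⟨δ, hδ, hδε, hδt, hδ6⟩ : ∃ δ : ℝ, 0 < δ ∧ δ ≤ ε ∧ δ ≤ 3*t ∧ δ ≤ 1/6 - t :=
    ⟨min ε (min (3*t) (1/6-t)), lt_min hε (lt_min (by linarith) (by linarith)), min_le_left _ _,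
      (min_le_right _ _).trans (min_le_left _ _), (min_le_right _ _).trans (min_le_right _ _)⟩
  have hBA : Same a t (3*a+3*t) (3*a+1) := by simpa using H1.symm.add 0 0 1
  have hex : ∃ k z1 z2, 3*a+3*t ≤ z1 ∧ z1 < 3*a+3*t+δ ∧ 3*a+1-δ < z2 ∧ z2 ≤ 3*a+1 ∧
      LF a t k z1 z2 := by
    obtain ⟨n, v1, v2, g1, g2, g3, g4, g5, g6⟩ :=
      exists_good_close ht ht6 H1 (by linarith) (by linarith) hBA hno hδ
    exact ⟨n, v1, v2, g1, g2, g4, g5, g6.lf ht ht6⟩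
  have hmin : ∀ k' z1 z2, 3*a+3*t ≤ z1 → z1 < 3*a+3*t+δ → 3*a+1-δ < z2 → z2 ≤ 3*a+1 →
      LF a t k' z1 z2 → Nat.find hex ≤ k' := fun k' z1 z2 h1 h2 h3 h4 h5 =>
    Nat.find_min' hex ⟨z1, z2, h1, h2, h3, h4, h5⟩
  obtain ⟨w1, w2, f1, f2, f3, f4, f5⟩ := Nat.find_spec hex
  set k := Nat.find hex with hk
  obtain ⟨k', hk', z1, z2, h1, h2, h3, h4, h5⟩ :=
    exists_good_above ht ht6 H1 NE f1 (by linarith) f4 f5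
  have hz1 : z1 < 3*a+3*t+δ := by linarith
  have hz2 : 3*a+1-δ < z2 := by linarith
  obtain rfl : k' = k := le_antisymm hk' (hmin k' z1 z2 h1 hz1 hz2 h4 (h5.lf ht ht6))
  clear_value k
  clear hk' h2 h3 f1 f2 f3 f4 f5
  obtain ⟨r1, r2⟩ := ratio_bounds ht ht6 H1 NE hno hδt (by linarith) hmin h1 hz1 hz2 h4 h5
  have heL : LF a t k (z2 - 1) z1 := by
    simpa [sub_eq_add_neg] using (h5.lf ht ht6).symm.add 0 (-1) 0
  obtain ⟨y1, hy1⟩ : ∃ y1, y1 = z2 - 1 := ⟨_, rfl⟩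
  rw [← hy1] at heL
  obtain rfl : z2 = y1 + 1 := by linarith
  clear hy1
  rename' z1 => y2
  have hsepe : 3*t ≤ nd (y1 - y2) := by
    obtain ⟨n, hn⟩ := nd_exists (y1 - y2)
    rw [hn]
    rcases lt_trichotomy n 0 with hn | rfl | hn
    · have : (n:ℝ) ≤ -1 := by exact_mod_cast (by omega : n ≤ -1)
      exact le_trans (by linarith) (le_abs_self _)
    · exact le_trans (by push_cast; linarith) (neg_le_abs _)
    · have : (1:ℝ) ≤ n := by exact_mod_cast hn
      exact le_trans (by linarith) (neg_le_abs _)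
  have av : ∀ j, 1 ≤ j → j ≤ k → ∀ h i : ℤ, ∀ P : ℝ,
      (P = 3^j*y1 + h/2 + i ∨ P = 3^j*y2 + h/2 + i) →
      ¬ (3*a+3*t ≤ P ∧ P < y2) ∧ ¬ (y1 < P ∧ P ≤ 3*a) := by
    intro j hj1 hj h i P hP
    have hsj := heL.sep ht hsepe j hj
    rcases hP with rfl | rfl
    · refine window_avoid ht ht6 H1 hδt (by linarith) hmin (by linarith) (by linarith) h1 hz1 heL
        (n := k - j) (by omega) ((heL.pow hj).add h i i) ?_
      convert hsj using 2; ring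
    · refine window_avoid ht ht6 H1 hδt (by linarith) hmin (by linarith) (by linarith) h1 hz1 heL
        (n := k - j) (by omega) ((heL.symm.pow hj).add h i i) ?_
      rw [← nd_neg]
      convert hsj using 2; ring
  obtain ⟨h, j, e1, e2⟩ := h5.2.image
  have hK1 : (1:ℝ) ≤ 3^k := one_le_pow₀ (by norm_num)
  have hNK : (3:ℝ)^(k+1) = 3 * 3^k := by rw [pow_succ]; ring
  rw [hNK] at r1 r2
  set K : ℝ := 3^k with hK
  have hM : (0:ℝ) < (3*K)^2 - 1 := by nlinarith
  obtain ⟨τ, hτ⟩ : ∃ τ : ℝ, τ * ((3*K)^2-1) = 3*K*(y2 - (3*a+3*t)) - (3*a - y1) :=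
    ⟨_, div_mul_cancel₀ _ hM.ne'⟩
  obtain ⟨σ, hσ⟩ : ∃ σ : ℝ, σ * ((3*K)^2-1) = 3*K*(3*a - y1) - (y2 - (3*a+3*t)) :=
    ⟨_, div_mul_cancel₀ _ hM.ne'⟩
  have hτ0 : 0 ≤ τ := by
    by_contra hc
    push Not at hc
    have := mul_neg_of_neg_of_pos hc hM
    linarith
  have hσ0 : 0 ≤ σ := by
    by_contra hc
    push Not at hc
    have := mul_neg_of_neg_of_pos hc hM
    linarith
  have q1 : τ + 3*K*σ = 3*a - y1 := by
    have : (τ + 3*K*σ - (3*a - y1)) * ((3*K)^2-1) = 0 := by linear_combination hτ + 3*K*hσ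
    rcases mul_eq_zero.1 this with h | h
    · linarith
    · linarith
  have q2 : σ + 3*K*τ = y2 - (3*a+3*t) := by
    have : (σ + 3*K*τ - (y2 - (3*a+3*t))) * ((3*K)^2-1) = 0 := by
      linear_combination hσ + 3*K*hτ
    rcases mul_eq_zero.1 this with h | h
    · linarith
    · linarith
  have u1 : 0 ≤ K*σ := by positivity
  have u2 : 0 ≤ K*τ := by positivity
  refine ⟨a + -(K*σ), t - -(K*σ) - -(K*τ), ?_, ?_, by linarith, by linarith, k, ?_⟩
  · rw [abs_lt]; constructor <;> linarith
  · rw [abs_lt]; constructor <;> linarith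
  have hα : 3 * (a + -(K*σ)) = y1 + τ := by linarith
  have hβ : 3 * (a + -(K*σ)) + 3 * (t - -(K*σ) - -(K*τ)) = y2 - σ := by linarith
  rw [hβ, hα]
  have hedge : Edge (a + -(K*σ)) (t - -(K*σ) - -(K*τ)) (K * (y2 - σ)) (K * (y1 + τ)) := by
    have := (h5.2.widen (d1 := -(K*σ)) (d2 := -(K*τ))).add 0 0 (-3^k)
    rw [← hK] at this
    convert this using 1
    · push_cast; ring
    · push_cast; rw [← hK]; ring
  refine ⟨fun i hi => ?_, Or.inr hedge⟩
  rcases hi.eq_or_lt with rfl | hi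
  · exact (hedge.mem (by linarith) (by linarith)).symm
  obtain ⟨C, hC, c1, c2⟩ := heL.1 i hi.le
  have hiw := Cl.isP_wid (t := t) hC
  obtain ⟨c, hc⟩ := Cl.isP_lo (a := a) (t := t) hC
  have hI1 : (1:ℝ) ≤ 3^i := one_le_pow₀ (by norm_num)
  have hIK : (3:ℝ)^i * 3^(k-i) = K := by rw [← pow_add]; congr 1; omega
  have hJ1 : (1:ℝ) ≤ 3^(k-i) := one_le_pow₀ (by norm_num)
  have hsi : ∀ z : ℝ, (3:ℝ)^(i+1) * z = 3 * (3^i * z) := by intro z; ring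
  set I : ℝ := 3^i with hI
  set J : ℝ := 3^(k-i) with hJ
  have hIτ : 0 ≤ I * τ := by positivity
  have hIσ : 0 ≤ I * σ := by positivity
  have hJcast : ((3^(k-i) : ℤ) : ℝ) = J := by push_cast; rfl
  -- arithmetic of the shifts
  have i1 : I * (y1 + τ) = I*y1 + I*τ := by ring
  have i2 : I * (y2 - σ) = I*y2 + -(I*σ) := by ring
  rw [i1, i2]
  refine ⟨C, hC, ?_, ?_⟩
  · obtain ⟨n, n1, n2⟩ := c1
    refine In.widen (n := n) hC ?_ ?_
    · by_contra hv
      push Not at hv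
      -- position of the image
      refine (av (i+1) (by omega) (by omega) (-c - 3*C.pp*n) 0 _ (Or.inl rfl)).1 ⟨?_, ?_⟩
      · rw [hsi]; push_cast; linarith
      · rw [hsi]; push_cast; linarith
    · by_contra hv
      push Not at hv
      obtain ⟨P, hP⟩ : ∃ P, P = 3^(i+1)*y1 + ((-c - 3*C.pp*n - C.pp : ℤ) : ℝ)/2 + (0:ℤ) := ⟨_, rfl⟩
      have hP' := hP
      rw [hsi] at hP'
      push_cast at hP'
      have hP1 : P ≤ 3*a := by linarith
      have hP2 : y1 + τ - 3*(I*τ) < P := by linarith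
      have hPy : P ≤ y1 := by
        by_contra hcc
        push Not at hcc
        exact (av (i+1) (by omega) (by omega) _ 0 P (Or.inl hP)).2 ⟨hcc, hP1⟩
      -- `3^(k-i) y1` lands next to the minor
      have hd : 0 ≤ J*(y1 - P) ∧ J * (y1 - P) ≤ 3*(K*τ) := by
        constructor
        · exact mul_nonneg (by linarith) (by linarith)
        · have : J * (y1 - P) ≤ J * (3*(I*τ)) := mul_le_mul_of_nonneg_left (by linarith) (by linarith)
          have e : J * (3*(I*τ)) = 3*(K*τ) := by rw [← hIK]; ring
          linarith
      have hd2 : J * (y1 - P) < 3*(K*τ) + σ := by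
        have : J * (y1 - P) < J * (3*(I*τ)) :=
          mul_lt_mul_of_pos_left (by linarith) (by linarith)
        have e : J * (3*(I*τ)) = 3*(K*τ) := by rw [← hIK]; ring
        linarith
      refine (av (k-i) (by omega) (by omega)
        (-h - 3^(k-i)*(-c - 3*C.pp*n - C.pp)) (3^(k+1) - j) _ (Or.inl rfl)).1 (?_ : _ ∧ _)
      have key : J * y1 + ((-h - 3^(k-i)*(-c - 3*C.pp*n - C.pp) : ℤ):ℝ)/2 + ((3^(k+1) - j : ℤ):ℝ)
          = 3*a+3*t + J * (y1 - P) := by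
        rw [hP]
        have e3 : (3:ℝ)^(i+1) * y1 * J = 3*(K*y1) := by rw [← hIK]; ring
        push_cast
        rw [← hJ, hNK]
        linear_combination e2 + e3
      rw [key]
      constructor <;> linarith
  · obtain ⟨n, n1, n2⟩ := c2
    refine In.widen (n := n) hC ?_ ?_
    · by_contra hv
      push Not at hv
      obtain ⟨P, hP⟩ : ∃ P, P = 3^(i+1)*y2 + ((-c - 3*C.pp*n : ℤ) : ℝ)/2 + (0:ℤ) := ⟨_, rfl⟩
      have hP' := hP
      rw [hsi] at hP'
      push_cast at hP'
      have hP1 : 3*a+3*t ≤ P := by linarith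
      have hP2 : P < y2 - σ + 3*(I*σ) := by linarith
      have hPy : y2 ≤ P := by
        by_contra hcc
        push Not at hcc
        exact (av (i+1) (by omega) (by omega) _ 0 P (Or.inr hP)).1 ⟨hP1, hcc⟩
      have hd0 : 0 ≤ J*(P - y2) := mul_nonneg (by linarith) (by linarith)
      have hd2 : J * (P - y2) < 3*(K*σ) := by
        have : J * (P - y2) < J * (3*(I*σ)) :=
          mul_lt_mul_of_pos_left (by linarith) (by linarith)
        have e : J * (3*(I*σ)) = 3*(K*σ) := by rw [← hIK]; ring
        linarith
      refine (av (k-i) (by omega) (by omega)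
        (-h - 3^(k-i)*(-c - 3*C.pp*n)) 0 _ (Or.inr rfl)).2 (?_ : _ ∧ _)
      have key : J * y2 + ((-h - 3^(k-i)*(-c - 3*C.pp*n) : ℤ):ℝ)/2 + ((0 : ℤ):ℝ)
          = 3*a - J * (P - y2) := by
        rw [hP]
        have e3 : (3:ℝ)^(i+1) * y2 * J = 3*(K*y2) := by rw [← hIK]; ring
        push_cast
        rw [← hJ]
        linear_combination e1 + e3
      rw [key]
      constructor <;> linarith
    · by_contra hv
      push Not at hv
      refine (av (i+1) (by omega) (by omega) (-c - 3*C.pp*n - C.pp) 0 _ (Or.inr rfl)).2 ⟨?_, ?_⟩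
      · rw [hsi]; push_cast; linarith
      · rw [hsi]; push_cast; linarith

end

section
variable {a t : ℝ}

/-- The index of the box of size `1/M` containing the fractional part. -/
def box (M : ℕ) (x : ℝ) : ℕ := ⌊M * Int.fract x⌋₊

lemma box_lt {M : ℕ} (hM : 0 < M) (x : ℝ) : box M x < M := by
  have hM' : (0:ℝ) < M := by exact_mod_cast hM
  refine (Nat.floor_lt (mul_nonneg hM'.le (Int.fract_nonneg x))).2 ?_
  nlinarith [Int.fract_lt_one x]

lemma nd_lt_of_box {M : ℕ} (hM : 0 < M) {x y : ℝ} (h : box M x = box M y) :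
    nd (x - y) < 1 / M := by
  have hM' : (0:ℝ) < M := by exact_mod_cast hM
  have e1 := Nat.floor_le (mul_nonneg hM'.le (Int.fract_nonneg x))
  have e2 := Nat.floor_le (mul_nonneg hM'.le (Int.fract_nonneg y))
  have e3 := Nat.lt_floor_add_one (M * Int.fract x)
  have e4 := Nat.lt_floor_add_one (M * Int.fract y)
  unfold box at h
  rw [h] at e1 e3
  refine (nd_le (x - y) (⌊x⌋ - ⌊y⌋)).trans_lt ?_
  have e : x - y - ((⌊x⌋ - ⌊y⌋ : ℤ):ℝ) = Int.fract x - Int.fract y := by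
    rw [Int.fract, Int.fract]; push_cast; ring
  rw [e, abs_lt]
  constructor
  · rw [neg_lt, div_eq_mul_inv, one_mul, ← one_div, lt_div_iff₀ hM']; linarith
  · rw [lt_div_iff₀ hM']; linarith

lemma exists_box_size {δ : ℝ} (hδ : 0 < δ) : ∃ M : ℕ, 0 < M ∧ 1 / (M:ℝ) < δ := by
  obtain ⟨n, hn⟩ := exists_nat_one_div_lt hδ
  exact ⟨n + 1, n.succ_pos, by exact_mod_cast hn⟩

lemma exists_close_times {ι : Type*} [Finite ι] (f : ℕ → ι → ℝ) {δ : ℝ} (hδ : 0 < δ) :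
    ∃ i j, i < j ∧ ∀ c, nd (f i c - f j c) < δ := by
  obtain ⟨M, hM, hMδ⟩ := exists_box_size hδ
  obtain ⟨i, j, hij, h⟩ := Finite.exists_ne_map_eq_of_infinite
    (fun n (c : ι) => (⟨box M (f n c), box_lt hM _⟩ : Fin M))
  have key : ∀ c, box M (f i c) = box M (f j c) := fun c => by
    have := congrFun h c
    simpa using this
  rcases hij.lt_or_gt with h' | h'
  · exact ⟨i, j, h', fun c => (nd_lt_of_box hM (key c)).trans hMδ⟩
  · exact ⟨j, i, h', fun c => (nd_lt_of_box hM (key c).symm).trans hMδ⟩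

lemma Same.exists_repeat (ht : 0 < t) {f : ℕ → ℝ} (h : ∀ i j, Same a t (f i) (f j)) :
    ∃ i j, i < j ∧ ∃ m : ℤ, f i - f j = m := by
  by_contra hc
  push Not at hc
  obtain ⟨M, hM, hMδ⟩ := exists_box_size (by linarith : 0 < 3*t)
  have hT : ∀ i j, i < j → ∃ n, ∀ k, n ≤ k → 3 * t ≤ nd (3^k*f i - 3^k*f j) := fun i j hij =>
    (h i j).eventually_sep ht (fun h0 => by
      obtain ⟨m, hm⟩ := nd_eq_zero h0
      exact hc i j hij m hm)
  choose! T hT using hT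
  set N := (Finset.range (M+1) ×ˢ Finset.range (M+1)).sup (fun p => T p.1 p.2)
  obtain ⟨i, j, hij, he⟩ := Fintype.exists_ne_map_eq_of_card_lt
    (fun c : Fin (M+1) => (⟨box M (3^N * f c), box_lt hM _⟩ : Fin M)) (by simp)
  have key : ∀ i j : Fin (M+1), i < j → box M (3^N*f i) = box M (3^N*f j) → False := by
    intro i j hij he
    have h1 := hT i j hij N (Finset.le_sup (f := fun p : ℕ × ℕ => T p.1 p.2)
      (b := ((i:ℕ), (j:ℕ))) (by simp [i.2, j.2]))
    have h2 := nd_lt_of_box hM he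
    linarith
  have he' : box M (3^N*f i) = box M (3^N*f j) := by simpa using he
  rcases hij.lt_or_gt with h' | h'
  · exact key i j h' he'
  · exact key j i h' he'.symm

lemma Link.perturb {x y u v u' v' δ : ℝ} (h : Link x y u v) (h1 : δ ≤ nd (x - u))
    (h2 : δ ≤ nd (u - y)) (h3 : δ ≤ nd (y - v)) (h4 : δ ≤ nd (v - x)) (hu : nd (u - u') < δ)
    (hv : nd (v - v') < δ) : Link x y u' v' := by
  have key : ∀ {u v u' v' : ℝ}, δ ≤ nd (x - u) → δ ≤ nd (u - y) → δ ≤ nd (y - v) → δ ≤ nd (v - x) →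
      nd (u - u') < δ → nd (v - v') < δ → (∃ i j k : ℤ, x < u + i ∧ u + i < y + j ∧ y + j < v + k ∧
        v + k < x + 1) → Link x y u' v' := by
    intro u v u' v' h1 h2 h3 h4 hu hv ⟨i, j, k, g1, g2, g3, g4⟩
    obtain ⟨m, hm⟩ := nd_exists (u - u')
    obtain ⟨n, hn⟩ := nd_exists (v - v')
    rw [hm, abs_lt] at hu
    rw [hn, abs_lt] at hv
    have b1 := h1.trans (nd_le _ i)
    have b2 := h2.trans (nd_le _ (j - i))
    have b3 := h3.trans (nd_le _ (k - j))
    have b4 := h4.trans (nd_le _ (1 - k))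
    push_cast at b1 b2 b3 b4
    rw [abs_of_neg (by linarith)] at b1 b2 b3 b4
    refine ⟨m + i, j, n + k, Or.inl ?_⟩
    push_cast
    refine ⟨?_, ?_, ?_, ?_⟩ <;> linarith
  obtain ⟨i, j, k, h | h⟩ := h
  · exact key h1 h2 h3 h4 hu hv ⟨i, j, k, h⟩
  · have e : ∀ p q, nd (p - q) = nd (q - p) := fun p q => by rw [← nd_neg]; congr 1; ring
    rw [e] at h1 h2 h3 h4
    exact (key h4 h3 h2 h1 hv hu ⟨k, j, i, h⟩).swap_right

/-- `3^N z` is periodic of period `P`. -/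
def Per (N P : ℕ) (z : ℝ) : Prop := ∃ m : ℤ, 3^(N+P)*z = 3^N*z + m

lemma Per.mono {N N' P : ℕ} {z : ℝ} (h : Per N P z) (hN : N ≤ N') : Per N' P z := by
  obtain ⟨m, hm⟩ := h
  obtain ⟨d, rfl⟩ := Nat.exists_eq_add_of_le hN
  refine ⟨3^d*m, ?_⟩
  have e : (3:ℝ)^(N+d+P)*z = 3^d*(3^(N+P)*z) := by ring
  rw [e, hm]; push_cast; ring

lemma Per.mul {N P : ℕ} {z : ℝ} (h : Per N P z) (c : ℕ) : Per N (P*c) z := by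
  induction c with
  | zero => exact ⟨0, by simp⟩
  | succ c ih =>
    obtain ⟨m, hm⟩ := ih
    obtain ⟨m', hm'⟩ := h.mono (Nat.le_add_right N (P*c))
    refine ⟨m + m', ?_⟩
    have : N + P*(c+1) = N + P*c + P := by ring
    rw [this, hm', hm]; push_cast; ring

lemma Same.exists_per (ht : 0 < t) (ht6 : t < 1/6) {z : ℝ} {n d : ℕ} (hd : 0 < d)
    (h : Same a t (3^n*z) (3^(n+d)*z)) : ∃ N P, 0 < P ∧ Per N P z := by
  have h0 : ∀ i, Same a t (3^n*z) (3^(n+i*d)*z) := by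
    intro i
    induction i with
    | zero => simpa using h.trans ht ht6 h.symm
    | succ i ih =>
      refine ih.trans ht ht6 ?_
      convert h.pow (i*d) using 1 <;> ring
  obtain ⟨i, j, hij, m, hm⟩ := Same.exists_repeat ht (f := fun i => 3^(n+i*d)*z)
    (fun i j => (h0 i).symm.trans ht ht6 (h0 j))
  obtain ⟨l, rfl⟩ := Nat.exists_eq_add_of_lt hij
  refine ⟨n + i*d, (l+1)*d, by positivity, -m, ?_⟩
  have : n + i*d + (l+1)*d = n + (i+l+1)*d := by ring
  rw [this]; push_cast; linarith

lemma Same.exists_per_of_link (ht : 0 < t) (ht6 : t < 1/6) {u x w y : ℝ} (hx : Same a t u x)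
    (hw : Same a t u w) (hy : Same a t u y) (hL : Link u w x y) :
    ∃ N P, 0 < P ∧ Per N P u ∧ Per N P w ∧ Per N P x ∧ Per N P y := by
  have hne : ∀ {p q r s : ℝ}, Link p q r s → nd (p - r) ≠ 0 := by
    intro p q r s ⟨i, j, k, h⟩ h0
    obtain ⟨m, hm⟩ := nd_eq_zero h0
    rcases h with ⟨h1, h2, h3, h4⟩ | ⟨h1, h2, h3, h4⟩
    · have e1 : (0:ℝ) < ((i - m : ℤ):ℝ) := by push_cast; linarith
      have e2 : ((i - m : ℤ):ℝ) < 1 := by push_cast; linarith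
      have e1' : 0 < i - m := by exact_mod_cast e1
      have e2' : i - m < 1 := by exact_mod_cast e2
      omega
    · have e1 : (0:ℝ) < ((i - m : ℤ):ℝ) := by push_cast; linarith
      have e2 : ((i - m : ℤ):ℝ) < 1 := by push_cast; linarith
      have e1' : 0 < i - m := by exact_mod_cast e1
      have e2' : i - m < 1 := by exact_mod_cast e2
      omega
  have hxw := hx.symm.trans ht ht6 hw
  have hwy := hw.symm.trans ht ht6 hy
  obtain ⟨n1, g1⟩ := hx.eventually_sep ht (hne hL)
  obtain ⟨n2, g2⟩ := hxw.eventually_sep ht (hne hL.symm.swap_right)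
  obtain ⟨n3, g3⟩ := hwy.eventually_sep ht (hne hL.swap_left.swap_right)
  obtain ⟨n4, g4⟩ := hy.symm.eventually_sep ht (hne hL.swap_right.symm)
  set M := n1 + n2 + n3 + n4
  obtain ⟨i, j, hij, hc⟩ := exists_close_times
    (fun n (c : Bool) => if c then 3^(M+n)*x else 3^(M+n)*y) (by linarith : 0 < 3*t)
  have c1 := hc true
  have c2 := hc false
  simp only [if_true, Bool.false_eq_true, if_false] at c1 c2
  have hLi := push_iter ht ht6 (M+i) (fun j _ => (hw j).cell)
    (fun j _ => (hx.symm.trans ht ht6 hy j).cell) hL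
  have hLij := hLi.perturb (g1 _ (by omega)) (g2 _ (by omega)) (g3 _ (by omega)) (g4 _ (by omega))
    c1 c2
  have hs := (hw.pow (M+i)).of_link ht ht6 ((hx.symm.trans ht ht6 hy).pow (M+j)) hLij
  have huu := hs.trans ht ht6 (hx.symm.pow (M+j))
  obtain ⟨l, rfl⟩ := Nat.exists_eq_add_of_lt hij
  have key : ∀ z, Same a t u z → ∃ N P, 0 < P ∧ Per N P z := by
    intro z hz
    refine Same.exists_per (a := a) (n := M+i) (d := l+1) ht ht6 (by omega) ?_
    rw [show M + i + (l+1) = M + (i+l+1) by ring]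
    exact (hz.symm.pow _).trans ht ht6 (huu.trans ht ht6 (hz.pow _))
  obtain ⟨N1, P1, p1, q1⟩ := key u (hx.trans ht ht6 hx.symm)
  obtain ⟨N2, P2, p2, q2⟩ := key w hw
  obtain ⟨N3, P3, p3, q3⟩ := key x hx
  obtain ⟨N4, P4, p4, q4⟩ := key y hy
  refine ⟨N1+N2+N3+N4, P1*P2*P3*P4, by positivity, ?_, ?_, ?_, ?_⟩
  · convert (q1.mono (by omega : N1 ≤ N1+N2+N3+N4)).mul (P2*P3*P4) using 1; ring
  · convert (q2.mono (by omega : N2 ≤ N1+N2+N3+N4)).mul (P1*P3*P4) using 1; ring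
  · convert (q3.mono (by omega : N3 ≤ N1+N2+N3+N4)).mul (P1*P2*P4) using 1; ring
  · convert (q4.mono (by omega : N4 ≤ N1+N2+N3+N4)).mul (P1*P2*P3) using 1; ring

end

section
variable {a t : ℝ}

variable (a t) in
/-- Points of period `P` in the class of `u`. -/
def Cls (P : ℕ) (u : ℝ) : Set ℝ := {z | Same a t u z ∧ Per 0 P z}

lemma Cls.add_int {P : ℕ} {u z : ℝ} (h : z ∈ Cls a t P u) (n : ℤ) : z + n ∈ Cls a t P u := by
  obtain ⟨h1, m, hm⟩ := h
  refine ⟨by simpa using h1.add 0 0 n, m + (3^P-1)*n, ?_⟩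
  rw [zero_add, pow_zero, one_mul] at hm ⊢
  rw [mul_add, hm]; push_cast; ring

lemma Cls.same (ht : 0 < t) (ht6 : t < 1/6) {P : ℕ} {u z z' : ℝ} (h : z ∈ Cls a t P u)
    (h' : z' ∈ Cls a t P u) : Same a t z z' := h.1.symm.trans ht ht6 h'.1

lemma Cls.finite {P : ℕ} (hP : 0 < P) (u x y : ℝ) : (Cls a t P u ∩ Icc x y).Finite := by
  have h3 : (1:ℝ) < 3^P := one_lt_pow₀ (by norm_num) hP.ne'
  have h3' : (0:ℝ) < 3^P - 1 := by linarith
  refine ((Set.finite_Icc ⌈x * (3^P-1)⌉ ⌊y * (3^P-1)⌋).image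
    (fun m : ℤ => (m:ℝ) / (3^P-1))).subset ?_
  rintro z ⟨⟨-, m, hm⟩, h1, h2⟩
  rw [zero_add, pow_zero, one_mul] at hm
  have e : (m:ℝ) = z * (3^P-1) := by linarith
  refine ⟨m, ⟨Int.ceil_le.2 ?_, Int.le_floor.2 ?_⟩, ?_⟩
  · rw [e]; gcongr
  · rw [e]; gcongr
  · simp only; rw [e]; field_simp

variable (a t) in
/-- A lift of an iterate of tripling, up to a half-integer, monotone on a class. -/
structure Move (P : ℕ) (u : ℝ) (l : ℕ) (F : ℝ → ℝ) : Prop where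
  cong : ∃ k : ℤ, ∀ z, ∃ j : ℤ, F z = 3^l*z + k/2 + j
  mono : ∀ z ∈ Cls a t P u, ∀ z' ∈ Cls a t P u, z < z' → F z < F z'
  add : ∀ z, ∀ n : ℤ, F (z + n) = F z + n

lemma exists_move (ht : 0 < t) (ht6 : t < 1/6) (P : ℕ) {u : ℝ} (hu : Same a t u u) (l : ℕ)
    (k i : ℤ) (e : ℝ) : ∃ F, Move a t P u l F ∧ F e = 3^l*e + k/2 + i := by
  obtain ⟨C, hC⟩ := hu.exists_itinerary
  have hmem : ∀ z ∈ Cls a t P u, ∀ j, In a t (C j) (3^j*z) := fun z hz j =>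
    (hz.1 j).in_of_in ht ht6 (hC j).1 (hC j).2.1
  obtain ⟨m, hm⟩ := Psi_cong (a := a) (t := t) C l e
  refine ⟨fun z => Psi a t C l z + (k/2 + i - m), ⟨⟨k, fun z => ?_⟩, fun z hz z' hz' h => ?_,
    fun z n => ?_⟩, ?_⟩
  · obtain ⟨m', hm'⟩ := Psi_cong (a := a) (t := t) C l z
    refine ⟨m' + i - m, ?_⟩
    rw [hm']; push_cast; ring
  · have := Psi_lt ht ht6 (n := l) (fun j _ => hmem z hz j) (fun j _ => hmem z' hz' j) h
    linarith
  · simp only [Psi_add_int]; ring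
  · simp only [hm]; ring

namespace Move
variable {P l : ℕ} {u : ℝ} {F : ℝ → ℝ}

lemma lt_iff (h : Move a t P u l F) {z z' : ℝ} (hz : z ∈ Cls a t P u) (hz' : z' ∈ Cls a t P u) :
    F z < F z' ↔ z < z' := by
  refine ⟨fun hl => ?_, h.mono z hz z' hz'⟩
  by_contra hc
  rcases (not_lt.1 hc).lt_or_eq with h' | h'
  · exact absurd (h.mono z' hz' z hz h') (not_lt.2 hl.le)
  · rw [h'] at hl; exact lt_irrefl _ hl

lemma nd_eq (h : Move a t P u l F) (z z' : ℝ) : nd (F z - F z') = nd (3^l*z - 3^l*z') := by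
  obtain ⟨k, hk⟩ := h.cong
  obtain ⟨j, hj⟩ := hk z
  obtain ⟨j', hj'⟩ := hk z'
  rw [hj, hj', ← nd_add_int (3^l*z - 3^l*z') (j - j')]
  congr 1; push_cast; ring

lemma same (h : Move a t P u l F) {z z' : ℝ} (hz : Same a t z z') : Same a t (F z) (F z') := by
  obtain ⟨k, hk⟩ := h.cong
  obtain ⟨j, hj⟩ := hk z
  obtain ⟨j', hj'⟩ := hk z'
  rw [hj, hj']
  exact (hz.pow l).add k j j'

lemma per (h : Move a t P u l F) {z : ℝ} (hz : Per 0 P z) : Per 0 P (F z) := by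
  obtain ⟨k, hk⟩ := h.cong
  obtain ⟨j, hj⟩ := hk z
  obtain ⟨m, hm⟩ := hz
  have hodd : ∃ c : ℤ, (3:ℤ)^P = 2*c+1 := by
    have : Odd ((3:ℤ)^P) := Odd.pow (by decide)
    exact this
  obtain ⟨c, hc⟩ := hodd
  have hc' : (3:ℝ)^P = 2*c+1 := by exact_mod_cast hc
  refine ⟨3^l*m + c*k + 2*c*j, ?_⟩
  rw [hj]
  rw [zero_add, pow_zero, one_mul] at hm ⊢
  have : (3:ℝ)^P * (3^l*z + k/2+j) = 3^l*(3^P*z) + 3^P*(k/2+j) := by ring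
  rw [this, hm, hc']; push_cast; ring

lemma surj (ht : 0 < t) (ht6 : t < 1/6) (h : Move a t P u l F) (hP : 0 < P) {e y : ℝ}
    (he : e ∈ Cls a t P u) (hy : Same a t (F e) y) (hyp : Per 0 P y) :
    ∃ z ∈ Cls a t P u, F z = y := by
  obtain ⟨k, hk⟩ := h.cong
  obtain ⟨j, hj⟩ := hk e
  obtain ⟨d, hd⟩ : ∃ d, d + l = P * l := ⟨P*l - l, by
    have : l ≤ P*l := Nat.le_mul_of_pos_left l hP
    omega⟩
  -- the inverse branch
  have hodd : ∃ c : ℤ, (3:ℤ)^P = 2*c+1 := by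
    have : Odd ((3:ℤ)^P) := Odd.pow (by decide)
    exact this
  obtain ⟨c, hc⟩ := hodd
  have hc' : (3:ℝ)^P = 2*c+1 := by exact_mod_cast hc
  have hy' : Per 0 P (y - k/2) := by
    obtain ⟨m, hm⟩ := hyp
    refine ⟨m - c*k, ?_⟩
    rw [zero_add, pow_zero, one_mul] at hm ⊢
    rw [mul_sub, hm, hc']; push_cast; ring
  have hs : Same a t (3^l*e) (y - k/2) := by
    have := hy.add (-k) (-j) 0
    rw [hj] at this
    convert this using 1 <;> push_cast <;> ring
  have hs2 := hs.pow d
  obtain ⟨m1, hm1⟩ := he.2.mul l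
  obtain ⟨m2, hm2⟩ := hy'.mul l
  rw [zero_add, pow_zero, one_mul] at hm1 hm2
  have e1 : (3:ℝ)^d*(3^l*e) = 3^(P*l)*e := by rw [← hd]; ring
  rw [e1, hm1] at hs2
  have hz0 : 3^d*(y-k/2) ∈ Cls a t P u := by
    refine ⟨he.1.trans ht ht6 ?_, ?_⟩
    · simpa using hs2.add 0 (-m1) 0
    · obtain ⟨m, hm⟩ := hy'
      refine ⟨3^d*m, ?_⟩
      rw [zero_add, pow_zero, one_mul] at hm ⊢
      rw [mul_left_comm, hm]; push_cast; ring
  obtain ⟨i, hi⟩ := hk (3^d*(y-k/2))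
  have e2 : (3:ℝ)^l*(3^d*(y-k/2)) = 3^(P*l)*(y-k/2) := by rw [← hd]; ring
  rw [e2, hm2] at hi
  refine ⟨_, Cls.add_int hz0 (-(m2+i)), ?_⟩
  rw [h.add, hi]; push_cast; ring

end Move

lemma exists_min_move (ht : 0 < t) (ht6 : t < 1/6) {P : ℕ} (hP : 0 < P) {u e e' : ℝ}
    (he : e ∈ Cls a t P u) (he' : e' ∈ Cls a t P u) (h1 : e < e') (h2 : e' < e + 1) :
    ∃ l F, Move a t P u l F ∧ (∀ m, nd (F e - F e') ≤ nd (3^m*e - 3^m*e')) ∧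
      ((F e ≤ 3*a ∧ 3*a+3*t ≤ F e' ∧ F e' - F e ≤ 1/2) ∨ 1/2 ≤ F e' - F e) := by
  have hs := Cls.same ht ht6 he he'
  have hne : nd (e - e') ≠ 0 := by
    intro h0
    obtain ⟨m, hm⟩ := nd_eq_zero h0
    have e1 : (-1:ℝ) < m := by linarith
    have e2 : (m:ℝ) < 0 := by linarith
    have e1' : -1 < m := by exact_mod_cast e1
    have e2' : m < 0 := by exact_mod_cast e2
    omega
  have hper : ∀ m c, nd (3^(m+P*c)*e - 3^(m+P*c)*e') = nd (3^m*e - 3^m*e') := by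
    intro m c
    obtain ⟨m1, hm1⟩ := (he.2.mul c).mono (Nat.zero_le m)
    obtain ⟨m2, hm2⟩ := (he'.2.mul c).mono (Nat.zero_le m)
    rw [hm1, hm2, ← nd_add_int (3^m*e - 3^m*e') (m1 - m2)]
    congr 1; push_cast; ring
  have hpos : ∀ m, 0 < nd (3^m*e - 3^m*e') := by
    intro m
    obtain ⟨n, hn⟩ := hs.eventually_sep ht hne
    have := hn (m + P*n) (by nlinarith)
    rw [hper] at this
    linarith
  obtain ⟨i, hi, himin⟩ := Finset.exists_min_image (Finset.range P)
    (fun m => nd (3^m*e - 3^m*e')) ⟨0, by simpa using hP⟩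
  have hmin : ∀ m, nd (3^i*e - 3^i*e') ≤ nd (3^m*e - 3^m*e') := by
    intro m
    have := himin (m % P) (by simpa using Nat.mod_lt m hP)
    rwa [← hper (m % P) (m / P), Nat.mod_add_div] at this
  obtain ⟨l, hl⟩ : ∃ l, l + 1 = i + P*1 := ⟨i + P - 1, by omega⟩
  have e3 : ∀ z : ℝ, (3:ℝ)^(l+1)*z = 3*(3^l*z) := by intro z; ring
  have hmin' : ∀ m, nd (3^(l+1)*e - 3^(l+1)*e') ≤ nd (3^m*e - 3^m*e') := by
    intro m; rw [hl, hper]; exact hmin m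
  have hd : 1/6 < nd (3^l*e - 3^l*e') := by
    by_contra hc
    push Not at hc
    have h3 := nd_three hc
    have h4 := hmin' l
    have h5 := hpos l
    rw [e3, e3, ← mul_sub, h3] at h4
    linarith
  have hu := he.1.trans ht ht6 he.1.symm
  obtain ⟨k, n, n', h | h⟩ := (hs l).drop ht hd
  · rw [← e3, ← e3] at h
    obtain ⟨F, hF, hFe⟩ := exists_move ht ht6 P hu (l+1) k n e
    refine ⟨l+1, F, hF, fun m => by rw [hF.nd_eq]; exact hmin' m, Or.inl ?_⟩
    have hm1 := hF.mono _ he _ he' h1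
    have hm2 := hF.mono _ he' _ (Cls.add_int he 1) (by push_cast; exact h2)
    rw [hF.add] at hm2
    obtain ⟨k', hk'⟩ := hF.cong
    have hsame : F e' = 3^(l+1)*e' + k/2 + n' := by
      obtain ⟨j1, hj1⟩ := hk' e
      obtain ⟨j2, hj2⟩ := hk' e'
      push_cast at hm2
      have b1 : (-1:ℝ) < ((n + j2 - j1 - n' : ℤ):ℝ) := by push_cast; linarith
      have b2 : ((n + j2 - j1 - n' : ℤ):ℝ) < 1 := by push_cast; linarith
      have b1' : -1 < n + j2 - j1 - n' := by exact_mod_cast b1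
      have b2' : n + j2 - j1 - n' < 1 := by exact_mod_cast b2
      have : (n:ℝ) + j2 - j1 - n' = 0 := by exact_mod_cast (by omega : n + j2 - j1 - n' = 0)
      linarith
    rw [hFe, hsame]; exact h
  · rw [← e3, ← e3] at h
    obtain ⟨F, hF, hFe⟩ := exists_move ht ht6 P hu (l+1) k n e
    refine ⟨l+1, F, hF, fun m => by rw [hF.nd_eq]; exact hmin' m, Or.inr ?_⟩
    have hm1 := hF.mono _ he _ he' h1
    have hm2 := hF.mono _ he' _ (Cls.add_int he 1) (by push_cast; exact h2)
    rw [hF.add] at hm2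
    obtain ⟨k', hk'⟩ := hF.cong
    have hsame : F e' = 3^(l+1)*e' + k/2 + n' + 1 := by
      obtain ⟨j1, hj1⟩ := hk' e
      obtain ⟨j2, hj2⟩ := hk' e'
      push_cast at hm2
      have b1 : (-1:ℝ) < ((n + j2 - j1 - n' - 1 : ℤ):ℝ) := by push_cast; linarith
      have b2 : ((n + j2 - j1 - n' - 1 : ℤ):ℝ) < 1 := by push_cast; linarith
      have b1' : -1 < n + j2 - j1 - n' - 1 := by exact_mod_cast b1
      have b2' : n + j2 - j1 - n' - 1 < 1 := by exact_mod_cast b2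
      have : (n:ℝ) + j2 - j1 - n' - 1 = 0 := by
        exact_mod_cast (by omega : n + j2 - j1 - n' - 1 = 0)
      linarith
    rw [hFe, hsame]; linarith

end

section
variable {a t : ℝ}

lemma not_two_outer {P l l' : ℕ} {u : ℝ} {F G : ℝ → ℝ} (hF : Move a t P u l F)
    (hG : Move a t P u l' G) {e e' f f' : ℝ} (he : e ∈ Cls a t P u) (he' : e' ∈ Cls a t P u)
    (hf : f ∈ Cls a t P u) (hf' : f' ∈ Cls a t P u) (h1 : e < e') (h2 : e' ≤ f) (h3 : f < f')
    (h4 : f' ≤ e + 1) (hne : e' < f ∨ f' < e + 1)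
    (mF : ∀ m, nd (F e - F e') ≤ nd (3^m*e - 3^m*e'))
    (mG : ∀ m, nd (G f - G f') ≤ nd (3^m*f - 3^m*f'))
    (oF : 1/2 ≤ F e' - F e) (oG : 1/2 ≤ G f' - G f) : False := by
  have key : ∀ {l : ℕ} {F : ℝ → ℝ}, Move a t P u l F → 0 < F e' - F e ∧ 0 < F f' - F f ∧
      F f' - F f < 1 - (F e' - F e) := by
    intro l F hF
    have g1 := hF.mono _ he _ he' h1
    have g3 := hF.mono _ hf _ hf' h3
    have a1 : F (e + 1) = F e + 1 := by simpa using hF.add e 1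
    have hc := Cls.add_int he 1
    simp only [Int.cast_one] at hc
    have w2 : F e' ≤ F f := by
      rcases h2.lt_or_eq with h | h
      · exact (hF.mono _ he' _ hf h).le
      · rw [h]
    have w4 : F f' ≤ F e + 1 := by
      rcases h4.lt_or_eq with h | h
      · rw [← a1]; exact (hF.mono _ hf' _ hc h).le
      · rw [h, a1]
    refine ⟨by linarith, by linarith, ?_⟩
    rcases hne with h | h
    · have := hF.mono _ he' _ hf h; linarith
    · have := hF.mono _ hf' _ hc h; linarith
  obtain ⟨f1, f2, f3⟩ := key hF
  obtain ⟨g1, g2, g3⟩ := key hG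
  have n1 := mF l'
  have n2 := mG l
  rw [← hG.nd_eq] at n1
  rw [← hF.nd_eq] at n2
  have v1 : nd (F e - F e') = 1 - (F e' - F e) := by
    rw [nd_eq (n := -1)] <;> push_cast
    · rw [abs_of_nonneg] <;> linarith
    · rw [abs_le]; constructor <;> linarith
  have v2 : nd (G f - G f') = 1 - (G f' - G f) := by
    rw [nd_eq (n := -1)] <;> push_cast
    · rw [abs_of_nonneg] <;> linarith
    · rw [abs_le]; constructor <;> linarith
  have v3 : nd (F f - F f') ≤ F f' - F f :=
    (nd_le_abs _).trans (by rw [abs_sub_comm, abs_of_pos]; exact f2)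
  have v4 : nd (G e - G e') ≤ G e' - G e :=
    (nd_le_abs _).trans (by rw [abs_sub_comm, abs_of_pos]; exact g1)
  linarith

lemma same_of_holes_aux (ht : 0 < t) (ht6 : t < 1/6) {P l l' : ℕ} {u : ℝ} {F G : ℝ → ℝ}
    (hF : Move a t P u l F)
    (hG : Move a t P u l' G) {e e' f f' : ℝ} (he : e ∈ Cls a t P u) (he' : e' ∈ Cls a t P u)
    (hf : f ∈ Cls a t P u) (hf' : f' ∈ Cls a t P u)
    (mG : ∀ m, nd (G f - G f') ≤ nd (3^m*f - 3^m*f'))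
    (oF : F e ≤ 3*a ∧ 3*a+3*t ≤ F e' ∧ F e' - F e ≤ 1/2)
    (oG : G f ≤ 3*a ∧ 3*a+3*t ≤ G f' ∧ G f' - G f ≤ 1/2)
    (hle : F e' - F e ≤ G f' - G f) : Same a t (F e) (G f) := by
  obtain ⟨f1, f2, f3⟩ := oF
  obtain ⟨g1, g2, g3⟩ := oG
  by_contra hns
  have sF : ∀ z ∈ Cls a t P u, Same a t (F e) (F z) := fun z hz => hF.same (Cls.same ht ht6 he hz)
  have sG := hG.same (Cls.same ht ht6 hf hf')
  have heq : ∀ z ∈ Cls a t P u, ∀ i : ℤ, F z + i = G f ∨ F z + i = G f' → False := by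
    rintro z hz i (h | h)
    · apply hns
      rw [← h]; simpa using (sF z hz).add 0 0 i
    · apply hns
      have h2 : Same a t (F e) (G f') := by rw [← h]; simpa using (sF z hz).add 0 0 i
      exact h2.trans ht ht6 sG.symm
  have hlt : G f < F e := by
    rcases lt_trichotomy (F e) (G f) with h | h | h
    · exact (hns ((sF e' he').of_link ht ht6 sG
        (Link.of_lt h (by linarith) (by linarith) (by linarith)))).elim
    · exact (heq e he 0 (Or.inl (by simpa using h))).elim
    · exact h
  have hz : ∀ z ∈ Cls a t P u, ∃ i : ℤ, G f < F z + i ∧ F z + i < G f' := by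
    intro z hz
    obtain ⟨i, h1, h2⟩ : ∃ i : ℤ, G f ≤ F z + i ∧ F z + i < G f + 1 := by
      refine ⟨-⌊F z - G f⌋, ?_, ?_⟩
      · have := Int.floor_le (F z - G f); push_cast; linarith
      · have := Int.lt_floor_add_one (F z - G f); push_cast; linarith
    refine ⟨i, lt_of_le_of_ne h1 (fun h => heq z hz i (Or.inl h.symm)), ?_⟩
    rcases lt_trichotomy (F z + i) (G f') with h | h | h
    · exact h
    · exact (heq z hz i (Or.inr h)).elim
    · have hFz : Same a t (F e) (F z + i) := by simpa using (sF z hz).add 0 0 i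
      exact (hns (sG.of_link ht ht6 hFz (Link.of_lt hlt (by linarith) h h2)).symm).elim
  obtain ⟨i, i1, i2⟩ := hz f hf
  obtain ⟨j, j1, j2⟩ := hz f' hf'
  have n1 := mG l
  rw [← hF.nd_eq] at n1
  have n2 := nd_le (F f - F f') (j - i)
  have n3 : |F f - F f' - ((j - i : ℤ):ℝ)| < G f' - G f := by
    rw [abs_lt]; push_cast; constructor <;> linarith
  have n4 : nd (G f - G f') = G f' - G f := by
    rw [nd_eq (n := 0)] <;> push_cast
    · rw [abs_sub_comm, abs_of_nonneg] <;> linarith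
    · rw [abs_le]; constructor <;> linarith
  linarith

lemma holes_false (ht : 0 < t) (ht6 : t < 1/6) {P l l' : ℕ} (hP : 0 < P) {v : ℝ} {F G : ℝ → ℝ}
    (hF : Move a t P v l F) (hG : Move a t P v l' G) {s u p w : ℝ} (hs : s ∈ Cls a t P v)
    (hu : u ∈ Cls a t P v) (hp : p ∈ Cls a t P v) (hw : w ∈ Cls a t P v)
    (hup : u < p) (hpw : p < w) (hws : w < s + 1)
    (aup : ∀ z ∈ Cls a t P v, u < z → p ≤ z) (asu : ∀ z ∈ Cls a t P v, z < u → z ≤ s)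
    (mF : ∀ m, nd (F u - F p) ≤ nd (3^m*u - 3^m*p))
    (mG : ∀ m, nd (G s - G u) ≤ nd (3^m*s - 3^m*u))
    (oF : F u ≤ 3*a ∧ 3*a+3*t ≤ F p ∧ F p - F u ≤ 1/2)
    (oG : G s ≤ 3*a ∧ 3*a+3*t ≤ G u ∧ G u - G s ≤ 1/2)
    (H : ∀ i j : ℕ, ∀ k : ℤ, ¬ Link (3^i*u) (3^i*w) (3^j*u + k/2) (3^j*w + k/2)) : False := by
  have hS : Same a t (F u) (G s) := by
    rcases le_total (F p - F u) (G u - G s) with h | h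
    · exact same_of_holes_aux ht ht6 hF hG hu hp hs hu mG oF oG h
    · exact (same_of_holes_aux ht ht6 hG hF hs hu hu hp mF oG oF h).symm
  have fs : ∀ z ∈ Cls a t P v, Same a t (F u) (F z) := fun z hz => hF.same (Cls.same ht ht6 hu hz)
  have gs : ∀ z ∈ Cls a t P v, Same a t (G s) (G z) := fun z hz => hG.same (Cls.same ht ht6 hs hz)
  have surjF : ∀ z ∈ Cls a t P v, ∃ y ∈ Cls a t P v, F y = G z := fun z hz =>
    hF.surj ht ht6 hP hu (hS.trans ht ht6 (gs z hz)) (hG.per hz.2)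
  have surjG : ∀ z ∈ Cls a t P v, ∃ y ∈ Cls a t P v, G y = F z := fun z hz =>
    hG.surj ht ht6 hP hs (hS.symm.trans ht ht6 (fs z hz)) (hF.per hz.2)
  obtain ⟨f1, f2, -⟩ := oF
  obtain ⟨g1, g2, -⟩ := oG
  have le_of : ∀ {l : ℕ} {F : ℝ → ℝ}, Move a t P v l F → ∀ {x y : ℝ}, x ∈ Cls a t P v →
      y ∈ Cls a t P v → x ≤ y → F x ≤ F y := by
    intro l F hF x y hx hy h
    rcases h.lt_or_eq with h | h
    · exact (hF.mono _ hx _ hy h).le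
    · rw [h]
  have e1 : F u = G s := by
    apply le_antisymm
    · obtain ⟨y, hy, hyF⟩ := surjG u hu
      rw [← hyF]
      exact le_of hG hy hs (asu y hy ((hG.lt_iff hy hu).1 (by rw [hyF]; linarith)))
    · obtain ⟨y, hy, hyF⟩ := surjF s hs
      rw [← hyF]
      refine le_of hF hy hu ?_
      by_contra hc
      push Not at hc
      have h1 := le_of hF hp hy (aup y hy hc)
      rw [hyF] at h1; linarith
  have e2 : G u = F p := by
    apply le_antisymm
    · obtain ⟨y, hy, hyF⟩ := surjG p hp
      rw [← hyF]
      refine le_of hG hu hy ?_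
      by_contra hc
      push Not at hc
      have h1 := le_of hG hy hs (asu y hy hc)
      rw [hyF] at h1; linarith
    · obtain ⟨y, hy, hyF⟩ := surjF u hu
      rw [← hyF]
      exact le_of hF hp hy (aup y hy ((hF.lt_iff hu hy).1 (by rw [hyF]; linarith)))
  have hFGw : F w < G w := by
    by_contra hc
    have hfin := (Cls.finite (a := a) (t := t) hP v u w).subset
      (sep_subset (Cls a t P v ∩ Icc u w) (fun z => F z < G z))
    obtain ⟨z, ⟨⟨hz, hz1, hz2⟩, hz3⟩, hzm⟩ := hfin.exists_maximal
      ⟨u, ⟨hu, le_rfl, by linarith⟩, by linarith⟩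
    have hzw : z < w := lt_of_le_of_ne hz2 (fun h => hc (h ▸ hz3))
    have hfin2 := (Cls.finite (a := a) (t := t) hP v z w).subset
      (sep_subset (Cls a t P v ∩ Icc z w) (fun y => z < y))
    obtain ⟨y, ⟨⟨hy, hy1, hy2⟩, hy3⟩, hym⟩ := hfin2.exists_minimal
      ⟨w, ⟨hw, hzw.le, le_rfl⟩, hzw⟩
    have hyn : G y ≤ F y := by
      by_contra hc2
      push Not at hc2
      have := hzm ⟨⟨hy, by linarith, hy2⟩, hc2⟩ hy3.le
      linarith
    have hG1 := hG.mono _ hz _ hy hy3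
    obtain ⟨x, hx, hxF⟩ := surjF z hz
    have q1 : z < x := (hF.lt_iff hz hx).1 (by rw [hxF]; exact hz3)
    have q2 : x < y := (hF.lt_iff hx hy).1 (by rw [hxF]; linarith)
    have := hym ⟨⟨hx, q1.le, by linarith⟩, q1⟩ q2.le
    linarith
  have hGw : G w < F u + 1 := by
    rw [e1]
    have := hG.mono _ hw _ (Cls.add_int hs 1) (by push_cast; exact hws)
    rwa [hG.add, Int.cast_one] at this
  have hL : Link (F u) (F w) (G u) (G w) :=
    Link.of_lt (by rw [e2]; exact hF.mono _ hu _ hp hup)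
      (by rw [e2]; exact hF.mono _ hp _ hw hpw) hFGw hGw
  obtain ⟨k, hk⟩ := hF.cong
  obtain ⟨k', hk'⟩ := hG.cong
  obtain ⟨i1, h1⟩ := hk u
  obtain ⟨i2, h2⟩ := hk w
  obtain ⟨i3, h3⟩ := hk' u
  obtain ⟨i4, h4⟩ := hk' w
  rw [h1, h2, h3, h4] at hL
  exact H l l' (k' - k) (hL.congr (-k/2) ⟨-i1, by push_cast; ring⟩ ⟨-i2, by push_cast; ring⟩
    ⟨-i3, by push_cast; ring⟩ ⟨-i4, by push_cast; ring⟩)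

lemma Cls.exists_neighbors {P : ℕ} (hP : 0 < P) {v u w x : ℝ} (hx : x ∈ Cls a t P v)
    (h1 : u < x) (h2 : x < w) :
    ∃ p ∈ Cls a t P v, ∃ q ∈ Cls a t P v, u < p ∧ p ≤ q ∧ q < w ∧
      (∀ z ∈ Cls a t P v, u < z → p ≤ z) ∧ (∀ z ∈ Cls a t P v, z < w → z ≤ q) := by
  have hfin := (Cls.finite (a := a) (t := t) hP v u w).subset
    (sep_subset (Cls a t P v ∩ Icc u w) (fun z => u < z ∧ z < w))
  obtain ⟨p, ⟨⟨hp, hp1, hp2⟩, hp3, hp4⟩, hpm⟩ := hfin.exists_minimal ⟨x, ⟨hx, h1.le, h2.le⟩, h1, h2⟩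
  obtain ⟨q, ⟨⟨hq, hq1, hq2⟩, hq3, hq4⟩, hqm⟩ := hfin.exists_maximal ⟨x, ⟨hx, h1.le, h2.le⟩, h1, h2⟩
  have ap : ∀ z ∈ Cls a t P v, u < z → p ≤ z := by
    intro z hz hz1
    rcases lt_or_ge z w with h | h
    · rcases le_total p z with h' | h'
      · exact h'
      · exact hpm ⟨⟨hz, hz1.le, h.le⟩, hz1, h⟩ h'
    · linarith
  have aq : ∀ z ∈ Cls a t P v, z < w → z ≤ q := by
    intro z hz hz1
    rcases lt_or_ge u z with h | h
    · rcases le_total z q with h' | h'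
      · exact h'
      · exact hqm ⟨⟨hz, h.le, hz1.le⟩, h, hz1⟩ h'
    · linarith
  exact ⟨p, hp, q, hq, hp3, ap q hq hq3, hq4, ap, aq⟩

lemma not_link_of_class (ht : 0 < t) (ht6 : t < 1/6) {A B x y : ℝ} (hB : Same a t A B)
    (hx : Same a t A x) (hy : Same a t A y)
    (H2 : ∀ i j : ℕ, ∀ k : ℤ, ¬ Link (3^i*A) (3^i*B) (3^j*A + k/2) (3^j*B + k/2)) :
    ¬ Link A B x y := by
  intro hL
  obtain ⟨N, P, hP, p1, p2, p3, p4⟩ := hx.exists_per_of_link ht ht6 hB hy hL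
  have hLN := push_iter ht ht6 N (fun j _ => (hB j).cell)
    (fun j _ => (hx.symm.trans ht ht6 hy j).cell) hL
  have per0 : ∀ {z}, Per N P z → Per 0 P (3^N*z) := by
    intro z ⟨m, hm⟩
    refine ⟨m, ?_⟩
    rw [zero_add, pow_zero, one_mul, ← hm]; ring
  set u : ℝ := 3^N*A with hu
  have cu : u ∈ Cls a t P u := ⟨(hB.trans ht ht6 hB.symm).pow N, per0 p1⟩
  have cB : 3^N*B ∈ Cls a t P u := ⟨hB.pow N, per0 p2⟩
  have cx : 3^N*x ∈ Cls a t P u := ⟨hx.pow N, per0 p3⟩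
  have cy : 3^N*y ∈ Cls a t P u := ⟨hy.pow N, per0 p4⟩
  obtain ⟨w, x', y', cw, cx', cy', g1, g2, g3, g4, m, hm⟩ : ∃ w x' y', w ∈ Cls a t P u ∧
      x' ∈ Cls a t P u ∧ y' ∈ Cls a t P u ∧ u < x' ∧ x' < w ∧ w < y' ∧ y' < u + 1 ∧
      ∃ m : ℤ, w = 3^N*B + m := by
    obtain ⟨i, j, k, h | h⟩ := hLN
    · exact ⟨_, _, _, Cls.add_int cB j, Cls.add_int cx i, Cls.add_int cy k, h.1, h.2.1, h.2.2.1, h.2.2.2, j, rfl⟩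
    · exact ⟨_, _, _, Cls.add_int cB j, Cls.add_int cy k, Cls.add_int cx i, h.1, h.2.1, h.2.2.1, h.2.2.2, j, rfl⟩
  have H : ∀ i j : ℕ, ∀ k : ℤ, ¬ Link (3^i*u) (3^i*w) (3^j*u + k/2) (3^j*w + k/2) := by
    intro i j k hl
    refine H2 (i+N) (j+N) k (hl.congr 0 ⟨0, by rw [hu]; push_cast; ring⟩
      ⟨-3^i*m, by rw [hm]; push_cast; ring⟩ ⟨0, by rw [hu]; push_cast; ring⟩
      ⟨-3^j*m, by rw [hm]; push_cast; ring⟩)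
  obtain ⟨p, cp, q, cq, b1, b2, b3, b4, b5⟩ := Cls.exists_neighbors hP cx' g1 g2
  obtain ⟨r, cr, s, cs, b6, b7, b8, b9, b10⟩ := Cls.exists_neighbors hP cy' g3 g4
  have cs' : s - 1 ∈ Cls a t P u := by simpa [sub_eq_add_neg] using Cls.add_int cs (-1)
  have cu1 : u + 1 ∈ Cls a t P u := by simpa using Cls.add_int cu 1
  have b11 : ∀ z ∈ Cls a t P u, z < u → z ≤ s - 1 := by
    intro z hz h
    have := b10 (z+1) (by simpa using Cls.add_int hz 1) (by linarith)
    linarith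
  obtain ⟨l1, F1, M1, n1, o1⟩ := exists_min_move ht ht6 hP cu cp b1 (by linarith)
  obtain ⟨l2, F2, M2, n2, o2⟩ := exists_min_move ht ht6 hP cq cw b3 (by linarith)
  obtain ⟨l3, F3, M3, n3, o3⟩ := exists_min_move ht ht6 hP cw cr b6 (by linarith)
  obtain ⟨l4, F4, M4, n4, o4⟩ := exists_min_move ht ht6 hP cs' cu (by linarith) (by linarith)
  have fin23 : (F2 q ≤ 3*a ∧ 3*a+3*t ≤ F2 w ∧ F2 w - F2 q ≤ 1/2) →
      (F3 w ≤ 3*a ∧ 3*a+3*t ≤ F3 r ∧ F3 r - F3 w ≤ 1/2) → False := by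
    intro k2 k3
    refine holes_false ht ht6 hP M3 M2 cq cw cr cu1 b6 (by linarith) (by linarith) b9 b5 n3 n2 k3 k2
      ?_
    intro i j k hl
    refine H i j k ((hl.swap_left.swap_right).congr 0 ⟨-3^i, by push_cast; ring⟩ ⟨0, by simp⟩
      ⟨-3^j, by push_cast; ring⟩ ⟨0, by simp⟩)
  rcases o1 with o1 | o1
  · rcases o4 with o4 | o4
    · exact holes_false ht ht6 hP M1 M4 cs' cu cp cw b1 (by linarith) (by linarith) b4 b11 n1 n4 o1 o4 H
    · rcases o2 with o2 | o2
      · rcases o3 with o3 | o3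
        · exact fin23 o2 o3
        · exact not_two_outer M4 M3 cs' cu cw cr (by linarith) (by linarith) b6 (by linarith)
            (Or.inl (by linarith)) n4 n3 o4 o3
      · exact not_two_outer M4 M2 cs' cu cq cw (by linarith) (by linarith) b3 (by linarith)
          (Or.inl (by linarith)) n4 n2 o4 o2
  · rcases o2 with o2 | o2
    · rcases o3 with o3 | o3
      · exact fin23 o2 o3
      · exact not_two_outer M1 M3 cu cp cw cr b1 (by linarith) b6 (by linarith)
          (Or.inl (by linarith)) n1 n3 o1 o3
    · exact not_two_outer M1 M2 cu cp cq cw b1 b2 b3 (by linarith)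
        (Or.inr (by linarith)) n1 n2 o1 o2

end

section
variable {a t : ℝ}

variable (a t) in
/-- Membership modulo one in a short arc spanned by a sixth-rotation of the short chord. -/
def Hol (j : ℤ) (x : ℝ) : Prop := ∃ n : ℤ, a + j / 6 ≤ x + n ∧ x + n ≤ a + j / 6 + t

variable (a t) in
/-- Membership modulo one in the arc following that of `Hol a t j`. -/
def Sx (j : ℤ) (x : ℝ) : Prop := ∃ n : ℤ, a + t + j / 6 ≤ x + n ∧ x + n ≤ a + (j + 1) / 6

lemma Hol.shift {j : ℤ} {x y : ℝ} (h : Hol a t j x) (i : ℤ) (hy : ∃ n : ℤ, y = x + i / 6 + n) :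
    Hol a t (j + i) y := by
  obtain ⟨n, h1, h2⟩ := h
  obtain ⟨m, rfl⟩ := hy
  exact ⟨n - m, by push_cast; linarith, by push_cast; linarith⟩

lemma Sx.shift {j : ℤ} {x y : ℝ} (h : Sx a t j x) (i : ℤ) (hy : ∃ n : ℤ, y = x + i / 6 + n) :
    Sx a t (j + i) y := by
  obtain ⟨n, h1, h2⟩ := h
  obtain ⟨m, rfl⟩ := hy
  exact ⟨n - m, by push_cast; linarith, by push_cast; linarith⟩

lemma Hol.mod {j : ℤ} {x : ℝ} (h : Hol a t j x) {i : ℤ} (hi : ∃ m, i = j + 6 * m) :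
    Hol a t i x := by
  obtain ⟨m, rfl⟩ := hi
  exact h.shift (6 * m) ⟨-m, by push_cast; ring⟩

lemma Sx.mod {j : ℤ} {x : ℝ} (h : Sx a t j x) {i : ℤ} (hi : ∃ m, i = j + 6 * m) :
    Sx a t i x := by
  obtain ⟨m, rfl⟩ := hi
  exact h.shift (6 * m) ⟨-m, by push_cast; ring⟩

lemma exists_mod_six (j : ℤ) : ∃ i m : ℤ, j = i + 6 * m ∧ 0 ≤ i ∧ i < 6 :=
  ⟨j % 6, j / 6, by omega, by omega, by omega⟩

/-- The cell containing a given hole. -/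
lemma Hol.exists_in (ht6 : t < 1/6) (j : ℤ) :
    ∃ C : Cl, ∀ x, Hol a t j x → In a t C x := by
  obtain ⟨i, m, rfl, h0, h6⟩ := exists_mod_six j
  have key : (∃ C : Cl, ∀ x, Hol a t i x → In a t C x) →
      ∃ C : Cl, ∀ x, Hol a t (i + 6 * m) x → In a t C x := by
    rintro ⟨C, hC⟩
    exact ⟨C, fun x hx => hC x (hx.mod ⟨-m, by ring⟩)⟩
  apply key
  interval_cases i
  · refine ⟨.pm, ?_⟩
    rintro x ⟨n, h1, h2⟩
    refine ⟨-n-1, ?_, ?_⟩ <;> simp only [Cl.lo, Cl.wid, Cl.pp] <;> push_cast at * <;> linarith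
  · refine ⟨.q1, ?_⟩
    rintro x ⟨n, h1, h2⟩
    refine ⟨-n, ?_, ?_⟩ <;> simp only [Cl.lo, Cl.wid, Cl.pp] <;> push_cast at * <;> linarith
  · refine ⟨.q2, ?_⟩
    rintro x ⟨n, h1, h2⟩
    refine ⟨-n, ?_, ?_⟩ <;> simp only [Cl.lo, Cl.wid, Cl.pp] <;> push_cast at * <;> linarith
  · refine ⟨.p1, ?_⟩
    rintro x ⟨n, h1, h2⟩
    refine ⟨-n, ?_, ?_⟩ <;> simp only [Cl.lo, Cl.wid, Cl.pp] <;> push_cast at * <;> linarith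
  · refine ⟨.q4, ?_⟩
    rintro x ⟨n, h1, h2⟩
    refine ⟨-n, ?_, ?_⟩ <;> simp only [Cl.lo, Cl.wid, Cl.pp] <;> push_cast at * <;> linarith
  · refine ⟨.q5, ?_⟩
    rintro x ⟨n, h1, h2⟩
    refine ⟨-n, ?_, ?_⟩ <;> simp only [Cl.lo, Cl.wid, Cl.pp] <;> push_cast at * <;> linarith

lemma Hol.cell (ht6 : t < 1/6) {j : ℤ} {x y : ℝ} (hx : Hol a t j x)
    (hy : Hol a t j y) : Cell a t x y := by
  obtain ⟨C, hC⟩ := Hol.exists_in (a := a) ht6 j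
  exact ⟨C, hC x hx, hC y hy⟩

lemma Sx.exists_in (ht : 0 < t) (ht6 : t < 1/6) (j : ℤ) :
    ∃ C : Cl, ∀ x, Sx a t j x ∨ Sx a t (5 - j) x → In a t C x := by
  obtain ⟨i, m, rfl, h0, h6⟩ := exists_mod_six j
  have key : (∃ C : Cl, ∀ x, Sx a t i x ∨ Sx a t (5 - i) x → In a t C x) →
      ∃ C : Cl, ∀ x, Sx a t (i + 6 * m) x ∨ Sx a t (5 - (i + 6 * m)) x → In a t C x := by
    rintro ⟨C, hC⟩
    exact ⟨C, fun x hx => hC x (hx.imp (fun h => h.mod ⟨-m, by ring⟩)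
      (fun h => h.mod ⟨m, by ring⟩))⟩
  apply key
  interval_cases i
  · refine ⟨.pm, ?_⟩
    rintro x (⟨n, h1, h2⟩ | ⟨n, h1, h2⟩)
    · refine ⟨-n-1, ?_, ?_⟩ <;> simp only [Cl.lo, Cl.wid, Cl.pp] <;> push_cast at * <;> linarith
    · refine ⟨-n, ?_, ?_⟩ <;> simp only [Cl.lo, Cl.wid, Cl.pp] <;> push_cast at * <;> linarith
  · refine ⟨.p0, ?_⟩
    rintro x (⟨n, h1, h2⟩ | ⟨n, h1, h2⟩)
    · refine ⟨-2*n, ?_, ?_⟩ <;> simp only [Cl.lo, Cl.wid, Cl.pp] <;> push_cast at * <;> linarith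
    · refine ⟨-2*n+1, ?_, ?_⟩ <;> simp only [Cl.lo, Cl.wid, Cl.pp] <;> push_cast at * <;> linarith
  · refine ⟨.p1, ?_⟩
    rintro x (⟨n, h1, h2⟩ | ⟨n, h1, h2⟩)
    · refine ⟨-n, ?_, ?_⟩ <;> simp only [Cl.lo, Cl.wid, Cl.pp] <;> push_cast at * <;> linarith
    · refine ⟨-n, ?_, ?_⟩ <;> simp only [Cl.lo, Cl.wid, Cl.pp] <;> push_cast at * <;> linarith
  · refine ⟨.p1, ?_⟩
    rintro x (⟨n, h1, h2⟩ | ⟨n, h1, h2⟩)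
    · refine ⟨-n, ?_, ?_⟩ <;> simp only [Cl.lo, Cl.wid, Cl.pp] <;> push_cast at * <;> linarith
    · refine ⟨-n, ?_, ?_⟩ <;> simp only [Cl.lo, Cl.wid, Cl.pp] <;> push_cast at * <;> linarith
  · refine ⟨.p0, ?_⟩
    rintro x (⟨n, h1, h2⟩ | ⟨n, h1, h2⟩)
    · refine ⟨-2*n+1, ?_, ?_⟩ <;> simp only [Cl.lo, Cl.wid, Cl.pp] <;> push_cast at * <;> linarith
    · refine ⟨-2*n, ?_, ?_⟩ <;> simp only [Cl.lo, Cl.wid, Cl.pp] <;> push_cast at * <;> linarith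
  · refine ⟨.pm, ?_⟩
    rintro x (⟨n, h1, h2⟩ | ⟨n, h1, h2⟩)
    · refine ⟨-n, ?_, ?_⟩ <;> simp only [Cl.lo, Cl.wid, Cl.pp] <;> push_cast at * <;> linarith
    · refine ⟨-n-1, ?_, ?_⟩ <;> simp only [Cl.lo, Cl.wid, Cl.pp] <;> push_cast at * <;> linarith

lemma Sx.cell (ht : 0 < t) (ht6 : t < 1/6) {i j : ℤ} {x y : ℝ} (hx : Sx a t i x)
    (hy : Sx a t j y) (hij : (∃ m, j = i + 6 * m) ∨ ∃ m, i + j = 5 + 6 * m) : Cell a t x y := by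
  obtain ⟨C, hC⟩ := Sx.exists_in (a := a) ht ht6 i
  refine ⟨C, hC x (Or.inl hx), hC y ?_⟩
  rcases hij with ⟨m, hm⟩ | ⟨m, hm⟩
  · exact Or.inl (hy.mod ⟨-m, by omega⟩)
  · exact Or.inr (hy.mod ⟨-m, by omega⟩)

/-- The points of a cell. -/
lemma In.cases {C : Cl} : ∃ i : ℤ, ∀ x, In a t C x →
    (Hol a t i x ∧ (C.isP → ∃ k, i = 3 * k)) ∨ (C.isP ∧ (Sx a t i x ∨ Sx a t (5 - i) x)) := by
  cases C
  · refine ⟨3, ?_⟩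
    rintro x ⟨n, h1, h2⟩
    simp only [Cl.lo, Cl.wid, Cl.pp, Int.cast_ofNat] at h1 h2
    rcases le_total (x - n) (a + 1/2) with h | h
    · exact Or.inr ⟨trivial, Or.inr ⟨-n, by push_cast; linarith, by push_cast; linarith⟩⟩
    rcases le_total (x - n) (a + 1/2 + t) with h' | h'
    · exact Or.inl ⟨⟨-n, by push_cast; linarith, by push_cast; linarith⟩, fun _ => ⟨1, by ring⟩⟩
    · exact Or.inr ⟨trivial, Or.inl ⟨-n, by push_cast; linarith, by push_cast; linarith⟩⟩
  · refine ⟨0, ?_⟩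
    rintro x ⟨n, h1, h2⟩
    simp only [Cl.lo, Cl.wid, Cl.pp, Int.cast_ofNat] at h1 h2
    rcases le_total (x - n) (a + 1) with h | h
    · exact Or.inr ⟨trivial, Or.inr ⟨-n, by push_cast; linarith, by push_cast; linarith⟩⟩
    rcases le_total (x - n) (a + 1 + t) with h' | h'
    · exact Or.inl ⟨⟨-n-1, by push_cast; linarith, by push_cast; linarith⟩, fun _ => ⟨0, by ring⟩⟩
    · exact Or.inr ⟨trivial, Or.inl ⟨-n-1, by push_cast; linarith, by push_cast; linarith⟩⟩
  · refine ⟨1, ?_⟩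
    rintro x ⟨n, h1, h2⟩
    simp only [Cl.lo, Cl.wid, Cl.pp, Int.cast_one] at h1 h2
    rcases Int.even_or_odd' n with ⟨m, rfl | rfl⟩
    · exact Or.inr ⟨trivial, Or.inl ⟨-m, by push_cast at *; linarith, by push_cast at *; linarith⟩⟩
    · exact Or.inr ⟨trivial, Or.inr ⟨-m, by push_cast at *; linarith, by push_cast at *; linarith⟩⟩
  · exact ⟨1, fun x ⟨n, h1, h2⟩ => Or.inl ⟨⟨-n, by
      simp only [Cl.lo, Cl.wid, Cl.pp] at *; push_cast at *; linarith, by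
      simp only [Cl.lo, Cl.wid, Cl.pp] at *; push_cast at *; linarith⟩, fun h => h.elim⟩⟩
  · exact ⟨2, fun x ⟨n, h1, h2⟩ => Or.inl ⟨⟨-n, by
      simp only [Cl.lo, Cl.wid, Cl.pp] at *; push_cast at *; linarith, by
      simp only [Cl.lo, Cl.wid, Cl.pp] at *; push_cast at *; linarith⟩, fun h => h.elim⟩⟩
  · exact ⟨4, fun x ⟨n, h1, h2⟩ => Or.inl ⟨⟨-n, by
      simp only [Cl.lo, Cl.wid, Cl.pp] at *; push_cast at *; linarith, by
      simp only [Cl.lo, Cl.wid, Cl.pp] at *; push_cast at *; linarith⟩, fun h => h.elim⟩⟩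
  · exact ⟨5, fun x ⟨n, h1, h2⟩ => Or.inl ⟨⟨-n, by
      simp only [Cl.lo, Cl.wid, Cl.pp] at *; push_cast at *; linarith, by
      simp only [Cl.lo, Cl.wid, Cl.pp] at *; push_cast at *; linarith⟩, fun h => h.elim⟩⟩

end

section
variable {a t : ℝ}

variable (a t) in
/-- Chords following the cells until they bound a gap. -/
def Leaf (x y : ℝ) : Prop :=
  (∀ k : ℕ, Cell a t (3^k*x) (3^k*y)) ∧
    ∃ n : ℕ, Edge a t (3^n*x) (3^n*y) ∨ Edge a t (3^n*y) (3^n*x)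

lemma Leaf.symm {x y : ℝ} (h : Leaf a t x y) : Leaf a t y x :=
  ⟨fun k => (h.1 k).symm, h.2.imp fun _ h => h.symm⟩

lemma Leaf.not_link (ht : 0 < t) (ht6 : t < 1/6) {x y u v : ℝ} (h : Leaf a t x y)
    (h' : Leaf a t u v) : ¬ Link x y u v := by
  obtain ⟨n, hn⟩ := h.2
  exact not_link_of_edge ht ht6 n (fun j _ => h.1 j) (fun j _ => h'.1 j) hn

lemma Leaf.add {x y : ℝ} (h : Leaf a t x y) (k i j : ℤ) :
    Leaf a t (x + k / 2 + i) (y + k / 2 + j) := by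
  have e : ∀ (l : ℕ) (z : ℝ) (i : ℤ), 3^l * (z + k/2 + i) =
      3^l * z + ((3^l*k : ℤ) : ℝ)/2 + ((3^l*i : ℤ):ℝ) := by
    intros; push_cast; ring
  refine ⟨fun l => ?_, ?_⟩
  · rw [e, e]; exact (h.1 l).add _ _ _
  · obtain ⟨n, hn⟩ := h.2
    refine ⟨n, ?_⟩
    rw [e, e]; exact hn.imp (fun h => h.add _ _ _) (fun h => h.add _ _ _)

lemma Leaf.lift {x y x' y' : ℝ} (hc : Cell a t x y) (h : Leaf a t x' y')
    (hx : ∃ n : ℤ, 3 * x = x' + n) (hy : ∃ n : ℤ, 3 * y = y' + n) : Leaf a t x y := by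
  obtain ⟨n, hn⟩ := hx
  obtain ⟨m, hm⟩ := hy
  have h2 := h.add 0 n m
  simp only [Int.cast_zero, zero_div, add_zero, ← hn, ← hm] at h2
  have e : ∀ (k : ℕ) (z : ℝ), 3^(k+1)*z = 3^k*(3*z) := by intros; ring
  refine ⟨fun k => ?_, ?_⟩
  · rcases k with _ | k
    · simpa using hc
    · rw [e, e]; exact h2.1 k
  · obtain ⟨k, hk⟩ := h2.2
    exact ⟨k+1, by rwa [e, e]⟩

variable (ht : 0 < t) (ht6 : t < 1/6) (hB : Leaf a t (3*a) (3*a+3*t))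
include ht ht6 hB

omit ht ht6 in
lemma Leaf.three {x y : ℝ} (h : Leaf a t x y) : Leaf a t (3*x) (3*y) := by
  have e : ∀ (k : ℕ) (z : ℝ), 3^k*(3*z) = 3^(k+1)*z := by intros; ring
  obtain ⟨n, hn⟩ := h.2
  rcases n with _ | n
  · simp only [pow_zero, one_mul] at hn
    rcases hn with hn | hn <;> obtain ⟨k, j, e1, e2⟩ := hn.image
    · rw [e1, e2]; simpa using hB.add k 0 j
    · rw [e1, e2]; simpa using hB.symm.add k j 0
  · refine ⟨fun k => ?_, n, ?_⟩
    · rw [e, e]; exact h.1 _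
    · rwa [e, e]

lemma leaf_hole (k i j : ℤ) : Leaf a t (a + k / 2 + i) (a + t + k / 2 + j) := by
  have h0 : Leaf a t a (a + t) := by
    refine Leaf.lift (Hol.cell (a := a) ht6 (j := 0) ⟨0, ?_, ?_⟩ ⟨0, ?_, ?_⟩) hB ⟨0, ?_⟩ ⟨0, ?_⟩ <;>
      push_cast <;> linarith
  exact h0.add k i j

lemma Leaf.cases {x y : ℝ} (h : Leaf a t x y) : (∃ j, Hol a t j x ∧ Hol a t j y) ∨
    ∃ i j, Sx a t i x ∧ Sx a t j y ∧ ((∃ m, j = i + 6 * m) ∨ ∃ m, i + j = 5 + 6 * m) := by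
  have key : ∀ {x y : ℝ} {k : ℤ}, Leaf a t x y → Hol a t (3*k) x →
      (Sx a t (3*k) y ∨ Sx a t (3*k-1) y) → Hol a t (3*k) y ∨ Sx a t (3*k) x ∨
        Sx a t (3*k-1) x := by
    rintro x y k h ⟨n, h1, h2⟩ hy
    by_contra! hcon
    obtain ⟨c1, c2, c3⟩ := hcon
    push_cast at h1 h2
    have g1 : a + k / 2 < x + n := by
      refine lt_of_le_of_ne (by linarith) fun e => c3 ⟨n, ?_, ?_⟩ <;> push_cast <;> linarith
    have g2 : x + n < a + t + k / 2 := by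
      refine lt_of_le_of_ne (by linarith) fun e => c2 ⟨n, ?_, ?_⟩ <;> push_cast <;> linarith
    have hl := (leaf_hole ht ht6 hB k 0 0).not_link ht ht6 h
    rcases hy with ⟨m, g3, g4⟩ | ⟨m, g3, g4⟩
    · push_cast at g3 g4
      have g5 : a + t + k / 2 < y + m := by
        refine lt_of_le_of_ne (by linarith) fun e => c1 ⟨m, ?_, ?_⟩ <;> push_cast <;> linarith
      exact hl ⟨n, 0, m, Or.inl (by push_cast; refine ⟨?_, ?_, ?_, ?_⟩ <;> linarith)⟩
    · push_cast at g3 g4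
      have g5 : y + m < a + k / 2 := by
        refine lt_of_le_of_ne (by linarith) fun e => c1 ⟨m, ?_, ?_⟩ <;> push_cast <;> linarith
      exact hl ⟨n, 0, m + 1, Or.inl (by push_cast; refine ⟨?_, ?_, ?_, ?_⟩ <;> linarith)⟩
  obtain ⟨C, hx, hy⟩ := h.1 0
  simp only [pow_zero, one_mul] at hx hy
  obtain ⟨i, hi⟩ := In.cases (a := a) (t := t) (C := C)
  have fix : ∀ {k : ℤ} {z : ℝ}, Sx a t (5 - 3 * k) z ↔ Sx a t (3 * k - 1) z := fun {k z} =>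
    ⟨fun h => h.mod ⟨k - 1, by ring⟩, fun h => h.mod ⟨1 - k, by ring⟩⟩
  rcases hi x hx with ⟨x1, x2⟩ | ⟨x1, x2⟩ <;> rcases hi y hy with ⟨y1, y2⟩ | ⟨y1, y2⟩
  · exact Or.inl ⟨i, x1, y1⟩
  · obtain ⟨k, rfl⟩ := x2 y1
    rw [fix] at y2
    rcases key h x1 y2 with h | h | h
    · exact Or.inl ⟨_, x1, h⟩
    · rcases y2 with y2 | y2
      · exact Or.inr ⟨_, _, h, y2, Or.inl ⟨0, by ring⟩⟩
      · exact Or.inr ⟨_, _, h, y2, Or.inr ⟨k - 1, by ring⟩⟩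
    · rcases y2 with y2 | y2
      · exact Or.inr ⟨_, _, h, y2, Or.inr ⟨k - 1, by ring⟩⟩
      · exact Or.inr ⟨_, _, h, y2, Or.inl ⟨0, by ring⟩⟩
  · obtain ⟨k, rfl⟩ := y2 x1
    rw [fix] at x2
    rcases key h.symm y1 x2 with h | h | h
    · exact Or.inl ⟨_, h, y1⟩
    · rcases x2 with x2 | x2
      · exact Or.inr ⟨_, _, x2, h, Or.inl ⟨0, by ring⟩⟩
      · exact Or.inr ⟨_, _, x2, h, Or.inr ⟨k - 1, by ring⟩⟩
    · rcases x2 with x2 | x2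
      · exact Or.inr ⟨_, _, x2, h, Or.inr ⟨k - 1, by ring⟩⟩
      · exact Or.inr ⟨_, _, x2, h, Or.inl ⟨0, by ring⟩⟩
  · right
    rcases x2 with x2 | x2 <;> rcases y2 with y2 | y2
    · exact ⟨_, _, x2, y2, Or.inl ⟨0, by ring⟩⟩
    · exact ⟨_, _, x2, y2, Or.inr ⟨0, by ring⟩⟩
    · exact ⟨_, _, x2, y2, Or.inr ⟨0, by ring⟩⟩
    · exact ⟨_, _, x2, y2, Or.inl ⟨0, by ring⟩⟩

/-- Any two of the siblings of a leaf are obtained by rotating its endpoints. -/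
lemma Leaf.siblings {x y : ℝ} (h : Leaf a t x y) :
    (Leaf a t (x+1/3) (y+1/3) ∧ Leaf a t (x+2/3) (y+2/3)) ∨
    (Leaf a t (x+1/3) (y+2/3) ∧ Leaf a t (x+2/3) (y+1/3)) := by
  have h3 := hB.three h
  rcases hB.cases ht ht6 h with ⟨j, h1, h2⟩ | ⟨i, j, h1, h2, hij⟩
  · refine Or.inl ⟨Leaf.lift (Hol.cell ht6 (h1.shift 2 ⟨0, ?_⟩) (h2.shift 2 ⟨0, ?_⟩)) h3
      ⟨1, ?_⟩ ⟨1, ?_⟩, Leaf.lift (Hol.cell ht6 (h1.shift 4 ⟨0, ?_⟩) (h2.shift 4 ⟨0, ?_⟩)) h3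
      ⟨2, ?_⟩ ⟨2, ?_⟩⟩ <;> push_cast <;> ring
  · rcases hij with ⟨m, hm⟩ | ⟨m, hm⟩
    · refine Or.inl ⟨Leaf.lift (Sx.cell ht ht6 (h1.shift 2 ⟨0, ?_⟩) (h2.shift 2 ⟨0, ?_⟩)
        (Or.inl ⟨m, by omega⟩)) h3 ⟨1, ?_⟩ ⟨1, ?_⟩,
        Leaf.lift (Sx.cell ht ht6 (h1.shift 4 ⟨0, ?_⟩) (h2.shift 4 ⟨0, ?_⟩)
        (Or.inl ⟨m, by omega⟩)) h3 ⟨2, ?_⟩ ⟨2, ?_⟩⟩ <;> push_cast <;> ring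
    · refine Or.inr ⟨Leaf.lift (Sx.cell ht ht6 (h1.shift 2 ⟨0, ?_⟩) (h2.shift 4 ⟨0, ?_⟩)
        (Or.inr ⟨m+1, by omega⟩)) h3 ⟨1, ?_⟩ ⟨2, ?_⟩,
        Leaf.lift (Sx.cell ht ht6 (h1.shift 4 ⟨0, ?_⟩) (h2.shift 2 ⟨0, ?_⟩)
        (Or.inr ⟨m+1, by omega⟩)) h3 ⟨2, ?_⟩ ⟨1, ?_⟩⟩ <;> push_cast <;> ring

lemma Leaf.exists_third {x y : ℝ} (h : Leaf a t x y) :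
    ∃ i j : Fin 3, Leaf a t ((x + (i:ℕ))/3) ((y + (j:ℕ))/3) := by
  have norm : ∀ x : ℝ, ∃ n : ℤ, 3 * a ≤ x + n ∧ x + n < 3 * a + 1 := fun x =>
    ⟨-⌊x - 3*a⌋, by push_cast; linarith [Int.floor_le (x - 3*a)],
      by push_cast; linarith [Int.lt_floor_add_one (x - 3*a)]⟩
  have fin : ∀ (n : ℤ) (x : ℝ), ∃ i : Fin 3, ∃ m : ℤ, (x + (i:ℕ))/3 = (x + n)/3 + m := by
    intro n x
    obtain ⟨l, hl⟩ : ∃ l : ℤ, n % 3 = n + 3 * l := ⟨-(n/3), by omega⟩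
    refine ⟨⟨(n % 3).toNat, by omega⟩, l, ?_⟩
    have e : (((n % 3).toNat : ℤ) : ℝ) = n + 3 * l := by
      rw [Int.toNat_of_nonneg (by omega)]; exact_mod_cast hl
    rw [Int.cast_natCast] at e
    simp only [e]; ring
  suffices ∃ n m : ℤ, Leaf a t ((x + n)/3) ((y + m)/3) by
    obtain ⟨n, m, hl⟩ := this
    obtain ⟨i, k, hi⟩ := fin n x
    obtain ⟨j, l, hj⟩ := fin m y
    refine ⟨i, j, ?_⟩
    rw [hi, hj]
    simpa using hl.add 0 k l
  obtain ⟨n, x1, x2⟩ := norm x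
  obtain ⟨m, y1, y2⟩ := norm y
  have hl := hB.not_link ht ht6 h
  have inn : 3*a < x + n → x + n < 3*a+3*t → 3*a+3*t < y + m → False := fun h1 h2 h3 =>
    hl ⟨n, 0, m, Or.inl (by push_cast; refine ⟨?_, ?_, ?_, ?_⟩ <;> linarith)⟩
  have inn' : 3*a < y + m → y + m < 3*a+3*t → 3*a+3*t < x + n → False := fun h1 h2 h3 =>
    hl ⟨n, 0, m, Or.inr (by push_cast; refine ⟨?_, ?_, ?_, ?_⟩ <;> linarith)⟩
  have hol : ∀ x : ℝ, 3*a ≤ x → x ≤ 3*a+3*t → Hol a t 0 (x/3) := fun x h1 h2 =>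
    ⟨0, by push_cast; linarith, by push_cast; linarith⟩
  have out : ∀ n m : ℤ, 3*a+3*t ≤ x + n → x + n ≤ 3*a+1 → 3*a+3*t ≤ y + m → y + m ≤ 3*a+1 →
      ∃ n m : ℤ, Leaf a t ((x + n)/3) ((y + m)/3) := by
    intro n m h1 h2 h3 h4
    refine ⟨n+1, m+1, Leaf.lift ⟨.p1, ⟨0, ?_, ?_⟩, ⟨0, ?_, ?_⟩⟩ h ⟨n+1, by ring⟩ ⟨m+1, by ring⟩⟩ <;>
      simp only [Cl.lo, Cl.wid, Cl.pp] <;> push_cast <;> linarith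
  rcases lt_or_ge (3*a+3*t) (x+n) with hx | hx <;> rcases lt_or_ge (3*a+3*t) (y+m) with hy | hy
  · exact out n m hx.le x2.le hy.le y2.le
  · rcases y1.eq_or_lt with e | y1
    · exact out n (m+1) hx.le x2.le (by push_cast; linarith) (by push_cast; linarith)
    · rcases hy.eq_or_lt with e | hy
      · exact out n m hx.le x2.le e.ge y2.le
      · exact (inn' y1 hy hx).elim
  · rcases x1.eq_or_lt with e | x1
    · exact out (n+1) m (by push_cast; linarith) (by push_cast; linarith) hy.le y2.le
    · rcases hx.eq_or_lt with e | hx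
      · exact out n m e.ge x2.le hy.le y2.le
      · exact (inn x1 hx hy).elim
  · exact ⟨n, m, Leaf.lift (Hol.cell ht6 (hol _ x1 hx) (hol _ y1 hy)) h ⟨n, by ring⟩ ⟨m, by ring⟩⟩
end

lemma norm_coe (x : ℝ) : ‖((x : ℝ) : S1)‖ = nd x := UnitAddCircle.norm_eq

lemma coe_eq_coe {x y : ℝ} : (x : S1) = (y : S1) ↔ ∃ n : ℤ, x = y + n := by
  rw [← sub_eq_zero, ← AddCircle.coe_sub, AddCircle.coe_eq_zero_iff]
  constructor
  · rintro ⟨n, hn⟩; exact ⟨n, by simp at hn; linarith⟩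
  · rintro ⟨n, hn⟩; exact ⟨n, by simp; linarith⟩

lemma exists_coe (p : S1) : ∃ x : ℝ, (x : S1) = p := QuotientAddGroup.mk_surjective p

lemma s3_coe (x : ℝ) : s3 (x : S1) = ((3 * x : ℝ) : S1) := by
  simp only [s3, ← AddCircle.coe_nsmul, nsmul_eq_mul]; norm_num

lemma s3_iterate_coe (k : ℕ) (x : ℝ) : s3^[k] (x : S1) = ((3^k * x : ℝ) : S1) := by
  induction k with
  | zero => simp
  | succ k ih => rw [Function.iterate_succ_apply', ih, s3_coe]; congr 1; ring

lemma antip_coe (x : ℝ) : antip (x : S1) = ((x + 1/2 : ℝ) : S1) := by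
  simp only [antip, ← AddCircle.coe_add]

lemma chordLen_coe (x y : ℝ) : chordLen s((x : S1), (y : S1)) = nd (x - y) := by
  simp only [chordLen, Sym2.lift_mk, ← AddCircle.coe_sub, norm_coe]

lemma toC_coe (x : ℝ) : toC (x : S1) = Complex.exp (2 * Real.pi * Complex.I * x) := by
  have h : ((AddCircle.equivIco 1 0 (x : S1) : Set.Ico (0:ℝ) (0+1)) : ℝ) = x - ⌊x⌋ := by
    have := AddCircle.coe_equivIco_mk_apply (1:ℝ) x
    rw [div_one, mul_one] at this
    exact this
  unfold toC
  rw [h, Complex.exp_eq_exp_iff_exists_int]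
  exact ⟨-⌊x⌋, by push_cast; ring⟩

lemma chordSet_coe (x y : ℝ) : chordSet s((x : S1), (y : S1)) = segment ℝ (toC x) (toC y) := rfl

/-- An affine functional vanishing on the chord from `x` to `y`. -/
def side (x y : ℝ) (z : ℂ) : ℝ :=
  Real.cos (Real.pi * (x + y)) * z.re + Real.sin (Real.pi * (x + y)) * z.im -
    Real.cos (Real.pi * (x - y))

lemma side_toC (x y w : ℝ) : side x y (toC w) =
    -2 * Real.sin (Real.pi * (w - x)) * Real.sin (Real.pi * (w - y)) := by
  have e : (2 * Real.pi * Complex.I * w : ℂ) = ((2 * Real.pi * w : ℝ) : ℂ) * Complex.I := by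
    push_cast; ring
  have h1 : side x y (toC w) =
      Real.cos (2 * Real.pi * w - Real.pi * (x + y)) - Real.cos (Real.pi * (x - y)) := by
    rw [toC_coe, e, side, Complex.exp_ofReal_mul_I_re, Complex.exp_ofReal_mul_I_im, Real.cos_sub]
    ring
  rw [h1, Real.cos_sub_cos]
  have e1 : (2 * Real.pi * w - Real.pi * (x + y) + Real.pi * (x - y)) / 2 = Real.pi * (w - y) := by
    ring
  have e2 : (2 * Real.pi * w - Real.pi * (x + y) - Real.pi * (x - y)) / 2 = Real.pi * (w - x) := by
    ring
  rw [e1, e2]; ring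

lemma side_combo (x y : ℝ) (z w : ℂ) {r s : ℝ} (h : r + s = 1) :
    side x y (r • z + s • w) = r * side x y z + s * side x y w := by
  obtain rfl : s = 1 - r := by linarith
  simp [side]; ring

lemma side_pos {x y w : ℝ} (hxy : y ≤ x + 1) (h1 : x < w) (h2 : w < y) : 0 < side x y (toC w) := by
  have hp := Real.pi_pos
  rw [side_toC]
  have e1 : 0 < Real.sin (Real.pi * (w - x)) :=
    Real.sin_pos_of_pos_of_lt_pi (by nlinarith) (by nlinarith)
  have e2 : 0 < Real.sin (Real.pi * (y - w)) :=
    Real.sin_pos_of_pos_of_lt_pi (by nlinarith) (by nlinarith)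
  have e3 : Real.sin (Real.pi * (w - y)) = - Real.sin (Real.pi * (y - w)) := by
    rw [← Real.sin_neg]; congr 1; ring
  rw [e3]; nlinarith [mul_pos e1 e2]

lemma side_neg {x y w : ℝ} (hxy : x ≤ y) (h1 : y < w) (h2 : w < x + 1) :
    side x y (toC w) < 0 := by
  have hp := Real.pi_pos
  rw [side_toC]
  have e1 : 0 < Real.sin (Real.pi * (w - x)) :=
    Real.sin_pos_of_pos_of_lt_pi (by nlinarith) (by nlinarith)
  have e2 : 0 < Real.sin (Real.pi * (w - y)) :=
    Real.sin_pos_of_pos_of_lt_pi (by nlinarith) (by nlinarith)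
  nlinarith [mul_pos e1 e2]

/-- Unlinked chords without common endpoints are disjoint. -/
lemma disjoint_chordSet {x y u v : ℝ} (h : ¬ Link x y u v) (h1 : (x : S1) ≠ u) (h2 : (x : S1) ≠ v)
    (h3 : (y : S1) ≠ u) (h4 : (y : S1) ≠ v) :
    Disjoint (chordSet s((x : S1), (y : S1))) (chordSet s((u : S1), (v : S1))) := by
  have norm : ∀ z : ℝ, ∃ w : ℝ, (∃ n : ℤ, w = z + n) ∧ x ≤ w ∧ w < x + 1 := fun z =>
    ⟨z - ⌊z - x⌋, ⟨-⌊z - x⌋, by push_cast; ring⟩, by linarith [Int.floor_le (z - x)],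
      by linarith [Int.lt_floor_add_one (z - x)]⟩
  obtain ⟨y', ⟨j, hj⟩, y1, y2⟩ := norm y
  obtain ⟨u', ⟨i, hi⟩, u1, u2⟩ := norm u
  obtain ⟨v', ⟨k, hk⟩, v1, v2⟩ := norm v
  rw [← coe_eq_coe.2 ⟨j, hj⟩] at h3 h4 ⊢
  rw [← coe_eq_coe.2 ⟨i, hi⟩] at h1 h3 ⊢
  rw [← coe_eq_coe.2 ⟨k, hk⟩] at h2 h4 ⊢
  have h' : ¬ Link x y' u' v' := fun hl => h (hl.congr 0 ⟨0, by simp⟩ ⟨-j, by simp [hj]⟩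
    ⟨-i, by simp [hi]⟩ ⟨-k, by simp [hk]⟩)
  have u3 : x < u' := lt_of_le_of_ne u1 fun e => h1 (by rw [e])
  have v3 : x < v' := lt_of_le_of_ne v1 fun e => h2 (by rw [e])
  have u4 : y' ≠ u' := fun e => h3 (by rw [e])
  have v4 : y' ≠ v' := fun e => h4 (by rw [e])
  have hx : side x y' (toC x) = 0 := by rw [side_toC]; simp
  have hy : side x y' (toC y') = 0 := by rw [side_toC]; simp
  have key : 0 < side x y' (toC u') ∧ 0 < side x y' (toC v') ∨
      side x y' (toC u') < 0 ∧ side x y' (toC v') < 0 := by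
    rcases lt_or_gt_of_ne u4 with g1 | g1 <;> rcases lt_or_gt_of_ne v4 with g2 | g2
    · exact Or.inr ⟨side_neg y1 g1 u2, side_neg y1 g2 v2⟩
    · exact (h' (Link.swap_right (Link.of_lt v3 g2 g1 u2))).elim
    · exact (h' (Link.of_lt u3 g1 g2 v2)).elim
    · exact Or.inl ⟨side_pos y2.le u3 g1, side_pos y2.le v3 g2⟩
  rw [Set.disjoint_left]
  rintro z ⟨r, s, hr, hs, hrs, rfl⟩ ⟨r', s', hr', hs', hrs', hz⟩
  have e := congrArg (side x y') hz
  rw [side_combo _ _ _ _ hrs, side_combo _ _ _ _ hrs', hx, hy] at e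
  rcases key with ⟨k1, k2⟩ | ⟨k1, k2⟩ <;> rcases hr'.eq_or_lt with rfl | hr'
  · obtain rfl : s' = 1 := by linarith
    linarith
  · nlinarith [mul_pos hr' k1, mul_nonneg hs' k2.le]
  · obtain rfl : s' = 1 := by linarith
    linarith
  · nlinarith [mul_pos_of_neg_of_neg (neg_lt_zero.2 hr') k1, mul_nonneg hs' (neg_nonneg.2 k2.le)]

lemma crosses_iff {x y u v : ℝ} :
    Crosses s((x : S1), (y : S1)) s((u : S1), (v : S1)) ↔ Link x y u v := by
  constructor
  · have key : ∀ {x y u v : ℝ}, (∃ a b c d : ℝ, a < b ∧ b < c ∧ c < d ∧ d < a + 1 ∧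
        s((x : S1), (y : S1)) = s(((a : ℝ) : S1), ((c : ℝ) : S1)) ∧
        s((u : S1), (v : S1)) = s(((b : ℝ) : S1), ((d : ℝ) : S1))) → Link x y u v := by
      rintro x y u v ⟨a, b, c, d, h1, h2, h3, h4, h5, h6⟩
      have hl := Link.of_lt h1 h2 h3 h4
      rw [Sym2.eq_iff] at h5 h6
      simp only [coe_eq_coe] at h5 h6
      rcases h5 with ⟨⟨i, hi⟩, ⟨j, hj⟩⟩ | ⟨⟨i, hi⟩, ⟨j, hj⟩⟩ <;>
      rcases h6 with ⟨⟨k, hk⟩, ⟨l, hL⟩⟩ | ⟨⟨k, hk⟩, ⟨l, hL⟩⟩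
      · exact hl.congr 0 ⟨i, by simp [hi]⟩ ⟨j, by simp [hj]⟩ ⟨k, by simp [hk]⟩ ⟨l, by simp [hL]⟩
      · exact hl.swap_right.congr 0 ⟨i, by simp [hi]⟩ ⟨j, by simp [hj]⟩ ⟨k, by simp [hk]⟩ ⟨l, by simp [hL]⟩
      · exact hl.swap_left.congr 0 ⟨i, by simp [hi]⟩ ⟨j, by simp [hj]⟩ ⟨k, by simp [hk]⟩ ⟨l, by simp [hL]⟩
      · exact hl.swap_left.swap_right.congr 0 ⟨i, by simp [hi]⟩ ⟨j, by simp [hj]⟩ ⟨k, by simp [hk]⟩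
          ⟨l, by simp [hL]⟩
    rintro (h | h)
    · exact key h
    · exact (key h).symm
  · rintro ⟨i, j, k, ⟨h1, h2, h3, h4⟩ | ⟨h1, h2, h3, h4⟩⟩
    · refine Or.inl ⟨x, u + i, y + j, v + k, h1, h2, h3, h4, ?_, ?_⟩
      · rw [coe_eq_coe.2 ⟨j, rfl⟩]
      · rw [coe_eq_coe.2 ⟨i, rfl⟩, coe_eq_coe.2 ⟨k, rfl⟩]
    · refine Or.inl ⟨x, v + k, y + j, u + i, h1, h2, h3, h4, ?_, ?_⟩
      · rw [coe_eq_coe.2 ⟨j, rfl⟩]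
      · rw [coe_eq_coe.2 ⟨i, rfl⟩, coe_eq_coe.2 ⟨k, rfl⟩, Sym2.eq_swap]

section
variable {a t : ℝ}

lemma continuous_nd : Continuous nd := by
  have : nd = fun x : ℝ => ‖((x : ℝ) : S1)‖ := funext fun x => (norm_coe x).symm
  rw [this]
  exact continuous_norm.comp (AddCircle.continuous_mk' 1)

lemma in_iff {C : Cl} {x : ℝ} :
    In a t C x ↔ nd ((x - C.lo a t - C.wid t / 2) * (2 / C.pp)) ≤ C.wid t / C.pp := by
  have hp : (0:ℝ) < C.pp := by rcases C.pp_cases_real with h | h <;> rw [h] <;> norm_num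
  have e : ∀ n : ℤ, |(x - C.lo a t - C.wid t / 2) * (2 / C.pp) - n| ≤ C.wid t / C.pp ↔
      C.lo a t ≤ x - C.pp / 2 * n ∧ x - C.pp / 2 * n ≤ C.lo a t + C.wid t := by
    intro n
    have : (x - C.lo a t - C.wid t / 2) * (2 / C.pp) - n =
      (x - C.lo a t - C.wid t / 2 - C.pp / 2 * n) * 2 / C.pp := by field_simp
    rw [this, abs_div, abs_of_pos hp, div_le_div_iff_of_pos_right hp, abs_le]
    constructor
    · rintro ⟨h1, h2⟩; constructor <;> linarith
    · rintro ⟨h1, h2⟩; constructor <;> linarith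
  constructor
  · rintro ⟨n, hn⟩
    exact (nd_le _ n).trans ((e n).2 hn)
  · intro h
    obtain ⟨n, hn⟩ := nd_exists ((x - C.lo a t - C.wid t / 2) * (2 / C.pp))
    exact ⟨n, (e n).1 (hn ▸ h)⟩

instance : Finite Cl :=
  Finite.of_surjective ![Cl.p1, Cl.pm, Cl.p0, Cl.q1, Cl.q2, Cl.q4, Cl.q5] fun C => by
    cases C
    exacts [⟨0, rfl⟩, ⟨1, rfl⟩, ⟨2, rfl⟩, ⟨3, rfl⟩, ⟨4, rfl⟩, ⟨5, rfl⟩, ⟨6, rfl⟩]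

lemma isClosed_in (C : Cl) : IsClosed {x : ℝ | In a t C x} := by
  simp only [in_iff]
  exact isClosed_le (continuous_nd.comp (by fun_prop)) continuous_const

lemma isClosed_cell : IsClosed {p : ℝ × ℝ | Cell a t p.1 p.2} := by
  have : {p : ℝ × ℝ | Cell a t p.1 p.2} = ⋃ C : Cl, {p | In a t C p.1 ∧ In a t C p.2} := by
    ext p; simp [Cell]
  rw [this]
  exact isClosed_iUnion_of_finite fun C => ((isClosed_in C).preimage continuous_fst).inter
    ((isClosed_in C).preimage continuous_snd)

lemma isClosed_not_link :
    IsClosed {q : (ℝ × ℝ) × ℝ × ℝ | ¬ Link q.1.1 q.1.2 q.2.1 q.2.2} := by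
  rw [← isOpen_compl_iff]
  have : {q : (ℝ × ℝ) × ℝ × ℝ | ¬ Link q.1.1 q.1.2 q.2.1 q.2.2}ᶜ = ⋃ (i : ℤ) (j : ℤ) (k : ℤ),
      {q : (ℝ × ℝ) × ℝ × ℝ | (q.1.1 < q.2.1 + i ∧ q.2.1 + i < q.1.2 + j ∧ q.1.2 + j < q.2.2 + k ∧
        q.2.2 + k < q.1.1 + 1) ∨ (q.1.1 < q.2.2 + k ∧ q.2.2 + k < q.1.2 + j ∧
        q.1.2 + j < q.2.1 + i ∧ q.2.1 + i < q.1.1 + 1)} := by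
    ext q; simp only [mem_compl_iff, mem_ofPred_eq, not_not, mem_iUnion, Link]
  rw [this]
  refine isOpen_iUnion fun i => isOpen_iUnion fun j => isOpen_iUnion fun k => ?_
  simp only [ofPred_or, ofPred_and]
  refine IsOpen.union (IsOpen.inter ?_ (IsOpen.inter ?_ (IsOpen.inter ?_ ?_)))
    (IsOpen.inter ?_ (IsOpen.inter ?_ (IsOpen.inter ?_ ?_)))
  all_goals exact isOpen_lt (by fun_prop) (by fun_prop)

variable (a t) in
/-- Limits of leaves, as pairs of lifts of endpoints. -/
def Lim : Set (ℝ × ℝ) := closure {p | Leaf a t p.1 p.2}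

variable (a t) in
/-- The lamination generated by a short chord. -/
def lam : Set Chord := {ℓ | ∃ x y : ℝ, (x, y) ∈ Lim a t ∧ ℓ = s((x : S1), (y : S1))}

lemma Lim.map {f g : ℝ × ℝ → ℝ} (hf : Continuous f) (hg : Continuous g)
    (h : ∀ x y, Leaf a t x y → Leaf a t (f (x, y)) (g (x, y))) {x y : ℝ} (hx : (x, y) ∈ Lim a t) :
    (f (x, y), g (x, y)) ∈ Lim a t :=
  (show MapsTo (fun p => (f p, g p)) {p | Leaf a t p.1 p.2} {p | Leaf a t p.1 p.2} from
    fun _ hp => h _ _ hp).closure (hf.prodMk hg) hx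

lemma Leaf.lim {x y : ℝ} (h : Leaf a t x y) : (x, y) ∈ Lim a t := subset_closure h

lemma Lim.symm {x y : ℝ} (hx : (x, y) ∈ Lim a t) : (y, x) ∈ Lim a t :=
  Lim.map (f := Prod.snd) (g := Prod.fst) (by fun_prop) (by fun_prop) (fun _ _ h => h.symm) hx

lemma Lim.add {x y : ℝ} (hx : (x, y) ∈ Lim a t) (k i j : ℤ) :
    (x + k / 2 + i, y + k / 2 + j) ∈ Lim a t :=
  Lim.map (f := fun p => p.1 + k / 2 + i) (g := fun p => p.2 + k / 2 + j) (by fun_prop)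
    (by fun_prop) (fun _ _ h => h.add k i j) hx

lemma Lim.cell {x y : ℝ} (hx : (x, y) ∈ Lim a t) : Cell a t x y :=
  closure_minimal (s := {p : ℝ × ℝ | Leaf a t p.1 p.2}) (t := {p | Cell a t p.1 p.2})
    (fun p hp => by simpa using hp.1 0) isClosed_cell hx

lemma Lim.not_link (ht : 0 < t) (ht6 : t < 1/6) {x y u v : ℝ} (hx : (x, y) ∈ Lim a t)
    (hu : (u, v) ∈ Lim a t) : ¬ Link x y u v := by
  have h : ((x, y), (u, v)) ∈ closure ({p | Leaf a t p.1 p.2} ×ˢ {p | Leaf a t p.1 p.2}) := by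
    rw [closure_prod_eq]; exact ⟨hx, hu⟩
  exact closure_minimal (fun q hq => hq.1.not_link ht ht6 hq.2) isClosed_not_link h

lemma nd_sub_int (z : ℝ) (n : ℤ) : nd (z - n) = nd z := by
  simpa [sub_eq_add_neg] using nd_add_int z (-n)

lemma Cell.le_abs (ht : 0 < t) (ht6 : t < 1/6) {x y : ℝ} (h : Cell a t x y) :
    t ≤ |1/3 - nd (x - y)| := by
  obtain ⟨C, ⟨n, h1, h2⟩, ⟨m, h3, h4⟩⟩ := h
  have key : C.pp = 2 → nd (x - y) ≤ C.wid t := by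
    intro hp
    simp only [hp] at h1 h2 h3 h4
    refine (nd_le _ (n - m)).trans (abs_le.2 ⟨?_, ?_⟩) <;> push_cast at * <;> linarith
  cases C <;> simp only [Cl.pp, Cl.wid, true_implies] at key
  case p0 =>
    simp only [Cl.lo, Cl.wid, Cl.pp] at h1 h2 h3 h4
    obtain ⟨l, hl | hl⟩ := Int.even_or_odd' (n - m)
    · have e : (n:ℝ) = m + 2 * l := by
        have : n = m + 2 * l := by omega
        exact_mod_cast this
      have : nd (x - y) ≤ 1/6 - t := by
        refine (nd_le _ l).trans (abs_le.2 ⟨?_, ?_⟩) <;> push_cast at * <;> linarith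
      rw [abs_of_pos] <;> linarith
    · have e : (n:ℝ) = m + 2 * l + 1 := by
        have : n = m + 2 * l + 1 := by omega
        exact_mod_cast this
      have e2 : nd (1/2 : ℝ) = 1/2 := by
        rw [nd_eq (n := 0)] <;> norm_num
      have e3 : (1/2 : ℝ) = (x - y - l) + -(x - y - l - 1/2) := by ring
      have e4 : nd (-(x - y - l - 1/2)) ≤ 1/6 - t := by
        rw [nd_neg]
        refine (nd_le_abs _).trans (abs_le.2 ⟨?_, ?_⟩) <;> push_cast at * <;> linarith
      have e5 := nd_add_le (x - y - l) (-(x - y - l - 1/2))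
      rw [← e3, e2, nd_sub_int] at e5
      rw [abs_of_neg] <;> linarith
  all_goals rw [abs_of_pos] <;> linarith

lemma Cell.le_sixth (ht : 0 < t) (ht6 : t < 1/6) {x y : ℝ} (h : Cell a t x y)
    (hx : Hol a t 0 x) : nd (x - y) ≤ 1/6 := by
  obtain ⟨C, ⟨n, h1, h2⟩, ⟨m, h3, h4⟩⟩ := h
  obtain ⟨l, h5, h6⟩ := hx
  push_cast at h5 h6
  have hC : C = .pm := by
    cases C <;> first | rfl | exfalso
    all_goals
      simp only [Cl.lo, Cl.wid, Cl.pp, Int.cast_ofNat, Int.cast_one] at h1 h2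
      have g1 : (l + n : ℝ) ≤ -1 ∨ (0 : ℝ) ≤ l + n := by
        rcases lt_or_ge (l + n) 0 with h | h
        · left; exact_mod_cast (show l + n ≤ -1 by omega)
        · right; exact_mod_cast h
      have g2 : (2 * l + n : ℝ) ≤ -1 ∨ (0 : ℝ) ≤ 2 * l + n := by
        rcases lt_or_ge (2 * l + n) 0 with h | h
        · left; exact_mod_cast (show 2 * l + n ≤ -1 by omega)
        · right; exact_mod_cast h
      rcases g1 with g1 | g1 <;> rcases g2 with g2 | g2 <;> linarith
  subst hC
  simp only [Cl.lo, Cl.wid, Cl.pp, Int.cast_ofNat] at h1 h2 h3 h4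
  have e : l + n = -1 := by
    have e1 : (-2:ℝ) < l + n := by linarith
    have e2 : (l + n : ℝ) < 0 := by linarith
    have e1 : -2 < l + n := by exact_mod_cast e1
    have e2 : l + n < 0 := by exact_mod_cast e2
    omega
  have e : (l:ℝ) = -1 - n := by
    have : l = -1 - n := by omega
    exact_mod_cast this
  refine (nd_le _ (n - m)).trans (abs_le.2 ⟨?_, ?_⟩) <;> push_cast <;> linarith
end

section
variable {a t : ℝ}

lemma mem_lam {x y : ℝ} (h : (x, y) ∈ Lim a t) : s((x : S1), (y : S1)) ∈ lam a t := ⟨x, y, h, rfl⟩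

lemma cmap_s3 (x y : ℝ) : cmap s3 s((x : S1), (y : S1)) =
    s(((3*x : ℝ) : S1), ((3*y : ℝ) : S1)) := by
  simp [cmap, s3_coe]

lemma cmap_iterate (k : ℕ) (x y : ℝ) : cmap (s3^[k]) s((x : S1), (y : S1)) =
    s(((3^k*x : ℝ) : S1), ((3^k*y : ℝ) : S1)) := by
  simp [cmap, s3_iterate_coe]

lemma cmap_antip (x y : ℝ) : cmap antip s((x : S1), (y : S1)) =
    s(((x + 1/2 : ℝ) : S1), ((y + 1/2 : ℝ) : S1)) := by
  simp only [cmap, Sym2.map_mk, antip_coe]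

lemma continuous_toC : Continuous fun x : ℝ => toC (x : S1) := by
  simp only [toC_coe]; fun_prop

lemma coe_add_int (x : ℝ) (n : ℤ) : ((x + n : ℝ) : S1) = (x : S1) := coe_eq_coe.2 ⟨n, rfl⟩

lemma ne_of_three {x u : ℝ} (h : ((3 * x : ℝ) : S1) ≠ ((3 * u : ℝ) : S1)) : (x : S1) ≠ (u : S1) := by
  intro e
  rw [← s3_coe, ← s3_coe, e] at h
  exact h rfl

lemma third_ne {x y : ℝ} {i : ℤ} (h : y = x + i / 3) (hi : ¬ (3 ∣ i)) : (x : S1) ≠ (y : S1) := by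
  rw [Ne, coe_eq_coe]
  rintro ⟨n, hn⟩
  refine hi ⟨-n, ?_⟩
  have : (i:ℝ) = 3 * (-n : ℤ) := by push_cast; linarith
  exact_mod_cast this

lemma isClosed_unionSet_lam : IsClosed (unionSet (lam a t)) := by
  have hK : IsCompact ((Lim a t ∩ (Icc 0 1 ×ˢ Icc 0 1)) ×ˢ (Icc (0:ℝ) 1)) :=
    ((isCompact_Icc.prod isCompact_Icc).inter_left isClosed_closure).prod isCompact_Icc
  have hF : Continuous fun q : (ℝ × ℝ) × ℝ =>
      (1 - q.2) • toC (q.1.1 : S1) + q.2 • toC (q.1.2 : S1) :=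
    ((continuous_const.sub continuous_snd).smul (continuous_toC.comp (by fun_prop))).add
      (continuous_snd.smul (continuous_toC.comp (by fun_prop)))
  convert (hK.image hF).isClosed using 1
  ext z
  simp only [unionSet, mem_iUnion, exists_prop, mem_image]
  constructor
  · rintro ⟨ℓ, ⟨x, y, hxy, rfl⟩, hz⟩
    rw [chordSet_coe, segment_eq_image] at hz
    obtain ⟨s, hs, rfl⟩ := hz
    have h := Lim.add hxy 0 (-⌊x⌋) (-⌊y⌋)
    refine ⟨((x + (0:ℤ)/2 + (-⌊x⌋ : ℤ), y + (0:ℤ)/2 + (-⌊y⌋ : ℤ)), s), ⟨⟨h, ?_, ?_⟩, hs⟩, ?_⟩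
    · constructor <;> push_cast <;> linarith [Int.floor_le x, Int.lt_floor_add_one x]
    · constructor <;> push_cast <;> linarith [Int.floor_le y, Int.lt_floor_add_one y]
    · simp only [coe_add_int]
      simp
  · rintro ⟨⟨⟨x, y⟩, s⟩, ⟨⟨h, -⟩, hs⟩, rfl⟩
    refine ⟨_, mem_lam h, ?_⟩
    rw [chordSet_coe, segment_eq_image]
    exact ⟨s, hs, rfl⟩

variable (ht : 0 < t) (ht6 : t < 1/6) (hB : Leaf a t (3*a) (3*a+3*t))
include ht ht6 hB

omit ht ht6 in
lemma Lim.three {x y : ℝ} (hx : (x, y) ∈ Lim a t) : (3 * x, 3 * y) ∈ Lim a t :=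
  Lim.map (f := fun p => 3 * p.1) (g := fun p => 3 * p.2) (by fun_prop)
    (by fun_prop) (fun _ _ h => hB.three h) hx

lemma Lim.siblings {x y : ℝ} (h : (x, y) ∈ Lim a t) :
    ((x+1/3, y+1/3) ∈ Lim a t ∧ (x+2/3, y+2/3) ∈ Lim a t) ∨
    ((x+1/3, y+2/3) ∈ Lim a t ∧ (x+2/3, y+1/3) ∈ Lim a t) := by
  have key : ∀ r s : ℝ, IsClosed {p : ℝ × ℝ | (p.1 + r, p.2 + s) ∈ Lim a t} := fun r s =>
    isClosed_closure.preimage (f := fun p : ℝ × ℝ => (p.1 + r, p.2 + s)) (by fun_prop)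
  exact closure_minimal (s := {p : ℝ × ℝ | Leaf a t p.1 p.2})
    (fun p hp => (hB.siblings ht ht6 hp).imp (fun h => ⟨h.1.lim, h.2.lim⟩)
      (fun h => ⟨h.1.lim, h.2.lim⟩))
    (((key _ _).inter (key _ _)).union ((key _ _).inter (key _ _))) h

lemma Lim.exists_third {x y : ℝ} (h : (x, y) ∈ Lim a t) :
    ∃ i j : Fin 3, ((x + (i:ℕ))/3, (y + (j:ℕ))/3) ∈ Lim a t := by
  have : IsClosed (⋃ (i : Fin 3) (j : Fin 3),
      {p : ℝ × ℝ | ((p.1 + (i:ℕ))/3, (p.2 + (j:ℕ))/3) ∈ Lim a t}) :=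
    isClosed_iUnion_of_finite fun i => isClosed_iUnion_of_finite fun j =>
      isClosed_closure.preimage (f := fun p : ℝ × ℝ => ((p.1 + (i:ℕ))/3, (p.2 + (j:ℕ))/3))
        (by fun_prop)
  have := closure_minimal (s := {p : ℝ × ℝ | Leaf a t p.1 p.2}) (fun p hp => by
    obtain ⟨i, j, h⟩ := hB.exists_third ht ht6 hp
    exact mem_iUnion.2 ⟨i, mem_iUnion.2 ⟨j, h.lim⟩⟩) this h
  simpa using this

lemma lam_siblings {x y : ℝ} (h : (x, y) ∈ Lim a t)
    (hd : ((3 * x : ℝ) : S1) ≠ ((3 * y : ℝ) : S1)) : ∃ ℓ₂ ∈ lam a t, ∃ ℓ₃ ∈ lam a t,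
      IsSiblingCollection s((x : S1), (y : S1)) ℓ₂ ℓ₃ := by
  have dis : ∀ {x y u v : ℝ} (i j : ℤ), (x, y) ∈ Lim a t → (u, v) ∈ Lim a t →
      ((3 * x : ℝ) : S1) ≠ ((3 * y : ℝ) : S1) → u = x + i / 3 → v = y + j / 3 → ¬ 3 ∣ i → ¬ 3 ∣ j →
      Disjoint (chordSet s((x : S1), (y : S1))) (chordSet s((u : S1), (v : S1))) := by
    intro x y u v i j h h' hd hu hv hi hj
    refine disjoint_chordSet (Lim.not_link ht ht6 h h') (third_ne hu hi) (ne_of_three ?_)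
      (ne_of_three ?_) (third_ne hv hj)
    · rw [show 3 * v = 3 * y + j by rw [hv]; ring, coe_add_int]; exact hd
    · rw [show 3 * u = 3 * x + i by rw [hu]; ring, coe_add_int]; exact hd.symm
  have img : ∀ (i j : ℤ), cmap s3 s(((x + i / 3 : ℝ) : S1), ((y + j / 3 : ℝ) : S1)) =
      cmap s3 s((x : S1), (y : S1)) := by
    intro i j
    rw [cmap_s3, cmap_s3, show 3 * (x + i/3 : ℝ) = 3 * x + i by ring,
      show 3 * (y + j/3 : ℝ) = 3 * y + j by ring, coe_add_int, coe_add_int]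
  have hdi : ¬ (cmap s3 s((x : S1), (y : S1))).IsDiag := by
    rw [cmap_s3, Sym2.mk_isDiag_iff]; exact hd
  have hd' : ∀ (i j : ℤ), ((3 * (x + i/3) : ℝ) : S1) ≠ ((3 * (y + j/3) : ℝ) : S1) := by
    intro i j
    rw [show 3 * (x + i/3 : ℝ) = 3 * x + i by ring,
      show 3 * (y + j/3 : ℝ) = 3 * y + j by ring, coe_add_int, coe_add_int]
    exact hd
  have key : ∀ i j i' j' : ℤ, ¬ 3 ∣ i → ¬ 3 ∣ j → ¬ 3 ∣ i' → ¬ 3 ∣ j' → ¬ 3 ∣ i' - i →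
      ¬ 3 ∣ j' - j → (x + i / 3, y + j / 3) ∈ Lim a t → (x + i' / 3, y + j' / 3) ∈ Lim a t →
      ∃ ℓ₂ ∈ lam a t, ∃ ℓ₃ ∈ lam a t, IsSiblingCollection s((x : S1), (y : S1)) ℓ₂ ℓ₃ := by
    intro i j i' j' h1 h2 h3 h4 h5 h6 m1 m2
    exact ⟨_, mem_lam m1, _, mem_lam m2, dis i j h m1 hd rfl rfl h1 h2,
      dis i' j' h m2 hd rfl rfl h3 h4, dis (i' - i) (j' - j) m1 m2 (hd' _ _)
      (by push_cast; ring) (by push_cast; ring) h5 h6, hdi, img _ _, img _ _⟩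
  rcases Lim.siblings ht ht6 hB h with ⟨h1, h2⟩ | ⟨h1, h2⟩
  · exact key 1 1 2 2 (by norm_num) (by norm_num) (by norm_num) (by norm_num) (by norm_num)
      (by norm_num) (by simpa using h1) (by simpa using h2)
  · exact key 1 2 2 1 (by norm_num) (by norm_num) (by norm_num) (by norm_num) (by norm_num)
      (by norm_num) (by simpa using h1) (by simpa using h2)

lemma isCubicSymLam_lam : IsCubicSymLam (lam a t) where
  nocross := by
    rintro _ ⟨x, y, h, rfl⟩ _ ⟨u, v, h', rfl⟩
    rw [crosses_iff]
    exact Lim.not_link ht ht6 h h'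
  closed := isClosed_unionSet_lam
  forward := by
    rintro _ ⟨x, y, h, rfl⟩
    rw [cmap_s3]
    exact Or.inl (mem_lam (Lim.three hB h))
  backward := by
    rintro _ ⟨x, y, h, rfl⟩
    obtain ⟨i, j, h'⟩ := Lim.exists_third ht ht6 hB h
    refine ⟨_, mem_lam h', ?_⟩
    have e : ∀ (z : ℝ) (i : Fin 3), ((3 * ((z + (i:ℕ))/3) : ℝ) : S1) = z := fun z i =>
      coe_eq_coe.2 ⟨(i : ℕ), by push_cast; ring⟩
    rw [cmap_s3, e, e]
  siblings := by
    rintro _ ⟨x, y, h, rfl⟩ hd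
    rw [cmap_s3, Sym2.mk_isDiag_iff] at hd
    exact lam_siblings ht ht6 hB h hd
  symm := by
    rintro _ ⟨x, y, h, rfl⟩
    rw [cmap_antip]
    exact mem_lam (by simpa using Lim.add h 1 0 0)

lemma mem_csCL : s((a : S1), ((a + t : ℝ) : S1)) ∈ CsCL := by
  have h0 : (a, a + t) ∈ Lim a t := by simpa using (leaf_hole ht ht6 hB 0 0 0).lim
  have nd0 : nd (a - (a + t)) = t := by
    have h2 : |t - (0:ℤ)| ≤ 1/2 := by rw [Int.cast_zero, sub_zero, abs_of_pos ht]; linarith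
    rw [show a - (a + t) = -t by ring, nd_neg, nd_eq h2, Int.cast_zero, sub_zero, abs_of_pos ht]
  have hM : (a + 2/3, a + t + 1/3) ∈ Lim a t := by
    refine (Leaf.lift (x' := 3*a) (y' := 3*a+3*t) ⟨.p1, ⟨0, ?_, ?_⟩, ⟨0, ?_, ?_⟩⟩ hB ⟨2, ?_⟩
      ⟨1, ?_⟩).lim <;> (try simp only [Cl.lo, Cl.wid, Cl.pp]) <;> push_cast <;> linarith
  have ndM : |1/3 - nd (a + 2/3 - (a + t + 1/3))| = t := by
    rw [show a + 2/3 - (a + t + 1/3) = 1/3 - t by ring, nd_eq (n := 0), Int.cast_zero, sub_zero,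
      abs_of_pos (show 0 < 1/3 - t by linarith)]
    · rw [show 1/3 - (1/3 - t) = t by ring, abs_of_pos ht]
    · rw [Int.cast_zero, sub_zero, abs_of_pos (show 0 < 1/3 - t by linarith)]; linarith
  refine ⟨lam a t, isCubicSymLam_lam ht ht6 hB, Or.inl ?_, fun _ => mem_lam h0,
    ⟨_, ⟨mem_lam hM, ?_⟩, ?_⟩, ?_⟩
  · rw [chordLen_coe, nd0]; exact ht6
  · rintro _ ⟨x, y, h, rfl⟩
    rw [chordLen_coe, chordLen_coe, ndM]
    exact (Lim.cell h).le_abs ht ht6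
  · have e1 : ((3 * a : ℝ) : S1) = ((3 * (a + 2/3) : ℝ) : S1) :=
      coe_eq_coe.2 ⟨-2, by push_cast; ring⟩
    have e2 : ((3 * (a + t) : ℝ) : S1) = ((3 * (a + t + 1/3) : ℝ) : S1) :=
      coe_eq_coe.2 ⟨-1, by push_cast; ring⟩
    rw [cmap_s3, cmap_s3, e1, e2]
  · rintro _ ⟨⟨u, v, h, rfl⟩, hm⟩
    have hm := hm _ (mem_lam hM)
    rw [chordLen_coe, chordLen_coe, ndM] at hm
    have far : ∀ {u v : ℝ}, (u, v) ∈ Lim a t → |1/3 - nd (u - v)| ≤ t → ¬ Hol a t 0 u := by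
      intro u v h hm hu
      have := (Lim.cell h).le_sixth ht ht6 hu
      rw [abs_of_pos (by linarith)] at hm
      linarith
    have far' : ∀ {u v : ℝ}, (u, v) ∈ Lim a t → |1/3 - nd (u - v)| ≤ t →
        (a : S1) ≠ u ∧ ((a + t : ℝ) : S1) ≠ u := by
      intro u v h hm
      refine ⟨fun e => ?_, fun e => ?_⟩ <;> obtain ⟨n, hn⟩ := coe_eq_coe.1 e
      · exact far h hm ⟨n, by push_cast; linarith, by push_cast; linarith⟩
      · exact far h hm ⟨n, by push_cast; linarith, by push_cast; linarith⟩
    have hm' : |1/3 - nd (v - u)| ≤ t := by rwa [← nd_neg, neg_sub]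
    exact disjoint_chordSet (Lim.not_link ht ht6 h0 h) (far' h hm).1 (far' (Lim.symm h) hm').1
      (far' h hm).2 (far' (Lim.symm h) hm').2

omit hB in
lemma coPeriodic {k : ℕ} (h : LF a t k (3*a) (3*a+3*t)) :
    CoPeriodic s((a : S1), ((a + t : ℝ) : S1)) := by
  constructor
  · refine ⟨2 * (k + 1), by omega, ?_⟩
    rw [cmap_s3, cmap_iterate]
    have e : ∀ z : ℝ, 3^(2*(k+1)) * z = 3^(k+1) * (3 * (3^k * z)) := by intro z; ring
    have odd : ∀ n : ℤ, ∃ m : ℤ, (3^(k+1) * (n / 2) + n / 2 : ℝ) = m := by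
      intro n
      obtain ⟨l, hl⟩ : Odd (3^(k+1) : ℤ) := Odd.pow (by decide)
      refine ⟨n * (l + 1), ?_⟩
      have : (3^(k+1) : ℝ) = 2 * l + 1 := by exact_mod_cast hl
      rw [this]; push_cast; ring
    have e2 : 3 * (a + t) = 3*a + 3*t := by ring
    rw [e2, e, e]
    have hK : ∀ z : ℝ, (3:ℝ)^(k+1) * z = 3 * (3^k * z) := by intro z; ring
    rcases h.2 with h | h <;> obtain ⟨n, j, h1, h2⟩ := h.image <;> obtain ⟨m, hm⟩ := odd n <;>
      rw [h1, h2]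
    · have f1 : ((3^(k+1) * (3*a + n/2) : ℝ) : S1) = ((3*a : ℝ) : S1) :=
        coe_eq_coe.2 ⟨m, by rw [mul_add, hK (3*a), h1]; linarith⟩
      have f2 : ((3^(k+1) * (3*a + 3*t + n/2 + j) : ℝ) : S1) = ((3*a + 3*t : ℝ) : S1) :=
        coe_eq_coe.2 ⟨m + 3^(k+1)*j + j, by
          rw [mul_add, mul_add, hK (3*a+3*t), h2]; push_cast; linarith⟩
      rw [f1, f2]
    · have f1 : ((3^(k+1) * (3*a + n/2) : ℝ) : S1) = ((3*a + 3*t : ℝ) : S1) :=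
        coe_eq_coe.2 ⟨m + j, by rw [mul_add, hK (3*a), h2]; push_cast; linarith⟩
      have f2 : ((3^(k+1) * (3*a + 3*t + n/2 + j) : ℝ) : S1) = ((3*a : ℝ) : S1) :=
        coe_eq_coe.2 ⟨m + 3^(k+1)*j, by
          rw [mul_add, mul_add, hK (3*a+3*t), h1]; push_cast; linarith⟩
      rw [f1, f2]
  · rintro ⟨p, hp, hc⟩
    obtain ⟨p, rfl⟩ : ∃ q, p = q + 1 := ⟨p - 1, by omega⟩
    have hs := same_of_edge h
    have h1 : nd (3*a - (3*a+3*t)) = 3*t := by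
      rw [show 3*a - (3*a+3*t) = -(3*t) by ring, nd_neg, nd_eq (n := 0)] <;>
        simp only [Int.cast_zero, sub_zero] <;> rw [abs_of_pos (by linarith)]
      linarith
    have h2 := hs.sep_of_sep ht (n := 0) (by simpa using h1.ge) p (by omega)
    have h3 := congrArg chordLen hc
    rw [cmap_iterate, chordLen_coe, chordLen_coe] at h3
    have h4 : nd (a - (a + t)) ≤ t := by
      refine (nd_le_abs _).trans ?_
      rw [show a - (a + t) = -t by ring, abs_neg, abs_of_pos ht]
    rw [show 3^(p+1) * a - 3^(p+1)*(a+t) = 3^p*(3*a) - 3^p*(3*a+3*t) by ring] at h3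
    linarith

omit hB in
lemma csCL_coPeriodic {k : ℕ} (h : LF a t k (3*a) (3*a+3*t)) :
    s((a : S1), ((a + t : ℝ) : S1)) ∈ CsCL ∧ CoPeriodic s((a : S1), ((a + t : ℝ) : S1)) :=
  ⟨mem_csCL ht ht6 ⟨fun j => (same_of_edge h j).cell, k, h.2⟩, coPeriodic ht ht6 h⟩
end

lemma not_link_diag (x u : ℝ) : ¬ Link x x u u := by
  rintro ⟨i, j, k, ⟨h1, h2, h3, h4⟩ | ⟨h1, h2, h3, h4⟩⟩
  · have : (0:ℝ) < j := by linarith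
    have : (j:ℝ) < 1 := by linarith
    norm_cast at *; omega
  · have : (0:ℝ) < j := by linarith
    have : (j:ℝ) < 1 := by linarith
    norm_cast at *; omega

/-- The degenerate chords at the points of order dividing `2 * (3 ^ k - 1)`. -/
def torsionLam (k : ℕ) : Set Chord :=
  {ℓ | ∃ (x : ℝ) (m : ℤ), 2 * (3^k - 1) * x = m ∧ ℓ = s((x : S1), (x : S1))}

lemma torsion_iterate {k : ℕ} {x : ℝ} {m : ℤ} (h : 2 * (3^k - 1) * x = m) :
    ((3^(2*k) * x : ℝ) : S1) = (x : S1) := by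
  obtain ⟨l, hl⟩ : Odd (3^k : ℤ) := Odd.pow (by decide)
  have hl' : (3^k : ℝ) = 2 * l + 1 := by exact_mod_cast hl
  refine coe_eq_coe.2 ⟨m * (l + 1), ?_⟩
  push_cast
  rw [← h, mul_comm 2 k, pow_mul, hl']
  ring

lemma isClosed_unionSet_torsionLam (k : ℕ) : IsClosed (unionSet (torsionLam k)) := by
  have hK : IsCompact (Icc (0:ℝ) 1 ∩ {x : ℝ | 2 * (3^k - 1) * x ∈ range ((↑) : ℤ → ℝ)}) :=
    isCompact_Icc.inter_right
      (Int.isClosedEmbedding_coe_real.isClosed_range.preimage (by fun_prop))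
  convert (hK.image continuous_toC).isClosed using 1
  ext z
  simp only [unionSet, mem_iUnion, exists_prop, mem_image]
  constructor
  · rintro ⟨ℓ, ⟨x, m, hm, rfl⟩, hz⟩
    rw [chordSet_coe, segment_same] at hz
    refine ⟨Int.fract x, ⟨⟨Int.fract_nonneg x, (Int.fract_lt_one x).le⟩,
      m - 2 * (3^k - 1) * ⌊x⌋, ?_⟩, ?_⟩
    · push_cast
      rw [← hm, Int.fract]
      ring
    · rw [hz, coe_eq_coe.2 ⟨-⌊x⌋, by rw [Int.fract]; push_cast; ring⟩]
  · rintro ⟨x, ⟨-, m, hm⟩, rfl⟩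
    refine ⟨_, ⟨x, m, hm.symm, rfl⟩, ?_⟩
    rw [chordSet_coe, segment_same]
    rfl

lemma isCubicSymLam_torsionLam {k : ℕ} (hk : 1 ≤ k) : IsCubicSymLam (torsionLam k) where
  nocross := by
    rintro _ ⟨x, m, h, rfl⟩ _ ⟨u, n, h', rfl⟩
    rw [crosses_iff]
    exact not_link_diag x u
  closed := isClosed_unionSet_torsionLam k
  forward := by
    rintro _ ⟨x, m, h, rfl⟩
    rw [cmap_s3]
    exact Or.inl ⟨_, 3 * m, by push_cast; linarith, rfl⟩
  backward := by
    rintro _ ⟨x, m, h, rfl⟩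
    refine ⟨_, ⟨3^(2*k-1) * x, 3^(2*k-1) * m, by push_cast; rw [← h]; ring, rfl⟩, ?_⟩
    rw [cmap_s3, ← mul_assoc, ← pow_succ', show 2*k - 1 + 1 = 2*k by omega, torsion_iterate h]
  siblings := by
    rintro _ ⟨x, m, h, rfl⟩ hd
    rw [cmap_s3, Sym2.mk_isDiag_iff] at hd
    exact absurd rfl hd
  symm := by
    rintro _ ⟨x, m, h, rfl⟩
    rw [cmap_antip]
    exact ⟨_, m + (3^k - 1), by push_cast; linarith, rfl⟩

/-- The degenerate chords at the preperiodic points `i / (3 * (3 ^ k - 1))`. -/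
lemma degenerate_coPeriodic {k : ℕ} (hk : 1 ≤ k) {i : ℤ} (hi : ¬ 3 ∣ i) {x : ℝ}
    (hx : 3 * (3^k - 1) * x = i) : s((x : S1), (x : S1)) ∈ CsCL ∧ CoPeriodic s((x : S1), (x : S1)) := by
  have no : ∀ {u : ℝ} {m : ℤ}, 2 * (3^k - 1) * u = m → (x : S1) ≠ u := by
    intro u m h e
    obtain ⟨n, hn⟩ := coe_eq_coe.1 e
    have h1 : (2 * i : ℝ) = 3 * (m + 2 * (3^k - 1) * n) := by
      rw [← hx, ← h, hn]; ring
    have h2 : 2 * i = 3 * (m + 2 * (3^k - 1) * n) := by exact_mod_cast h1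
    omega
  have h3 : 2 * (3^k - 1) * (3 * x) = (2 * i : ℤ) := by push_cast; linarith
  refine ⟨⟨torsionLam k, isCubicSymLam_torsionLam hk, Or.inr (by simp), fun h => (h (by simp)).elim,
    ⟨_, ⟨⟨3^(2*k) * x, 3^(2*k-1) * (2*i), ?_, rfl⟩, ?_⟩, ?_⟩, ?_⟩, ⟨2 * k, by omega, ?_⟩, ?_⟩
  · push_cast
    rw [← hx, show 2 * k = 2*k-1+1 by omega, pow_succ]
    simp only [Nat.add_sub_cancel]
    ring
  · rintro _ ⟨u, n, h', rfl⟩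
    simp only [chordLen_coe, sub_self, le_refl]
  · rw [cmap_s3, cmap_s3, ← torsion_iterate h3]
    ring_nf
  · rintro _ ⟨⟨u, n, h', rfl⟩, -⟩
    exact disjoint_chordSet (not_link_diag x u) (no h') (no h') (no h') (no h')
  · rw [cmap_s3, cmap_iterate, torsion_iterate h3]
  · rintro ⟨p, hp, h⟩
    obtain ⟨q, rfl⟩ : ∃ q, p = q + 1 := ⟨p - 1, by omega⟩
    rw [cmap_iterate, Sym2.eq_iff] at h
    obtain ⟨n, hn⟩ := coe_eq_coe.1 (h.elim And.left And.left)
    have h1 : (3 * 3^q - 1) * (i : ℝ) = 3 * ((3^k - 1) * n) := by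
      rw [← hx]
      have : (3 * 3^q - 1) * x = n := by rw [← pow_succ']; linarith
      rw [← this]; ring
    have h2 : (3 * 3^q - 1) * i = 3 * ((3^k - 1) * n) := by exact_mod_cast h1
    exact hi ⟨3^q * i - (3^k - 1) * n, by linarith⟩

lemma exists_degenerate_near (x : ℝ) {ε : ℝ} (hε : 0 < ε) : ∃ y : ℝ, |x - y| < ε ∧
    s((y : S1), (y : S1)) ∈ CsCL ∧ CoPeriodic s((y : S1), (y : S1)) := by
  obtain ⟨k, hk⟩ := pow_unbounded_of_one_lt (1/ε + 1) (show (1:ℝ) < 3 by norm_num)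
  have hk1 : 1 ≤ k := by
    rcases Nat.eq_zero_or_pos k with rfl | h
    · have : 0 < 1/ε := by positivity
      rw [pow_zero] at hk; linarith
    · exact h
  set D : ℝ := 3^k - 1 with hD
  have hD1 : 1/ε < D := by linarith
  have hD0 : 0 < D := lt_trans (by positivity) hD1
  refine ⟨(3 * ⌊D * x⌋ + 1 : ℤ) / (3 * D), ?_, degenerate_coPeriodic hk1
    (i := 3 * ⌊D * x⌋ + 1) (by omega) (by rw [← hD]; field_simp)⟩
  have h1 := Int.floor_le (D * x)
  have h2 := Int.lt_floor_add_one (D * x)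
  have h3 : 1 < D * ε := by rwa [div_lt_iff₀ hε] at hD1
  have e : x - (3 * ⌊D * x⌋ + 1 : ℤ) / (3 * D) = (D * x - ⌊D * x⌋ - 1/3) / D := by
    push_cast; field_simp; ring
  rw [e, abs_div, abs_of_pos hD0, div_lt_iff₀ hD0, abs_lt]
  constructor <;> linarith

section
variable {a t : ℝ}

/-- Both points lie, modulo one, in the interval `[u, v]`. -/
def Both (u v x y : ℝ) : Prop :=
  (∃ i : ℤ, u ≤ x + i ∧ x + i ≤ v) ∧ ∃ i : ℤ, u ≤ y + i ∧ y + i ≤ v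

lemma both_of_not_link {u v x y : ℝ} (h : ¬ Link u v x y) :
    Both u v x y ∨ Both v (u + 1) x y := by
  have rep : ∀ x : ℝ, ∃ i : ℤ, u ≤ x + i ∧ x + i < u + 1 := fun x =>
    ⟨-⌊x - u⌋, by push_cast; linarith [Int.floor_le (x - u)],
      by push_cast; linarith [Int.lt_floor_add_one (x - u)]⟩
  have main : ∀ {x y : ℝ} {i j : ℤ}, ¬ Link u v x y → u ≤ x + i → x + i ≤ v → v < y + j →
      y + j < u + 1 → Both u v x y ∨ Both v (u + 1) x y := by
    intro x y i j h h1 h2 h3 h4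
    rcases h1.eq_or_lt with h1 | h1
    · exact Or.inr ⟨⟨i + 1, by push_cast; linarith, by push_cast; linarith⟩, j, h3.le, h4.le⟩
    rcases h2.eq_or_lt with h2 | h2
    · exact Or.inr ⟨⟨i, by linarith, by linarith⟩, j, h3.le, h4.le⟩
    exact (h ⟨i, 0, j, Or.inl ⟨h1, by simpa using h2, by simpa using h3, h4⟩⟩).elim
  obtain ⟨i, hi1, hi2⟩ := rep x
  obtain ⟨j, hj1, hj2⟩ := rep y
  rcases le_or_gt (x + i) v with hx | hx <;> rcases le_or_gt (y + j) v with hy | hy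
  · exact Or.inl ⟨⟨i, hi1, hx⟩, j, hj1, hy⟩
  · exact main h hi1 hx hy hj2
  · exact (main (fun hl => h hl.swap_right) hj1 hy hx hi2).imp And.symm And.symm
  · exact Or.inr ⟨⟨i, hx.le, hi2.le⟩, j, hy.le, hj2.le⟩

lemma Both.half {u v x y : ℝ} (h : Both (u + 1/2) (v + 1/2) x y) :
    Both u v (x + 1/2) (y + 1/2) := by
  obtain ⟨⟨i, h1, h2⟩, j, h3, h4⟩ := h
  exact ⟨⟨i - 1, by push_cast; linarith, by push_cast; linarith⟩, j - 1, by push_cast; linarith,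
    by push_cast; linarith⟩

lemma split_arc (ht : 0 < t) (ht6 : t < 1/6) {x : ℝ}
    (h : ∃ i : ℤ, a + 1/3 ≤ x + i ∧ x + i ≤ a + t + 2/3)
    (h' : ∃ i : ℤ, a + 2/3 ≤ x + i ∧ x + i ≤ a + t + 4/3) :
    ∃ i : ℤ, (a + 1/3 ≤ x + i ∧ x + i ≤ a + t + 1/3) ∨
      (a + 2/3 ≤ x + i ∧ x + i ≤ a + t + 2/3) := by
  obtain ⟨i, h1, h2⟩ := h
  obtain ⟨j, h3, h4⟩ := h'
  refine ⟨i, ?_⟩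
  have e1 : -1 < j - i := by
    have : (-1:ℝ) < (j:ℝ) - i := by linarith
    exact_mod_cast this
  have e2 : j - i < 2 := by
    have : (j:ℝ) - i < 2 := by linarith
    exact_mod_cast this
  obtain e | e : j = i ∨ j = i + 1 := by omega
  · subst e; exact Or.inr ⟨h3, h2⟩
  · subst e; push_cast at h4; exact Or.inl ⟨h1, by linarith⟩

lemma cell_of_strip (ht : 0 < t) (ht6 : t < 1/6) {x y : ℝ}
    (h : Both (a + 1/3) (a + t + 2/3) x y) (h' : Both (a + 2/3) (a + t + 4/3) x y)
    (hl : t ≤ |1/3 - nd (x - y)|) : Cell a t x y := by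
  have main : ∀ {x y : ℝ} {i j : ℤ}, t ≤ |1/3 - nd (x - y)| → a + 1/3 ≤ x + i →
      x + i ≤ a + t + 1/3 → a + 2/3 ≤ y + j → y + j ≤ a + t + 2/3 → Cell a t x y := by
    intro x y i j hl h1 h2 h3 h4
    have hd : nd (x - y) = (y + j) - (x + i) := by
      have e : |y + j - (x + i) - (0:ℤ)| = y + j - (x + i) := by
        rw [Int.cast_zero, sub_zero, abs_of_pos (by linarith)]
      rw [← nd_neg, show -(x - y) = y + j - (x + i) + (i - j : ℤ) by push_cast; ring, nd_add_int,
        nd_eq (n := 0), e]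
      rw [e]; linarith
    rw [hd] at hl
    rcases le_abs.1 hl with hl | hl
    · refine ⟨.p1, ⟨-i, ?_, ?_⟩, ⟨-j, ?_, ?_⟩⟩ <;> simp only [Cl.lo, Cl.wid, Cl.pp] <;>
        push_cast <;> linarith
    · refine ⟨.p0, ⟨-2 * i, ?_, ?_⟩, ⟨-2 * j + 1, ?_, ?_⟩⟩ <;>
        simp only [Cl.lo, Cl.wid, Cl.pp] <;> push_cast <;> linarith
  obtain ⟨i, hi⟩ := split_arc ht ht6 h.1 h'.1
  obtain ⟨j, hj⟩ := split_arc ht ht6 h.2 h'.2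
  have hl' : t ≤ |1/3 - nd (y - x)| := by rwa [← nd_neg, neg_sub]
  rcases hi with hi | hi <;> rcases hj with hj | hj
  · refine ⟨.q2, ⟨-i, ?_, ?_⟩, ⟨-j, ?_, ?_⟩⟩ <;> simp only [Cl.lo, Cl.wid, Cl.pp] <;>
      push_cast <;> linarith
  · exact main hl hi.1 hi.2 hj.1 hj.2
  · exact (main hl' hj.1 hj.2 hi.1 hi.2).symm
  · refine ⟨.q4, ⟨-i, ?_, ?_⟩, ⟨-j, ?_, ?_⟩⟩ <;> simp only [Cl.lo, Cl.wid, Cl.pp] <;>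
      push_cast <;> linarith

lemma in_p0_of_arcs (ht : 0 < t) (ht6 : t < 1/6) {x : ℝ}
    (h : ∃ i : ℤ, a + t + 2/3 ≤ x + i ∧ x + i ≤ a + 4/3)
    (h' : ∃ i : ℤ, a + t + 1/6 ≤ x + i ∧ x + i ≤ a + 5/6) : In a t .p0 x := by
  obtain ⟨i, h1, h2⟩ := h
  obtain ⟨j, h3, h4⟩ := h'
  have e1 : -1 < i - j := by
    have : (-1:ℝ) < (i:ℝ) - j := by linarith
    exact_mod_cast this
  have e2 : i - j < 2 := by
    have : (i:ℝ) - j < 2 := by linarith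
    exact_mod_cast this
  obtain e | e : i = j ∨ i = j + 1 := by omega
  · subst e
    refine ⟨-2 * i + 1, ?_, ?_⟩ <;> simp only [Cl.lo, Cl.wid, Cl.pp] <;> push_cast <;> linarith
  · subst e
    push_cast at h1 h2
    refine ⟨-2 * j, ?_, ?_⟩ <;> simp only [Cl.lo, Cl.wid, Cl.pp] <;> push_cast <;> linarith

lemma cell_of_not_link (ht : 0 < t) (ht6 : t < 1/6) {x y : ℝ}
    (h1 : ¬ Link (a + t + 1/3) (a + 2/3) x y) (h2 : ¬ Link (a + 1/3) (a + t + 2/3) x y)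
    (h3 : ¬ Link (a + t + 5/6) (a + 7/6) x y) (h4 : ¬ Link (a + t + 1/6) (a + 5/6) x y)
    (hl : t ≤ |1/3 - nd (x - y)|) : Cell a t x y := by
  rcases both_of_not_link h1 with ⟨⟨i, _, _⟩, j, _, _⟩ | g1
  · refine ⟨.p1, ⟨-i, ?_, ?_⟩, ⟨-j, ?_, ?_⟩⟩ <;> simp only [Cl.lo, Cl.wid, Cl.pp] <;>
      push_cast <;> linarith
  rcases both_of_not_link h3 with ⟨⟨i, _, _⟩, j, _, _⟩ | g3
  · refine ⟨.pm, ⟨-i, ?_, ?_⟩, ⟨-j, ?_, ?_⟩⟩ <;> simp only [Cl.lo, Cl.wid, Cl.pp] <;>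
      push_cast <;> linarith
  rcases both_of_not_link h2 with g2 | g2
  · exact cell_of_strip ht ht6 g2 (by convert g1 using 1; ring) hl
  rcases both_of_not_link h4 with g4 | g4
  · have e : a + 1/3 + 1 = a + 4/3 := by ring
    rw [e] at g2
    exact ⟨.p0, in_p0_of_arcs ht ht6 g2.1 g4.1, in_p0_of_arcs ht ht6 g2.2 g4.2⟩
  · have e : Both (a + 1/3) (a + t + 2/3) (x + 1/2) (y + 1/2) := by
      refine Both.half ?_
      convert g4 using 1 <;> ring
    have e' : Both (a + 2/3) (a + t + 4/3) (x + 1/2) (y + 1/2) := by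
      refine Both.half ?_
      convert g3 using 1 <;> ring
    have := (cell_of_strip ht ht6 e e' (by rwa [add_sub_add_right_eq_sub])).add (-1) 0 0
    convert this using 1 <;> push_cast <;> ring

lemma cellP_of_cell (ht : 0 < t) {x y : ℝ} (h : Cell a t x y) (hd : 3 * t ≤ nd (x - y)) :
    CellP a t x y := by
  obtain ⟨C, hx, hy⟩ := h
  refine ⟨C, ?_, hx, hy⟩
  by_contra hC
  have hp : C.pp = 2 ∧ C.wid t = t := by
    cases C <;> simp_all [Cl.isP, Cl.pp, Cl.wid]
  obtain ⟨n, h1, h2⟩ := hx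
  obtain ⟨m, h3, h4⟩ := hy
  rw [hp.1, hp.2] at *
  have := (nd_le (x - y) (n - m)).trans (abs_le.2 ⟨show -t ≤ _ by push_cast; push_cast at *; linarith,
    by push_cast; push_cast at *; linarith⟩)
  linarith
end

section
variable {L : Set Chord}

lemma add_half_mem (hL : IsCubicSymLam L) {x y : ℝ} (h : s((x : S1), (y : S1)) ∈ L)
    (k : ℤ) : s(((x + k/2 : ℝ) : S1), ((y + k/2 : ℝ) : S1)) ∈ L := by
  obtain ⟨l, rfl | rfl⟩ := Int.even_or_odd' k
  · have e : ∀ x : ℝ, ((x + (2 * l : ℤ)/2 : ℝ) : S1) = x := fun x =>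
      coe_eq_coe.2 ⟨l, by push_cast; ring⟩
    rwa [e, e]
  · have e : ∀ x : ℝ, ((x + (2 * l + 1 : ℤ)/2 : ℝ) : S1) = ((x + 1/2 : ℝ) : S1) := fun x =>
      coe_eq_coe.2 ⟨l, by push_cast; ring⟩
    rw [e, e, ← cmap_antip]
    exact hL.symm _ h

lemma three_mem (hL : IsInvLam L) {x y : ℝ} (h : s((x : S1), (y : S1)) ∈ L)
    (hd : 0 < nd (3 * x - 3 * y)) : s(((3 * x : ℝ) : S1), ((3 * y : ℝ) : S1)) ∈ L := by
  rcases hL.forward _ h with h | h <;> rw [cmap_s3] at h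
  · exact h
  · rw [Sym2.mk_isDiag_iff] at h
    rw [← chordLen_coe, h] at hd
    simp [chordLen] at hd

lemma not_link_of_mem (hL : IsLamination L) {x y u v : ℝ} (h : s((x : S1), (y : S1)) ∈ L)
    (h' : s((u : S1), (v : S1)) ∈ L) : ¬ Link x y u v :=
  crosses_iff.not.1 (hL.nocross _ h _ h')

lemma nd_of_mem {z : ℝ} (h0 : 0 ≤ z) (h : z ≤ 1/2) : nd z = z := by
  have h2 : |z - (0:ℤ)| ≤ 1/2 := by rw [Int.cast_zero, sub_zero, abs_of_nonneg h0]; exact h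
  rw [nd_eq h2, Int.cast_zero, sub_zero, abs_of_nonneg h0]

lemma exists_lift {c : Chord} (hc : ¬ c.IsDiag) : ∃ a t : ℝ, 0 < t ∧ t = chordLen c ∧
    c = s((a : S1), ((a + t : ℝ) : S1)) := by
  induction c using Sym2.ind with
  | _ p q =>
  obtain ⟨x, rfl⟩ := exists_coe p
  obtain ⟨y, rfl⟩ := exists_coe q
  rw [Sym2.mk_isDiag_iff, coe_eq_coe] at hc
  obtain ⟨n, hn⟩ := nd_exists (x - y)
  rw [chordLen_coe, hn]
  have h0 : x - y - n ≠ 0 := fun h => hc ⟨n, by linarith⟩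
  refine (lt_or_gt_of_ne h0).elim (fun h => ⟨x, |x - y - n|, abs_pos.2 h0, rfl, ?_⟩)
    (fun h => ⟨y, |x - y - n|, abs_pos.2 h0, rfl, ?_⟩)
  · rw [abs_of_neg h, show x + -(x - y - n) = y + n by ring, coe_add_int]
  · rw [abs_of_pos h, show y + (x - y - n) = x + (-n : ℤ) by push_cast; ring, coe_add_int, Sym2.eq_swap]

lemma exists_abs_le_sixth (hL : IsInvLam L) {a t : ℝ} (ht : 0 < t) (ht6 : t < 1/6)
    (h : s((a : S1), ((a + t : ℝ) : S1)) ∈ L) : ∃ ℓ ∈ L, |1/3 - chordLen ℓ| ≤ 1/6 := by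
  have hex : ∃ k : ℕ, 1/6 ≤ 3^k * t := by
    obtain ⟨k, hk⟩ := pow_unbounded_of_one_lt (1/6/t) (show (1:ℝ) < 3 by norm_num)
    exact ⟨k, ((div_lt_iff₀ ht).1 hk).le⟩
  classical
  have nde : ∀ k : ℕ, 3^k * t < 1/2 → nd (3^k * a - 3^k * (a + t)) = 3^k * t := by
    intro k hk
    rw [show 3^k * a - 3^k * (a + t) = -(3^k * t) by ring, nd_neg,
      nd_of_mem (by positivity) hk.le]
  have lt_half : ∀ k ≤ Nat.find hex, 3^k * t < 1/2 := by
    intro k hk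
    cases k with
    | zero => rw [pow_zero]; linarith
    | succ k =>
      have := Nat.find_min hex (Nat.lt_of_succ_le hk)
      rw [pow_succ]; linarith
  have mem : ∀ k ≤ Nat.find hex, s(((3^k * a : ℝ) : S1), ((3^k * (a + t) : ℝ) : S1)) ∈ L := by
    intro k
    induction k with
    | zero => simpa using h
    | succ k ih =>
      intro hk
      have := nde _ (lt_half _ hk)
      rw [pow_succ', mul_assoc, mul_assoc] at this ⊢
      exact three_mem hL (ih (by omega)) (by rw [this]; positivity)
  refine ⟨_, mem _ le_rfl, ?_⟩
  rw [chordLen_coe, nde _ (lt_half _ le_rfl), abs_le]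
  have h1 := Nat.find_spec hex
  have h2 := lt_half _ le_rfl
  constructor <;> linarith

lemma exists_third_of_s3_eq {x u : ℝ} (h : ((3 * x : ℝ) : S1) = ((3 * u : ℝ) : S1)) :
    ∃ n : ℕ, n < 3 ∧ (x : S1) = ((u + n / 3 : ℝ) : S1) := by
  obtain ⟨n, hn⟩ := coe_eq_coe.1 h
  refine ⟨(n % 3).toNat, by omega, coe_eq_coe.2 ⟨n / 3, ?_⟩⟩
  have e : (((n % 3).toNat : ℤ) : ℝ) + 3 * (n / 3 : ℤ) = n := by
    have : ((n % 3).toNat : ℤ) + 3 * (n / 3) = n := by omega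
    exact_mod_cast this
  rw [Int.cast_natCast] at e
  linarith

lemma exists_thirds_of_s3_eq {a b : ℝ} {M : Chord}
    (h : cmap s3 s((a : S1), (b : S1)) = cmap s3 M) : ∃ n m : ℕ, n < 3 ∧ m < 3 ∧
      M = s(((a + n / 3 : ℝ) : S1), ((b + m / 3 : ℝ) : S1)) := by
  induction M using Sym2.ind with
  | _ p q =>
  obtain ⟨x, rfl⟩ := exists_coe p
  obtain ⟨y, rfl⟩ := exists_coe q
  rw [cmap_s3, cmap_s3, Sym2.eq_iff] at h
  rcases h with ⟨h1, h2⟩ | ⟨h1, h2⟩ <;> obtain ⟨n, hn, e1⟩ := exists_third_of_s3_eq h1.symm <;>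
    obtain ⟨m, hm, e2⟩ := exists_third_of_s3_eq h2.symm
  · exact ⟨n, m, hn, hm, by rw [e1, e2]⟩
  · exact ⟨n, m, hn, hm, by rw [e1, e2, Sym2.eq_swap]⟩

lemma ne_of_disjoint {p q r s : S1} (h : Disjoint (chordSet s(p, q)) (chordSet s(r, s))) :
    p ≠ r ∧ q ≠ s := by
  constructor <;> rintro rfl
  · exact Set.disjoint_left.1 h (left_mem_segment ℝ (toC p) (toC q))
      (left_mem_segment ℝ (toC p) (toC s))
  · exact Set.disjoint_left.1 h (right_mem_segment ℝ (toC p) (toC q))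
      (right_mem_segment ℝ (toC r) (toC q))

lemma thirds_ne_of_disjoint {a b : ℝ} {n m n' m' : ℕ}
    (h : Disjoint (chordSet s(((a + n / 3 : ℝ) : S1), ((b + m / 3 : ℝ) : S1)))
      (chordSet s(((a + n' / 3 : ℝ) : S1), ((b + m' / 3 : ℝ) : S1)))) : n ≠ n' ∧ m ≠ m' := by
  obtain ⟨h1, h2⟩ := ne_of_disjoint h
  exact ⟨fun e => h1 (by rw [e]), fun e => h2 (by rw [e])⟩

/-- A nondegenerate comajor determines both of its long siblings, which are majors. -/
lemma long_siblings_mem (hL : IsCubicSymLam L) {a t : ℝ} (ht : 0 < t) (ht6 : t < 1/6)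
    (hc : IsComajor L s((a : S1), ((a + t : ℝ) : S1))) :
    s(((a + 2/3 : ℝ) : S1), ((a + t + 1/3 : ℝ) : S1)) ∈ L ∧
    s(((a + 1/3 : ℝ) : S1), ((a + t + 2/3 : ℝ) : S1)) ∈ L ∧
    ∀ ℓ ∈ L, t ≤ |1/3 - chordLen ℓ| := by
  obtain ⟨-, hcL, ⟨M, hM, hcM⟩, hdis⟩ := hc
  have nd1 : nd (3 * a - 3 * (a + t)) = 3 * t := by
    rw [show 3 * a - 3 * (a + t) = -(3 * t) by ring, nd_neg,
      nd_of_mem (by linarith) (by linarith)]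
  have hndc : ¬ (cmap s3 s((a : S1), ((a + t : ℝ) : S1))).IsDiag := by
    rw [cmap_s3, Sym2.mk_isDiag_iff]
    intro e
    rw [← chordLen_coe, e] at nd1
    simp [chordLen] at nd1
    linarith
  replace hcL := hcL fun h => hndc (by
    rw [Sym2.mk_isDiag_iff] at h
    rw [h]; simp [cmap])
  obtain ⟨n, m, hn, hm, rfl⟩ := exists_thirds_of_s3_eq hcM
  have dis0 : ∀ {n m : ℕ}, IsMajor L s(((a + n / 3 : ℝ) : S1), ((a + t + m / 3 : ℝ) : S1)) →
      0 ≠ n ∧ 0 ≠ m := fun h =>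
    thirds_ne_of_disjoint (a := a) (b := a + t) (by
      rw [Nat.cast_zero, zero_div, add_zero, add_zero]; exact hdis _ h)
  have hnm := dis0 hM
  -- the three possible distances to one third
  have len : ∀ n m : ℕ, |1/3 - chordLen s(((a + n / 3 : ℝ) : S1), ((a + t + m / 3 : ℝ) : S1))| =
      |1/3 - nd (t + (m - n) / 3)| := by
    intro n m
    rw [chordLen_coe, ← nd_neg]
    congr 3; ring
  have len1 : nd (t + 1/3) = 1/3 + t := by
    rw [nd_of_mem (by linarith) (by linarith)]; ring
  have len2 : nd (t + -(1/3)) = 1/3 - t := by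
    rw [← nd_neg, nd_of_mem (by linarith) (by linarith)]; ring
  have d1 : |1/3 - (1/3 + t)| = t := by
    rw [show (1:ℝ)/3 - (1/3 + t) = -t by ring, abs_neg, abs_of_pos ht]
  have d2 : |1/3 - (1/3 - t)| = t := by
    rw [show (1:ℝ)/3 - (1/3 - t) = t by ring, abs_of_pos ht]
  have hlen : ∀ n m : ℕ, n < 3 → m < 3 → n ≠ m →
      |1/3 - chordLen s(((a + n / 3 : ℝ) : S1), ((a + t + m / 3 : ℝ) : S1))| = t := by
    intro n m hn hm hne
    have i1 : t + (2:ℝ)/3 = t + -(1/3) + (1:ℤ) := by push_cast; ring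
    have i2 : t + -((2:ℝ)/3) = t + 1/3 - (1:ℤ) := by push_cast; ring
    rw [len]
    interval_cases n <;> interval_cases m <;> first | exact absurd rfl hne | norm_num
    · rw [len1, d1]
    · rw [i1, nd_add_int, len2, d2]
    · rw [len2, d2]
    · rw [len1, d1]
    · rw [i2, nd_sub_int, len1, d1]
    · rw [len2, d2]
  have hne : n ≠ m := by
    rintro rfl
    obtain ⟨ℓ, hℓ, h1⟩ := exists_abs_le_sixth hL.toIsInvLam ht ht6 hcL
    have h2 := (hM.2 ℓ hℓ).trans h1
    rw [len, sub_self, zero_div, add_zero, nd_of_mem ht.le (by linarith),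
      abs_of_pos (by linarith)] at h2
    linarith
  have hall : ∀ ℓ ∈ L, t ≤ |1/3 - chordLen ℓ| := fun ℓ hℓ => by
    rw [← hlen n m hn hm hne]; exact hM.2 ℓ hℓ
  obtain ⟨ℓ₂, h2, ℓ₃, h3, s1, s2, s3, -, s4, s5⟩ := hL.siblings _ hM.1 (hcM ▸ hndc)
  obtain ⟨n2, m2, hn2, hm2, rfl⟩ := exists_thirds_of_s3_eq (hcM.trans s4.symm)
  obtain ⟨n3, m3, hn3, hm3, rfl⟩ := exists_thirds_of_s3_eq (hcM.trans s5.symm)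
  have t1 := thirds_ne_of_disjoint s1
  have t2 := thirds_ne_of_disjoint s2
  have t3 := thirds_ne_of_disjoint s3
  have maj : ∀ {n m : ℕ}, n < 3 → m < 3 → s(((a + n / 3 : ℝ) : S1), ((a + t + m / 3 : ℝ) : S1)) ∈ L →
      n = 0 → m = 0 := by
    intro n m hn hm h hn0
    by_contra hm0
    refine (dis0 ⟨h, fun ℓ hℓ => ?_⟩).1 hn0.symm
    rw [hlen n m hn hm (by omega)]
    exact hall ℓ hℓ
  have k2 := maj hn2 hm2 h2
  have k3 := maj hn3 hm3 h3
  have hM' : s(((a + m / 3 : ℝ) : S1), ((a + t + n / 3 : ℝ) : S1)) ∈ L := by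
    obtain ⟨rfl, rfl⟩ | ⟨rfl, rfl⟩ : (n2 = m ∧ m2 = n) ∨ (n3 = m ∧ m3 = n) := by omega
    · exact h2
    · exact h3
  obtain ⟨rfl, rfl⟩ | ⟨rfl, rfl⟩ : (n = 2 ∧ m = 1) ∨ (n = 1 ∧ m = 2) := by omega
  · exact ⟨by simpa using hM.1, by simpa using hM', hall⟩
  · exact ⟨by simpa using hM', by simpa using hM.1, hall⟩

lemma cellP_of_mem (hL : IsCubicSymLam L) {a t : ℝ} (ht : 0 < t) (ht6 : t < 1/6)
    (hc : IsComajor L s((a : S1), ((a + t : ℝ) : S1))) {x y : ℝ} (h : s((x : S1), (y : S1)) ∈ L)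
    (hd : 3 * t ≤ nd (x - y)) : CellP a t x y := by
  obtain ⟨h1, h2, h3⟩ := long_siblings_mem hL ht ht6 hc
  have hl := hL.toIsLamination
  have e1 := add_half_mem hL h1 1
  have e2 := add_half_mem hL h2 1
  refine cellP_of_cell ht (cell_of_not_link ht ht6 ?_ ?_ ?_ ?_ (chordLen_coe x y ▸ h3 _ h)) hd
  · exact fun h' => not_link_of_mem hl h1 h h'.swap_left
  · exact not_link_of_mem hl h2 h
  · refine fun h' => not_link_of_mem hl e1 h (h'.swap_left.congr 0 ⟨0, ?_⟩ ⟨0, ?_⟩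
      ⟨0, by simp⟩ ⟨0, by simp⟩) <;> push_cast <;> ring
  · refine fun h' => not_link_of_mem hl e2 h (h'.swap_left.congr 0 ⟨0, ?_⟩ ⟨1, ?_⟩
      ⟨0, by simp⟩ ⟨0, by simp⟩) <;> push_cast <;> ring

lemma orbit_mem (hL : IsCubicSymLam L) {a t : ℝ} (ht : 0 < t) (ht6 : t < 1/6)
    (hc : IsComajor L s((a : S1), ((a + t : ℝ) : S1))) (k : ℕ) :
    s(((3^k * (3*a) : ℝ) : S1), ((3^k * (3*a + 3*t) : ℝ) : S1)) ∈ L ∧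
      3 * t ≤ nd (3^k * (3*a) - 3^k * (3*a + 3*t)) := by
  have nd0 : ∀ {s : ℝ}, 0 < s → s < 1/2 → nd (a - (a + s)) = s := by
    intro s hs hs2
    rw [show a - (a + s) = -s by ring, nd_neg, nd_of_mem hs.le hs2.le]
  induction k with
  | zero =>
    have h3 : nd (3 * a - (3 * a + 3 * t)) = 3 * t := by
      rw [show 3 * a - (3 * a + 3 * t) = a - (a + 3 * t) by ring, nd0] <;> linarith
    simp only [pow_zero, one_mul, h3, le_refl, and_true]
    have e : 3 * a + 3 * t = 3 * (a + t) := by ring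
    rw [e] at h3 ⊢
    refine three_mem hL.toIsInvLam (hc.2.1 fun h => ?_) (by rw [h3]; linarith)
    rw [Sym2.mk_isDiag_iff] at h
    have := nd0 ht (by linarith)
    rw [← chordLen_coe, ← h] at this
    simp [chordLen] at this
    linarith
  | succ k ih =>
    have h1 := (cellP_of_mem hL ht ht6 hc ih.1 ih.2).grow ht
    have h2 : 3 * t ≤ nd (3 * (3^k * (3*a)) - 3 * (3^k * (3*a + 3*t))) :=
      (le_min (by linarith [ih.2]) le_rfl).trans h1
    rw [pow_succ', mul_assoc, mul_assoc]
    exact ⟨three_mem hL.toIsInvLam ih.1 (by linarith), h2⟩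

end

section
variable {L : Set Chord}

lemma coPeriodic_near (hL : IsCubicSymLam L) {a t : ℝ} (ht : 0 < t) (ht6 : t < 1/6)
    (hc : IsComajor L s((a : S1), ((a + t : ℝ) : S1))) {ε : ℝ} (hε : 0 < ε) :
    ∃ a' t', |a' - a| < ε ∧ |a' + t' - (a + t)| < ε ∧ 0 < t' ∧ t' < 1/6 ∧
      ∃ k, LF a' t' k (3*a') (3*a'+3*t') := by
  have horb := orbit_mem hL ht ht6 hc
  have H1 : Same a t (3*a) (3*a+3*t) := fun k =>
    cellP_of_mem hL ht ht6 hc (horb k).1 (horb k).2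
  have H2 : ∀ i j : ℕ, ∀ k : ℤ, ¬ Link (3^i*(3*a)) (3^i*(3*a+3*t))
      (3^j*(3*a) + k/2) (3^j*(3*a+3*t) + k/2) := fun i j k =>
    not_link_of_mem hL.toIsLamination (horb i).1 (add_half_mem hL (horb j).1 k)
  by_cases NE : ∃ k, LF a t k (3*a) (3*a+3*t)
  · exact ⟨a, t, by simpa using hε, by simpa using hε, ht, ht6, NE⟩
  by_cases hs : ∀ x, 3*a < x → x < 3*a+3*t → ¬ Same a t (3*a) x
  · exact approx_short ht ht6 H1 hs hε
  push Not at hs NE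
  obtain ⟨x, hx1, hx2, hx⟩ := hs
  refine approx_long ht ht6 H1 NE (fun y hy1 hy2 hy => ?_) hε
  exact not_link_of_class ht ht6 H1 hx (H1.trans ht ht6 hy) H2 (Link.of_lt hx1 hx2 hy1 hy2)

end

end Comajor

theorem coperiodic_comajors_dense :
    ∀ c ∈ CsCL, ∀ ε : ℝ, 0 < ε →
      ∃ c' ∈ CsCL, CoPeriodic c' ∧
        ∃ a b a' b' : S1, c = s(a, b) ∧ c' = s(a', b') ∧
          ‖a - a'‖ < ε ∧ ‖b - b'‖ < ε := by
  rintro c ⟨L, hL, hc⟩ ε hε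
  have dist : ∀ {x y : ℝ}, |x - y| < ε → ‖(x : S1) - (y : S1)‖ < ε := by
    intro x y h
    rw [← AddCircle.coe_sub, Comajor.norm_coe]
    exact (Comajor.nd_le_abs _).trans_lt h
  by_cases hd : c.IsDiag
  · induction c using Sym2.ind with
    | _ p q =>
    obtain rfl : p = q := hd
    obtain ⟨x, rfl⟩ := Comajor.exists_coe p
    obtain ⟨y, hy, h1, h2⟩ := Comajor.exists_degenerate_near x hε
    exact ⟨_, h1, h2, x, x, y, y, rfl, rfl, dist hy, dist hy⟩
  · obtain ⟨a, t, ht, htc, rfl⟩ := Comajor.exists_lift hd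
    have ht6 : t < 1/6 := htc ▸ hc.1.resolve_right hd
    obtain ⟨a', t', h1, h2, ht', ht6', k, hk⟩ := Comajor.coPeriodic_near hL ht ht6 hc hε
    obtain ⟨h3, h4⟩ := Comajor.csCL_coPeriodic ht' ht6' hk
    exact ⟨_, h3, h4, a, _, a', _, rfl, rfl, dist (by rwa [abs_sub_comm]),
      dist (by rwa [abs_sub_comm])⟩

end
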